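/- arXiv:2306.02195 — 8 statements merged into one kernel-verified Lean document; each statement's English description precedes it below -/
import Mathlib

section
/- For every finite simple graph G and every positive integer ℓ, semiweak_ℓ(G) ≤ gcol_{⌈ℓ/2⌉,ℓ}(G). In fact, for every linear ordering σ of V(G) and every vertex y, SubReach_ℓ(G,σ,y) ⊆ GReach_{⌈ℓ/2⌉,ℓ}[G,σ,y]. -/
/-- The set of vertices `k`-hop `ℓ`-reachable from `v` with respect to the ordering `σ`. -/
def GReach {V : Type} (G : SimpleGraph V) (σ : V → ℕ) (k ℓ : ℕ) (v : V) : Set V :=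
  {u | ∃ p : G.Walk v u, p.IsPath ∧ p.length ≤ ℓ ∧
    (∀ i < p.length, σ u < σ (p.getVert i)) ∧
    {j : ℕ | 1 ≤ j ∧ j ≤ p.length ∧
      ∀ i < j, σ (p.getVert j) < σ (p.getVert i)}.ncard ≤ k}

/-- The `k`-hop `ℓ`-colouring number of the ordering `σ`. -/
noncomputable def gcolOrd {V : Type} [Fintype V] (G : SimpleGraph V) (σ : V → ℕ)
    (k ℓ : ℕ) : ℕ :=
  Finset.univ.sup fun v => (GReach G σ k ℓ v).ncard

/-- The `k`-hop `ℓ`-colouring number of `G`: minimum over all linear orderings. -/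
noncomputable def gcol {V : Type} [Fintype V] (G : SimpleGraph V) (k ℓ : ℕ) : ℕ :=
  sInf {n : ℕ | ∃ σ : V → ℕ, Function.Injective σ ∧ gcolOrd G σ k ℓ = n}

/-- `x ∈ SubReach_k(G,σ,y)`: there is a path `z_0 z_1 ⋯ z_s` with `z_0 = x`, `z_s = y`,
`s ≤ k`, `x` the `σ`-minimum vertex of the path, and `y ≤_σ z_i` for `⌈k/2⌉ ≤ i ≤ s`. -/
def SubReach {V : Type} (G : SimpleGraph V) (σ : V → ℕ) (k : ℕ) (y : V) : Set V :=
  {x | ∃ p : G.Walk x y, p.IsPath ∧ p.length ≤ k ∧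
    (∀ i ≤ p.length, σ x ≤ σ (p.getVert i)) ∧
    (∀ i, (k + 1) / 2 ≤ i → i ≤ p.length → σ y ≤ σ (p.getVert i))}

/-- The semi-weak `k`-colouring number of the ordering `σ`. -/
noncomputable def semiweakOrd {V : Type} [Fintype V] (G : SimpleGraph V) (σ : V → ℕ)
    (k : ℕ) : ℕ :=
  Finset.univ.sup fun y => (SubReach G σ k y).ncard

/-- The semi-weak `k`-colouring number of `G`: minimum over all linear orderings. -/
noncomputable def semiweak {V : Type} [Fintype V] (G : SimpleGraph V) (k : ℕ) : ℕ :=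
  sInf {n : ℕ | ∃ σ : V → ℕ, Function.Injective σ ∧ semiweakOrd G σ k = n}

/-- Reversing a path witnessing sub-reachability, the left-to-right minima after the start `y` lie
below `y`, hence among the last `⌈ℓ/2⌉` positions. -/
theorem subReach_subset_gReach {V : Type} (G : SimpleGraph V) (ℓ : ℕ) {σ : V → ℕ}
    (hσ : Function.Injective σ) (y : V) :
    SubReach G σ ℓ y ⊆ GReach G σ ((ℓ + 1) / 2) ℓ y := by
  rintro x ⟨p, hp, hlen, hmin, hhalf⟩
  refine ⟨p.reverse, hp.reverse, by simpa using hlen, fun i hi => ?_, ?_⟩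
  · rw [SimpleGraph.Walk.length_reverse] at hi
    rw [SimpleGraph.Walk.getVert_reverse]
    refine lt_of_le_of_ne (hmin _ (Nat.sub_le _ _)) fun h => ?_
    have h0 : p.getVert 0 = p.getVert (p.length - i) := by
      rw [SimpleGraph.Walk.getVert_zero]
      exact hσ h
    have := hp.getVert_injOn (Nat.zero_le p.length) (Nat.sub_le p.length i) h0
    omega
  · have hsub : {j : ℕ | 1 ≤ j ∧ j ≤ p.reverse.length ∧
        ∀ i < j, σ (p.reverse.getVert j) < σ (p.reverse.getVert i)} ⊆
        (Finset.Ioc (p.length - (ℓ + 1) / 2) p.length : Set ℕ) := by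
      rintro j ⟨hj, hjlen, hrec⟩
      rw [SimpleGraph.Walk.length_reverse] at hjlen
      have hlt := hrec 0 hj
      rw [SimpleGraph.Walk.getVert_zero, SimpleGraph.Walk.getVert_reverse] at hlt
      have hpos : p.length - j < (ℓ + 1) / 2 := by
        by_contra! h
        exact absurd (hhalf _ h (Nat.sub_le _ _)) hlt.not_ge
      rw [Finset.mem_coe, Finset.mem_Ioc]
      omega
    refine (Set.ncard_le_ncard hsub (Finset.finite_toSet _)).trans ?_
    rw [Set.ncard_coe_finset, Nat.card_Ioc]
    omega

/-- `semiweak_ℓ(G) ≤ gcol_{⌈ℓ/2⌉,ℓ}(G)`; in fact for every ordering `σ` and vertex `y`,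
`SubReach_ℓ(G,σ,y) ⊆ GReach_{⌈ℓ/2⌉,ℓ}[G,σ,y]`. -/
theorem semiweak_le_gcol {V : Type} [Fintype V] (G : SimpleGraph V) (ℓ : ℕ)
    (hℓ : 0 < ℓ) :
    (∀ σ : V → ℕ, Function.Injective σ → ∀ y : V,
      SubReach G σ ℓ y ⊆ GReach G σ ((ℓ + 1) / 2) ℓ y) ∧
    semiweak G ℓ ≤ gcol G ((ℓ + 1) / 2) ℓ := by
  refine ⟨fun σ hσ y => subReach_subset_gReach G ℓ hσ y, ?_⟩
  obtain ⟨τ, hτ⟩ := exists_injective_nat V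
  obtain ⟨σ, hσ, hmin⟩ := Nat.sInf_mem
    (s := {n : ℕ | ∃ σ : V → ℕ, Function.Injective σ ∧ gcolOrd G σ ((ℓ + 1) / 2) ℓ = n})
    ⟨_, τ, hτ, rfl⟩
  calc semiweak G ℓ ≤ semiweakOrd G σ ℓ := Nat.sInf_le ⟨σ, hσ, rfl⟩
    _ ≤ gcolOrd G σ ((ℓ + 1) / 2) ℓ := Finset.sup_mono_fun fun y _ =>
        Set.ncard_le_ncard (subReach_subset_gReach G ℓ hσ y) (Set.toFinite _)
    _ = gcol G ((ℓ + 1) / 2) ℓ := hmin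
end

section
/- Let t be a positive integer, G a t-tree, and L a simplicial ordering of V(G). Then for every vertex v ∈ V(G), Reach_∞[G,L,v] = Reach_1[G,L,v], i.e. the set of vertices 1-hop reachable from v by paths of arbitrary length equals {v} ∪ {u : uv ∈ E(G), u <_L v}. -/
/-- `σ` witnesses that `G` is a `t`-tree with simplicial ordering `σ`: `G` is finite with at
least `t+1` vertices, the first `t+1` vertices (in the order `σ`) are pairwise adjacent to
all earlier vertices, every later vertex has exactly `t` earlier neighbours, and the set of
earlier neighbours of any vertex is a clique. -/
def IsTTreeOrder {W : Type} (H : SimpleGraph W) (t : ℕ) (σ : W → ℕ) : Prop :=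
  Finite W ∧ Function.Injective σ ∧ t + 1 ≤ Nat.card W ∧
  ∀ v : W,
    ({u : W | σ u < σ v}.ncard ≤ t → ∀ u : W, σ u < σ v → H.Adj u v) ∧
    (t + 1 ≤ {u : W | σ u < σ v}.ncard → {u : W | H.Adj u v ∧ σ u < σ v}.ncard = t) ∧
    H.IsClique {u : W | H.Adj u v ∧ σ u < σ v}

/-- `Reach_∞[G,σ,v]`: the set of vertices `1`-hop reachable from `v` by paths of arbitrary
length: there is a path from `v` to `u` all of whose vertices except `u` are `σ`-above `u`,
and with at most one "new minimum" index along the path. -/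
def ReachInf {V : Type} (G : SimpleGraph V) (σ : V → ℕ) (v : V) : Set V :=
  {u | ∃ p : G.Walk v u, p.IsPath ∧
    (∀ i < p.length, σ u < σ (p.getVert i)) ∧
    {j : ℕ | 1 ≤ j ∧ j ≤ p.length ∧
      ∀ i < j, σ (p.getVert j) < σ (p.getVert i)}.ncard ≤ 1}

/-- The vertex `a` is joined to `u` by a path whose vertices other than `u` descend in the
order `σ` and have value at least `s`. -/
inductive DescendsTo {V : Type} (G : SimpleGraph V) (σ : V → ℕ) (s : ℕ) (u : V) : V → Prop
  | adj {a : V} : s ≤ σ a → G.Adj a u → DescendsTo G σ s u a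
  | step {a b : V} : G.Adj a b → σ b < σ a → DescendsTo G σ s u b → DescendsTo G σ s u a

namespace DescendsTo

variable {V : Type} {G : SimpleGraph V} {σ : V → ℕ} {s : ℕ} {u : V}

theorem le {a : V} (h : DescendsTo G σ s u a) : s ≤ σ a := by
  induction h with
  | adj hs _ => exact hs
  | step _ hlt _ ih => exact ih.trans hlt.le

/-- When earlier neighbourhoods are cliques, having a descending path to `u` passes to
neighbours with value at least `s`. -/
theorem of_adj (hσ : Function.Injective σ)
    (hG : ∀ v, G.IsClique {w | G.Adj w v ∧ σ w < σ v}) (hu : σ u < s) {b : V}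
    (hb : DescendsTo G σ s u b) : ∀ {a : V}, s ≤ σ a → G.Adj a b → DescendsTo G σ s u a := by
  induction hb with
  | @adj b hs hbu =>
    intro a ha hab
    rcases lt_or_gt_of_ne (hσ.ne hab.ne) with hlt | hgt
    · refine .adj ha (hG b ⟨hab, hlt⟩ ⟨hbu.symm, hu.trans_le hs⟩ ?_)
      rintro rfl
      omega
    · exact .step hab hgt (.adj hs hbu)
  | @step b c hbc hlt hc ih =>
    intro a ha hab
    rcases lt_or_gt_of_ne (hσ.ne hab.ne) with hab_lt | hgt
    · by_cases hac : a = c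
      · exact hac ▸ hc
      · exact ih ha (hG b ⟨hab, hab_lt⟩ ⟨hbc.symm, hlt⟩ hac)
    · exact .step hab hgt (.step hbc hlt hc)

theorem of_walk (hσ : Function.Injective σ)
    (hG : ∀ v, G.IsClique {w | G.Adj w v ∧ σ w < σ v}) (hu : σ u < s) {a : V}
    (p : G.Walk a u) (ha : s ≤ σ a) (hp : ∀ i < p.length, s ≤ σ (p.getVert i)) :
    DescendsTo G σ s u a := by
  induction p with
  | nil => omega
  | @cons a b u hab q ih =>
    have hq : ∀ i < q.length, s ≤ σ (q.getVert i) := fun i hi => by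
      simpa using hp (i + 1) (by simpa using hi)
    cases q with
    | nil => exact .adj ha hab
    | cons hbc r =>
      have hb : s ≤ σ b := by simpa using hq 0 (by simp)
      exact of_adj hσ hG hu (ih hu hb hq) ha hab

theorem adj_of_self {v : V} (h : DescendsTo G σ (σ v) u v) : G.Adj v u := by
  cases h with
  | adj _ h => exact h
  | step _ hlt hb => exact absurd hb.le (by omega)

end DescendsTo

/-- If the endpoint of a walk lies strictly below all other vertices and there is at most one
new minimum along the walk, then no vertex other than the endpoint lies below the start. -/
theorem le_getVert_of_ncard_le_one {V : Type} {G : SimpleGraph V} {σ : V → ℕ} {v u : V}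
    (p : G.Walk v u) (hu : ∀ i < p.length, σ u < σ (p.getVert i))
    (hp : {j : ℕ | 1 ≤ j ∧ j ≤ p.length ∧
      ∀ i < j, σ (p.getVert j) < σ (p.getVert i)}.ncard ≤ 1) :
    ∀ i < p.length, σ v ≤ σ (p.getVert i) := by
  have hfin : {j : ℕ | 1 ≤ j ∧ j ≤ p.length ∧
      ∀ i < j, σ (p.getVert j) < σ (p.getVert i)}.Finite :=
    (Set.finite_Iic p.length).subset fun j hj => hj.2.1
  intro j
  induction j using Nat.strong_induction_on with
  | _ j ih =>
    intro hj
    by_contra! hlt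
    have hj0 : 1 ≤ j := by
      rcases Nat.eq_zero_or_pos j with rfl | h
      · simp at hlt
      · exact h
    have hne : j = p.length := (Set.ncard_le_one hfin).mp hp j
      ⟨hj0, hj.le, fun i hi => hlt.trans_le (ih i hi (hi.trans hj))⟩ p.length
      ⟨by omega, le_rfl, fun i hi => by simpa using hu i hi⟩
    omega

/-- For a `t`-tree `G` with simplicial ordering `σ`, `Reach_∞[G,σ,v] = Reach_1[G,σ,v]`,
i.e. it equals `{v} ∪ {u | uv ∈ E(G), u <_σ v}`. -/
theorem reachInf_eq_reach_one {V : Type} [Fintype V] (G : SimpleGraph V) (t : ℕ)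
    (ht : 0 < t) (σ : V → ℕ) (h : IsTTreeOrder G t σ) (v : V) :
    ReachInf G σ v = {v} ∪ {u : V | G.Adj u v ∧ σ u < σ v} := by
  obtain ⟨-, hσ, -, hv⟩ := h
  ext u
  constructor
  · rintro ⟨p, -, hu, hp⟩
    by_cases huv : u = v
    · exact Or.inl huv
    have hlen : 0 < p.length := by
      rw [Nat.pos_iff_ne_zero]
      exact fun h0 => huv (SimpleGraph.Walk.eq_of_length_eq_zero h0).symm
    have hlt : σ u < σ v := by simpa using hu 0 hlen
    exact Or.inr ⟨(DescendsTo.of_walk hσ (fun w => (hv w).2.2) hlt p le_rfl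
      (le_getVert_of_ncard_le_one p hu hp)).adj_of_self.symm, hlt⟩
  · rintro (rfl | ⟨huv, hlt⟩)
    · refine ⟨.nil, .nil, by simp, ?_⟩
      rw [Set.ncard_le_one ((Set.finite_Iic 0).subset fun j hj => hj.2.1)]
      rintro a ⟨ha, ha', -⟩ b ⟨hb, hb', -⟩
      simp only [SimpleGraph.Walk.length_nil] at ha' hb'
      omega
    · refine ⟨huv.symm.toWalk, by simp [huv.ne'], ?_, ?_⟩
      · intro i hi
        obtain rfl : i = 0 := by simpa using hi
        simpa using hlt
      · rw [Set.ncard_le_one ((Set.finite_Iic 1).subset fun j hj => hj.2.1)]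
        rintro a ⟨ha, ha', -⟩ b ⟨hb, hb', -⟩
        simp only [SimpleGraph.Walk.length_cons, SimpleGraph.Walk.length_nil] at ha' hb'
        omega
end

section
/- Let G be a finite simple graph and L a linear ordering of V(G) such that |Reach_∞[G,L,y]| ≤ t+1 for every y ∈ V(G). Then for every positive integer k and every y ∈ V(G), |WReach_k[G,L,y]| ≤ C(t+k, t) (the binomial coefficient). -/
/-- The vertices reachable from `y` by at most `k` steps of the relation `R`. -/
def stepsWithin {V : Type} (R : V → V → Prop) : ℕ → V → Set V
  | 0, y => {y}
  | k + 1, y => {u | u = y ∨ ∃ a, R y a ∧ u ∈ stepsWithin R k a}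

theorem self_mem_stepsWithin {V : Type} (R : V → V → Prop) (k : ℕ) (y : V) :
    y ∈ stepsWithin R k y := by
  cases k <;> simp [stepsWithin]

theorem stepsWithin_subset_succ {V : Type} (R : V → V → Prop) (k : ℕ) (y : V) :
    stepsWithin R k y ⊆ stepsWithin R (k + 1) y := by
  induction k generalizing y with
  | zero => rintro u rfl; exact Or.inl rfl
  | succ k ih =>
    rintro u (rfl | ⟨a, ha, hu⟩)
    · exact Or.inl rfl
    · exact Or.inr ⟨a, ha, ih a hu⟩

/-- A walk from an in-neighbour `x` of `w` either stays above `w`, or can be rerouted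
through `w`. -/
theorem stepsWithin_subset_union {V : Type} {L : V → ℕ} (hL : Function.Injective L)
    {R : V → V → Prop} (hclique : ∀ x a b, R x a → R x b → L b < L a → R a b) {w : V}
    (k : ℕ) {x : V} (hx : R x w) :
    stepsWithin R k x ⊆
      stepsWithin (fun a b => R a b ∧ L w < L b) k x ∪ stepsWithin R k w := by
  induction k generalizing x with
  | zero => rintro u rfl; exact Or.inl rfl
  | succ k ih =>
    rintro u (rfl | ⟨a, ha, hu⟩)
    · exact Or.inl (Or.inl rfl)
    rcases lt_trichotomy (L a) (L w) with hlt | heq | hgt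
    · exact Or.inr (Or.inr ⟨a, hclique x w a hx ha hlt, hu⟩)
    · obtain rfl := hL heq
      exact Or.inr (stepsWithin_subset_succ R k a hu)
    · rcases ih (hclique x a w ha hx hgt) hu with hu | hu
      · exact Or.inl (Or.inr ⟨a, ⟨ha, hgt⟩, hu⟩)
      · exact Or.inr (stepsWithin_subset_succ R k w hu)

/-- If out-neighbourhoods of an `L`-decreasing relation are cliques of size at most `t`, then at
most `(t + k).choose t` vertices are reachable in at most `k` steps. -/
theorem stepsWithin_ncard_le_choose {V : Type} [Finite V] {L : V → ℕ}
    (hL : Function.Injective L) (t k : ℕ) (R : V → V → Prop)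
    (hclique : ∀ x a b, R x a → R x b → L b < L a → R a b) (y : V)
    (hdeg : ∀ x, Relation.ReflTransGen R y x → {b | R x b}.ncard ≤ t) :
    (stepsWithin R k y).ncard ≤ (t + k).choose t := by
  induction t generalizing k R y with
  | zero =>
    have hempty : {b | R y b} = ∅ :=
      (Set.ncard_eq_zero (Set.toFinite _)).1 (Nat.le_zero.1 (hdeg y .refl))
    have hsub : stepsWithin R k y ⊆ {y} := by
      cases k with
      | zero => rfl
      | succ k =>
        rintro u (rfl | ⟨a, ha, -⟩)
        · rfl
        · exact (Set.eq_empty_iff_forall_notMem.1 hempty a ha).elim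
    simpa using Set.ncard_le_ncard hsub
  | succ t iht =>
    induction k generalizing y with
    | zero => simp [stepsWithin]
    | succ k ihk =>
      rcases Set.eq_empty_or_nonempty {b | R y b} with hempty | hne
      · have hsub : stepsWithin R (k + 1) y ⊆ {y} := by
          rintro u (rfl | ⟨a, ha, -⟩)
          · rfl
          · exact (Set.eq_empty_iff_forall_notMem.1 hempty a ha).elim
        calc (stepsWithin R (k + 1) y).ncard ≤ 1 := by
              simpa using Set.ncard_le_ncard hsub
          _ ≤ _ := Nat.choose_pos (by omega)
      obtain ⟨w, hw, hmin⟩ := Set.exists_min_image _ L (Set.toFinite {b | R y b}) hne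
      have hsub : stepsWithin R (k + 1) y ⊆
          stepsWithin (fun a b => R a b ∧ L w < L b) (k + 1) y ∪ stepsWithin R k w := by
        rintro u (rfl | ⟨a, ha, hu⟩)
        · exact Or.inl (Or.inl rfl)
        rcases (hmin a ha).eq_or_lt with heq | hgt
        · obtain rfl := hL heq
          exact Or.inr hu
        · rcases stepsWithin_subset_union hL hclique k (hclique y a w ha hw hgt) hu with hu | hu
          · exact Or.inl (Or.inr ⟨a, ⟨ha, hgt⟩, hu⟩)
          · exact Or.inr hu
      have habove : (stepsWithin (fun a b => R a b ∧ L w < L b) (k + 1) y).ncard ≤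
          (t + (k + 1)).choose t := by
        refine iht (k + 1) _ (fun x a b ha hb hlt => ⟨hclique x a b ha.1 hb.1 hlt, hb.2⟩) y ?_
        intro x hx
        have hxw : R x w := by
          induction hx with
          | refl => exact hw
          | tail _ hab ih => exact hclique _ _ _ hab.1 ih hab.2
        have hlt : {b | R x b ∧ L w < L b}.ncard < {b | R x b}.ncard :=
          Set.ncard_lt_ncard ⟨fun b hb => hb.1, fun hle => lt_irrefl _ (hle hxw).2⟩
        have := hdeg x (Relation.ReflTransGen.mono (fun _ _ hab => hab.1) _ _ hx)
        omega
      have hbelow : (stepsWithin R k w).ncard ≤ (t + 1 + k).choose (t + 1) :=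
        ihk w fun x hx => hdeg x (.head hw hx)
      calc (stepsWithin R (k + 1) y).ncard
          ≤ _ := Set.ncard_le_ncard hsub
        _ ≤ _ := Set.ncard_union_le _ _
        _ ≤ (t + (k + 1)).choose t + (t + 1 + k).choose (t + 1) := add_le_add habove hbelow
        _ = (t + 1 + (k + 1)).choose (t + 1) := by
          rw [show t + 1 + (k + 1) = (t + 1 + k) + 1 by omega, Nat.choose_succ_succ',
            show t + (k + 1) = t + 1 + k by omega]

/-- The fill-in relation of `G` along `L`: `u` lies below `v` and is joined to it by a walk all
of whose other vertices lie above or at `v`. -/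
def FillIn {V : Type} (G : SimpleGraph V) (L : V → ℕ) (v u : V) : Prop :=
  L u < L v ∧ ∃ p : G.Walk v u, ∀ z ∈ p.support, z = u ∨ L v ≤ L z

theorem FillIn.mem_reachInf {V : Type} {G : SimpleGraph V} {L : V → ℕ} {v u : V}
    (h : FillIn G L v u) : u ∈ ReachInf G L v := by
  classical
  obtain ⟨hlt, p, hp⟩ := h
  have hpath : p.bypass.IsPath := p.bypass_isPath
  have habove : ∀ i < p.bypass.length, L v ≤ L (p.bypass.getVert i) := by
    intro i hi
    refine (hp _ (p.support_bypass_subset_support (p.bypass.getVert_mem_support i))).resolve_left ?_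
    intro heq
    have := (hpath.getVert_eq_end_iff hi.le).1 heq
    omega
  refine ⟨p.bypass, hpath, fun i hi => hlt.trans_le (habove i hi), ?_⟩
  refine (Set.ncard_le_ncard (t := {p.bypass.length}) ?_).trans (Set.ncard_singleton _).le
  rintro j ⟨hj, hjle, hrec⟩
  by_contra hne
  have hv := hrec 0 hj
  rw [SimpleGraph.Walk.getVert_zero] at hv
  exact absurd (habove j (lt_of_le_of_ne hjle hne)) (not_le.2 hv)

theorem self_mem_reachInf {V : Type} (G : SimpleGraph V) (L : V → ℕ) (v : V) :
    v ∈ ReachInf G L v := by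
  refine ⟨.nil, .nil, by simp, ?_⟩
  refine (Set.ncard_le_ncard (t := {0}) ?_).trans (Set.ncard_singleton _).le
  rintro j ⟨-, hj, -⟩
  simpa using hj

theorem FillIn.of_common_source {V : Type} {G : SimpleGraph V} {L : V → ℕ} {x a b : V}
    (ha : FillIn G L x a) (hb : FillIn G L x b) (hlt : L b < L a) : FillIn G L a b := by
  obtain ⟨hxa, p, hp⟩ := ha
  obtain ⟨-, q, hq⟩ := hb
  refine ⟨hlt, p.reverse.append q, fun z hz => ?_⟩
  rw [SimpleGraph.Walk.mem_support_append_iff, SimpleGraph.Walk.support_reverse,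
    List.mem_reverse] at hz
  rcases hz with hz | hz
  · rcases hp z hz with rfl | hz
    · exact Or.inr le_rfl
    · exact Or.inr (hxa.le.trans hz)
  · exact (hq z hz).imp_right hxa.le.trans

/-- A walk descending to its minimum `u` splits at its successive records into fill-in steps;
`q` is the part walked since the last record `x`. -/
theorem mem_stepsWithin_fillIn_of_walk {V : Type} {G : SimpleGraph V} {L : V → ℕ}
    (hL : Function.Injective L) {a u : V} (p : G.Walk a u) (hp : ∀ z ∈ p.support, L u ≤ L z)
    {k : ℕ} (hk : p.length ≤ k) {x : V} (hx : L u ≤ L x) (q : G.Walk x a)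
    (hq : ∀ z ∈ q.support, L x ≤ L z) : u ∈ stepsWithin (FillIn G L) k x := by
  induction p generalizing k x with
  | nil =>
    obtain rfl := hL (le_antisymm hx (hq _ q.end_mem_support))
    exact self_mem_stepsWithin _ _ _
  | @cons a b u hab p ih =>
    have hp' : ∀ z ∈ p.support, L u ≤ L z := fun z hz => hp z (by simp [hz])
    rw [SimpleGraph.Walk.length_cons] at hk
    have hconcat : ∀ z ∈ (q.concat hab).support, z ∈ q.support ∨ z = b := by
      simp [SimpleGraph.Walk.support_concat]
    by_cases hlt : L b < L x
    · obtain ⟨k, rfl⟩ : ∃ m, k = m + 1 := ⟨k - 1, by omega⟩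
      exact Or.inr ⟨b, ⟨hlt, q.concat hab, fun z hz => (hconcat z hz).symm.imp_right (hq z)⟩,
        ih hp' (by omega) (hp' b p.start_mem_support) .nil (by simp)⟩
    · refine ih hp' (by omega) hx (q.concat hab) fun z hz => ?_
      rcases hconcat z hz with hz | rfl
      · exact hq z hz
      · exact not_lt.1 hlt

theorem gReach_subset_stepsWithin_fillIn {V : Type} {G : SimpleGraph V} {L : V → ℕ}
    (hL : Function.Injective L) (k ℓ : ℕ) (v : V) :
    GReach G L k ℓ v ⊆ stepsWithin (FillIn G L) ℓ v := by
  rintro u ⟨p, -, hlen, hmin, -⟩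
  have hp : ∀ z ∈ p.support, L u ≤ L z := by
    intro z hz
    obtain ⟨i, rfl, hi⟩ := SimpleGraph.Walk.mem_support_iff_exists_getVert.1 hz
    rcases hi.eq_or_lt with rfl | hi
    · simp
    · exact (hmin i hi).le
  exact mem_stepsWithin_fillIn_of_walk hL p hp hlen (hp v p.start_mem_support) .nil (by simp)

theorem fillIn_ncard_lt {V : Type} [Finite V] (G : SimpleGraph V) (L : V → ℕ) (v : V) :
    {u | FillIn G L v u}.ncard < (ReachInf G L v).ncard :=
  Set.ncard_lt_ncard ⟨fun _ hu => FillIn.mem_reachInf hu,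
    fun hle => lt_irrefl _ (hle (self_mem_reachInf G L v)).1⟩

/-- If `|Reach_∞[G,L,y]| ≤ t+1` for every `y`, then for every positive `k` and every `y`,
`|WReach_k[G,L,y]| = |GReach_{k,k}[G,L,y]| ≤ C(t+k, t)`. -/
theorem wreach_card_le_choose {V : Type} [Fintype V] (G : SimpleGraph V) (L : V → ℕ)
    (hL : Function.Injective L) (t : ℕ)
    (h : ∀ y : V, (ReachInf G L y).ncard ≤ t + 1) (k : ℕ) (hk : 0 < k) (y : V) :
    (GReach G L k k y).ncard ≤ (t + k).choose t := by
  refine (Set.ncard_le_ncard (gReach_subset_stepsWithin_fillIn hL k k y)).trans ?_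
  exact stepsWithin_ncard_le_choose hL t k _ (fun _ _ _ => FillIn.of_common_source) y
    fun x _ => Nat.lt_succ_iff.1 ((fillIn_ncard_lt G L x).trans_le (h x))
end

section
/- Let k ≤ ℓ and t be positive integers, G a t-tree, and L a simplicial ordering of V(G). Then for every vertex v ∈ V(G), GReach_{k,ℓ}[G,L,v] = WReach_k[G,L,v]. -/
/-- The vertices of the walk `p`, other than its start, at which `σ` is strictly smaller than at
every preceding vertex of `p`. -/
def SimpleGraph.Walk.recordVerts {V : Type} {G : SimpleGraph V} (σ : V → ℕ) {v u : V}
    (p : G.Walk v u) : Set V :=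
  {z | ∃ j, 1 ≤ j ∧ j ≤ p.length ∧ p.getVert j = z ∧ ∀ i < j, σ z < σ (p.getVert i)}

namespace SimpleGraph.Walk

variable {V : Type} {G : SimpleGraph V} {σ : V → ℕ}

/-- If earlier neighbourhoods are cliques, a strictly decreasing walk starting at a later neighbour
of `v` can be rerouted to start at `v`, using only its vertices below `v`. -/
lemma exists_decreasing_of_adj (hσ : Function.Injective σ)
    (hG : ∀ x, G.IsClique {y | G.Adj y x ∧ σ y < σ x}) {w u : V} (q : G.Walk w u) {v : V}
    (hq : q.support.Pairwise (fun a b => σ b < σ a)) (hvw : G.Adj v w) (hlt : σ v < σ w)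
    (huv : σ u < σ v) :
    ∃ r : G.Walk v u, r.support.Pairwise (fun a b => σ b < σ a) ∧
      ∀ z ∈ r.support.tail, z ∈ q.support ∧ σ z < σ v := by
  induction q with
  | nil => omega
  | @cons w y u hwy q ih =>
    rw [support_cons, List.pairwise_cons] at hq
    obtain ⟨hw, hq⟩ := hq
    have hyw : σ y < σ w := hw y q.start_mem_support
    have hqy : ∀ z ∈ q.support.tail, σ z < σ y := by
      rw [← cons_tail_support, List.pairwise_cons] at hq
      exact hq.1
    rcases lt_trichotomy (σ y) (σ v) with hyv | hyv | hyv
    · have hadj : G.Adj v y :=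
        hG w ⟨hvw, hlt⟩ ⟨hwy.symm, hyw⟩ (fun h => by simp [h] at hyv)
      have hqv : ∀ z ∈ q.support, σ z < σ v := by
        intro z hz
        rw [← cons_tail_support, List.mem_cons] at hz
        rcases hz with rfl | hz
        · exact hyv
        · exact (hqy z hz).trans hyv
      refine ⟨cons hadj q, ?_, ?_⟩
      · rw [support_cons, List.pairwise_cons]
        exact ⟨hqv, hq⟩
      · intro z hz
        rw [support_cons, List.tail_cons] at hz
        exact ⟨by simp [hz], hqv z hz⟩
    · obtain rfl := hσ hyv
      exact ⟨q, hq, fun z hz => ⟨by simp [List.mem_of_mem_tail hz], hqy z hz⟩⟩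
    · obtain ⟨r, hr, hrz⟩ := ih hq (hG w ⟨hvw, hlt⟩ ⟨hwy.symm, hyw⟩
        (fun h => by simp [h] at hyv)) hyv huv
      exact ⟨r, hr, fun z hz => ⟨by simp [(hrz z hz).1], (hrz z hz).2⟩⟩

lemma mem_recordVerts_cons {v w u z : V} (h : G.Adj v w) {p : G.Walk w u}
    (hz : z ∈ p.recordVerts σ) (hzv : σ z < σ v) : z ∈ (cons h p).recordVerts σ := by
  obtain ⟨j, hj1, hjl, hjz, hj⟩ := hz
  refine ⟨j + 1, by omega, by simpa using hjl, by simpa using hjz, ?_⟩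
  rintro (_ | i) hi
  · simpa using hzv
  · simpa using hj i (by omega)

/-- If earlier neighbourhoods are cliques, a walk whose end is its strict minimum can be replaced by
a strictly decreasing walk through record vertices only. -/
lemma exists_decreasing_tail_subset_recordVerts (hσ : Function.Injective σ)
    (hG : ∀ x, G.IsClique {y | G.Adj y x ∧ σ y < σ x}) {v u : V} (p : G.Walk v u)
    (hp : ∀ i < p.length, σ u < σ (p.getVert i)) :
    ∃ q : G.Walk v u, q.support.Pairwise (fun a b => σ b < σ a) ∧
      ∀ z ∈ q.support.tail, z ∈ p.recordVerts σ := by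
  induction p with
  | nil => exact ⟨nil, by simp, by simp⟩
  | @cons v w u h p ih =>
    obtain ⟨q, hq, hqz⟩ := ih fun i hi => by simpa using hp (i + 1) (by simpa using hi)
    have hqw : ∀ z ∈ q.support.tail, σ z < σ w := by
      rw [← cons_tail_support, List.pairwise_cons] at hq
      exact hq.1
    rcases lt_or_gt_of_ne (hσ.ne h.ne) with hvw | hwv
    · obtain ⟨r, hr, hrz⟩ := exists_decreasing_of_adj hσ hG q hq h hvw
        (by simpa using hp 0 (by simp))
      refine ⟨r, hr, fun z hz => ?_⟩
      obtain ⟨hzq, hzv⟩ := hrz z hz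
      rw [← cons_tail_support, List.mem_cons] at hzq
      rcases hzq with rfl | hzq
      · omega
      · exact mem_recordVerts_cons h (hqz z hzq) hzv
    · refine ⟨cons h q, ?_, ?_⟩
      · rw [support_cons, List.pairwise_cons]
        refine ⟨fun z hz => ?_, hq⟩
        rw [← cons_tail_support, List.mem_cons] at hz
        rcases hz with rfl | hz
        · exact hwv
        · exact (hqw z hz).trans hwv
      · intro z hz
        rw [support_cons, List.tail_cons, ← cons_tail_support, List.mem_cons] at hz
        rcases hz with rfl | hz
        · exact ⟨1, le_rfl, by simp, by simp, by simpa using hwv⟩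
        · exact mem_recordVerts_cons h (hqz z hz) ((hqw z hz).trans hwv)

lemma finite_recordIndices {v u : V} (p : G.Walk v u) :
    {j : ℕ | 1 ≤ j ∧ j ≤ p.length ∧
      ∀ i < j, σ (p.getVert j) < σ (p.getVert i)}.Finite :=
  (Set.finite_Icc 1 p.length).subset fun _ hj => ⟨hj.1, hj.2.1⟩

lemma recordVerts_eq_image {v u : V} (p : G.Walk v u) :
    p.recordVerts σ = p.getVert '' {j : ℕ | 1 ≤ j ∧ j ≤ p.length ∧
      ∀ i < j, σ (p.getVert j) < σ (p.getVert i)} := by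
  ext z
  constructor
  · rintro ⟨j, h1, hl, rfl, hj⟩
    exact ⟨j, ⟨h1, hl, hj⟩, rfl⟩
  · rintro ⟨j, ⟨h1, hl, hj⟩, rfl⟩
    exact ⟨j, h1, hl, rfl, hj⟩

lemma length_le_ncard_of_tail_subset {v u : V} {q : G.Walk v u} {s : Set V} (hs : s.Finite)
    (hq : q.IsPath) (hqs : ∀ z ∈ q.support.tail, z ∈ s) : q.length ≤ s.ncard := by
  classical
  calc q.length = q.support.tail.toFinset.card := by
        rw [List.toFinset_card_of_nodup hq.support_nodup.tail]
        simp
    _ = (q.support.tail.toFinset : Set V).ncard := (Set.ncard_coe_finset _).symm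
    _ ≤ s.ncard := Set.ncard_le_ncard (fun z hz => hqs z (by simpa using hz)) hs

end SimpleGraph.Walk

/-- For a `t`-tree `G` with simplicial ordering `L` and `k ≤ ℓ`,
`GReach_{k,ℓ}[G,L,v] = WReach_k[G,L,v] = GReach_{k,k}[G,L,v]`. -/
theorem greach_eq_wreach_of_ttree {V : Type} [Fintype V] (G : SimpleGraph V)
    (t k ℓ : ℕ) (ht : 0 < t) (hk : 0 < k) (hkl : k ≤ ℓ) (L : V → ℕ)
    (h : IsTTreeOrder G t L) (v : V) :
    GReach G L k ℓ v = GReach G L k k v := by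
  obtain ⟨-, hσ, -, hv⟩ := h
  have hG : ∀ x, G.IsClique {y | G.Adj y x ∧ L y < L x} := fun x => (hv x).2.2
  ext u
  constructor
  · rintro ⟨p, -, -, hmin, hcard⟩
    obtain ⟨q, hq, hqz⟩ := p.exists_decreasing_tail_subset_recordVerts hσ hG hmin
    have hpath : q.IsPath :=
      SimpleGraph.Walk.IsPath.mk' (hq.imp fun {a b} hab => by rintro rfl; exact hab.false)
    rw [SimpleGraph.Walk.recordVerts_eq_image] at hqz
    have hlen : q.length ≤ k :=
      (SimpleGraph.Walk.length_le_ncard_of_tail_subset (p.finite_recordIndices.image _) hpath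
        hqz).trans ((Set.ncard_image_le p.finite_recordIndices).trans hcard)
    refine ⟨q, hpath, hlen, fun i hi => ?_, ?_⟩
    · rw [List.pairwise_iff_getElem] at hq
      have hlt := hq i q.length (by simp; omega) (by simp) hi
      rw [SimpleGraph.Walk.support_getElem_length] at hlt
      rwa [SimpleGraph.Walk.getVert_eq_support_getElem q hi.le]
    · refine le_trans ?_ hlen
      calc _ ≤ (Set.Icc 1 q.length).ncard :=
            Set.ncard_le_ncard (fun j hj => ⟨hj.1, hj.2.1⟩) (Set.finite_Icc 1 q.length)
        _ = q.length := by simp [← Finset.coe_Icc, Set.ncard_coe_finset]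
  · rintro ⟨p, hp, hlen, hrest⟩
    exact ⟨p, hp, hlen.trans hkl, hrest⟩
end

section
/- Let k ≤ ℓ and t be positive integers. Every finite simple graph G with treewidth at most t satisfies gcol_{k,ℓ}(G) ≤ C(t+k, t) (the binomial coefficient). -/
/-- `G` has treewidth at most `t`: `G` is a subgraph of some `t`-tree. -/
def HasTreewidthLE {V : Type} (G : SimpleGraph V) (t : ℕ) : Prop :=
  ∃ (W : Type) (H : SimpleGraph W) (σ : W → ℕ) (f : V ↪ W),
    IsTTreeOrder H t σ ∧ ∀ u v : V, G.Adj u v → H.Adj (f u) (f v)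

/-- The neighbours of `v` that precede it in the ordering `σ`. -/
def backNbhd {W : Type} (H : SimpleGraph W) (σ : W → ℕ) (v : W) : Set W :=
  {u : W | H.Adj u v ∧ σ u < σ v}

/-- `BackReach H σ k v w` says that some `σ`-decreasing path of length at most `k` in `H`
leads from `v` to `w`. -/
inductive BackReach {W : Type} (H : SimpleGraph W) (σ : W → ℕ) : ℕ → W → W → Prop
  | refl (k : ℕ) (v : W) : BackReach H σ k v v
  | step {k : ℕ} {v y w : W} (hy : y ∈ backNbhd H σ v) (h : BackReach H σ k y w) :
      BackReach H σ (k + 1) v w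

namespace BackReach

variable {W : Type} {H : SimpleGraph W} {σ : W → ℕ}

theorem mono {j k : ℕ} {v w : W} (h : BackReach H σ j v w) (hjk : j ≤ k) :
    BackReach H σ k v w := by
  induction h generalizing k with
  | refl j v => exact .refl k v
  | step hy _ ih =>
    obtain ⟨k, rfl⟩ : ∃ k', k = k' + 1 := ⟨k - 1, by omega⟩
    exact .step hy (ih (by omega))

theorem eq_or_exists {k : ℕ} {v w : W} (h : BackReach H σ k v w) :
    w = v ∨ ∃ y ∈ backNbhd H σ v, ∃ j < k, BackReach H σ j y w := by
  cases h with
  | refl => exact .inl rfl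
  | step hy h => exact .inr ⟨_, hy, _, Nat.lt_succ_self _, h⟩

/-- If `B` is an initial segment of the at most `t` earlier neighbours of `v` and `t ≤ |B| + m`,
then at most `C(m + k, k)` vertices are back-reachable from `v` in `k` steps without being
back-reachable from `B` in fewer than `k` steps. -/
theorem ncard_avoiding_le [Finite W] (hσ : Function.Injective σ) {t : ℕ}
    (hcard : ∀ v, (backNbhd H σ v).ncard ≤ t) (hclique : ∀ v, H.IsClique (backNbhd H σ v))
    (k m : ℕ) (v : W) (B : Set W) (hB : B ⊆ backNbhd H σ v)
    (hlower : ∀ b ∈ B, ∀ z ∈ backNbhd H σ v, σ z < σ b → z ∈ B) (hm : t ≤ B.ncard + m) :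
    {w | BackReach H σ k v w ∧ ∀ b ∈ B, ∀ j < k, ¬ BackReach H σ j b w}.ncard
      ≤ (m + k).choose k := by
  induction k generalizing m v B with
  | zero =>
    refine (Set.ncard_le_ncard (t := {v}) ?_).trans (by simp)
    rintro w ⟨h, -⟩
    simpa using h.eq_or_exists
  | succ k ihk =>
    induction m generalizing B with
    | zero =>
      have hBeq : B = backNbhd H σ v :=
        Set.eq_of_subset_of_ncard_le hB ((hcard v).trans (by simpa using hm))
      refine (Set.ncard_le_ncard (t := {v}) ?_).trans (by simp)
      rintro w ⟨h, hw⟩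
      rcases h.eq_or_exists with rfl | ⟨y, hy, j, hj, hyw⟩
      · rfl
      · exact (hw y (hBeq ▸ hy) j hj hyw).elim
    | succ m ihm =>
      by_cases hne : (backNbhd H σ v \ B).Nonempty
      · obtain ⟨y, ⟨hyv, hyB⟩, hymin⟩ :=
          Set.exists_min_image (backNbhd H σ v \ B) σ (Set.toFinite _) hne
        have hlt : ∀ b ∈ B, σ b < σ y := fun b hb => by
          rcases lt_trichotomy (σ b) (σ y) with h | h | h
          · exact h
          · exact (hyB (hσ h ▸ hb)).elim
          · exact (hyB (hlower b hb y hyv h)).elim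
        have hBy : B ⊆ backNbhd H σ y := fun b hb =>
          ⟨hclique v (hB hb) hyv (fun h => hyB (h ▸ hb)), hlt b hb⟩
        have hinsert := ihm (insert y B) (Set.insert_subset hyv hB)
          (by
            rintro b hb z hz hzb
            by_contra hzB
            have hz' : z ∉ B := fun h => hzB (Set.mem_insert_of_mem _ h)
            rcases hb with rfl | hb
            · exact absurd (hymin z ⟨hz, hz'⟩) (by omega)
            · exact hz' (hlower b hb z hz hzb))
          (by rw [Set.ncard_insert_of_notMem hyB]; omega)
        have hnext := ihk (m + 1) y {z | z ∈ backNbhd H σ y ∧ ∃ b ∈ B, σ z ≤ σ b}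
          (fun z hz => hz.1)
          (fun b ⟨_, c, hc, hbc⟩ z hz hzb => ⟨hz, c, hc, by omega⟩)
          (hm.trans (Nat.add_le_add_right
            (Set.ncard_le_ncard fun b (hb : b ∈ B) => (⟨hBy hb, b, hb, le_rfl⟩ :
              b ∈ backNbhd H σ y ∧ ∃ c ∈ B, σ b ≤ σ c)) _))
        refine (Set.ncard_le_ncard (fun w hw => ?_)).trans
          ((Set.ncard_union_le _ _).trans (Nat.add_le_add hinsert hnext) |>.trans ?_)
        · obtain ⟨hvw, hw⟩ := hw
          by_cases hyw : BackReach H σ k y w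
          · refine .inr ⟨hyw, ?_⟩
            rintro z ⟨hz, b, hb, hzb⟩ j hj hzw
            rcases hzb.lt_or_eq with hzb | hzb
            · exact hw b hb (j + 1) (by omega)
                (.step ⟨hclique y hz (hBy hb) (fun h => by simp [h] at hzb), hzb⟩ hzw)
            · exact hw b hb j (by omega) (hσ hzb ▸ hzw)
          · refine .inl ⟨hvw, ?_⟩
            rintro b (rfl | hb) j hj hbw
            · exact hyw (hbw.mono (by omega))
            · exact hw b hb j hj hbw
        · have := Nat.choose_succ_succ (m + 1 + k) k
          have h : m + (k + 1) = m + 1 + k := by omega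
          rw [h, ← add_assoc]
          simp only [Nat.succ_eq_add_one] at this
          omega
      · have hBeq : backNbhd H σ v ⊆ B := by
          rwa [Set.not_nonempty_iff_eq_empty, Set.sdiff_eq_empty] at hne
        refine (Set.ncard_le_ncard (t := {v}) ?_).trans
          (by simpa using Nat.succ_le_of_lt (Nat.choose_pos (by omega)))
        rintro w ⟨h, hw⟩
        rcases h.eq_or_exists with rfl | ⟨y, hy, j, hj, hyw⟩
        · rfl
        · exact (hw y (hBeq hy) j hj hyw).elim

theorem ncard_le_choose [Finite W] (hσ : Function.Injective σ) {t : ℕ}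
    (hcard : ∀ v, (backNbhd H σ v).ncard ≤ t) (hclique : ∀ v, H.IsClique (backNbhd H σ v))
    (k : ℕ) (v : W) : {w | BackReach H σ k v w}.ncard ≤ (t + k).choose k := by
  simpa using ncard_avoiding_le hσ hcard hclique k t v ∅ (by simp) (by simp) (by simp)

end BackReach

/-- In a graph whose earlier neighbourhoods are cliques, the ends of a path all of whose internal
vertices come after both ends are adjacent. -/
theorem adj_of_internal_gt {W : Type} {H : SimpleGraph W} {σ : W → ℕ}
    (hclique : ∀ v, H.IsClique (backNbhd H σ v)) {s : ℕ} {x : ℕ → W}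
    (hadj : ∀ i < s, H.Adj (x i) (x (i + 1)))
    (hinj : ∀ i ≤ s, ∀ j ≤ s, σ (x i) = σ (x j) → i = j) (d i j : ℕ) (hd : j ≤ i + d)
    (hij : i < j) (hjs : j ≤ s)
    (hint : ∀ a, i < a → a < j → σ (x i) < σ (x a) ∧ σ (x j) < σ (x a)) :
    H.Adj (x i) (x j) := by
  induction d generalizing i j with
  | zero => omega
  | succ d ih =>
    rcases Nat.lt_or_ge (i + 1) j with h | h
    · obtain ⟨m, hm, hmin⟩ :=
        Set.exists_min_image (Set.Ioo i j) (fun a => σ (x a)) (Set.toFinite _) ⟨i + 1, by simp, h⟩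
      obtain ⟨him, hmj⟩ := hm
      have hgt : ∀ a, i < a → a < j → a ≠ m → σ (x m) < σ (x a) := fun a h₁ h₂ h₃ =>
        lt_of_le_of_ne (hmin a ⟨h₁, h₂⟩) fun he => h₃ (hinj m (by omega) a (by omega) he).symm
      have hi : H.Adj (x i) (x m) := ih i m (by omega) him (by omega) fun a h₁ h₂ =>
        ⟨(hint a h₁ (by omega)).1, hgt a h₁ (by omega) (by omega)⟩
      have hj : H.Adj (x m) (x j) := ih m j (by omega) hmj hjs fun a h₁ h₂ =>
        ⟨hgt a (by omega) h₂ (by omega), (hint a (by omega) h₂).2⟩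
      refine hclique (x m) ⟨hi, (hint m him hmj).1⟩ ⟨hj.symm, (hint m him hmj).2⟩ fun he => ?_
      have := hinj i (by omega) j hjs (by rw [he])
      omega
    · obtain rfl : j = i + 1 := by omega
      exact hadj i (by omega)

/-- The prefix minima of a path that ends at its minimum form a decreasing path. -/
theorem backReach_of_prefix_minima {W : Type} {H : SimpleGraph W} {σ : W → ℕ}
    (hclique : ∀ v, H.IsClique (backNbhd H σ v)) {s : ℕ} {x : ℕ → W}
    (hadj : ∀ i < s, H.Adj (x i) (x (i + 1)))
    (hinj : ∀ i ≤ s, ∀ j ≤ s, σ (x i) = σ (x j) → i = j)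
    (hend : ∀ i < s, σ (x s) < σ (x i)) (k i : ℕ) (his : i ≤ s)
    (hrec : ∀ a < i, σ (x i) < σ (x a))
    (hcount : {j | i + 1 ≤ j ∧ j ≤ s ∧ ∀ a < j, σ (x j) < σ (x a)}.ncard ≤ k) :
    BackReach H σ k (x i) (x s) := by
  induction k generalizing i with
  | zero =>
    rcases his.eq_or_lt with rfl | h
    · exact .refl _ _
    · have hfin : {j | i + 1 ≤ j ∧ j ≤ s ∧ ∀ a < j, σ (x j) < σ (x a)}.Finite :=
        (Set.finite_Iic s).subset fun j hj => hj.2.1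
      rw [Nat.le_zero, Set.ncard_eq_zero hfin] at hcount
      exact (Set.eq_empty_iff_forall_notMem.1 hcount s ⟨h, le_rfl, hend⟩).elim
  | succ k ih =>
    rcases his.eq_or_lt with rfl | h
    · exact .refl _ _
    · classical
      have hex : ∃ j, i < j ∧ j ≤ s ∧ σ (x j) < σ (x i) := ⟨s, h, le_rfl, hend i h⟩
      obtain ⟨j, ⟨hij, hjs, hj⟩, hfirst⟩ : ∃ j, (i < j ∧ j ≤ s ∧ σ (x j) < σ (x i)) ∧
          ∀ a < j, ¬ (i < a ∧ a ≤ s ∧ σ (x a) < σ (x i)) :=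
        ⟨Nat.find hex, Nat.find_spec hex, fun a => Nat.find_min hex⟩
      have hbetween : ∀ a, i < a → a < j → σ (x i) < σ (x a) := fun a h₁ h₂ => by
        have h₃ := hfirst a h₂
        have h₄ : σ (x i) ≠ σ (x a) := fun he => by
          have := hinj i his a (by omega) he
          omega
        have : ¬ σ (x a) < σ (x i) := fun h₅ => h₃ ⟨h₁, by omega, h₅⟩
        omega
      have hjrec : ∀ a < j, σ (x j) < σ (x a) := fun a ha => by
        rcases lt_trichotomy a i with h₁ | rfl | h₁
        · exact hj.trans (hrec a h₁)
        · exact hj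
        · exact hj.trans (hbetween a h₁ ha)
      have hstep : H.Adj (x i) (x j) :=
        adj_of_internal_gt hclique hadj hinj j i j (by omega) hij hjs fun a h₁ h₂ =>
          ⟨hbetween a h₁ h₂, hjrec a h₂⟩
      refine .step ⟨hstep.symm, hj⟩ (ih j hjs hjrec (Nat.le_of_lt_succ ?_))
      have hfin : {j | i + 1 ≤ j ∧ j ≤ s ∧ ∀ a < j, σ (x j) < σ (x a)}.Finite :=
        (Set.finite_Iic s).subset fun j hj => hj.2.1
      refine (Set.ncard_lt_ncard ?_ hfin).trans_le hcount
      have hsub : {a | j + 1 ≤ a ∧ a ≤ s ∧ ∀ b < a, σ (x a) < σ (x b)} ⊆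
          {a | i + 1 ≤ a ∧ a ≤ s ∧ ∀ b < a, σ (x a) < σ (x b)} :=
        fun a ha => ⟨by have := ha.1; omega, ha.2⟩
      refine (Set.ssubset_iff_of_subset hsub).2 ⟨j, ⟨hij, hjs, hjrec⟩, fun ha => ?_⟩
      have := ha.1
      omega

theorem IsTTreeOrder.ncard_backNbhd_le {W : Type} {H : SimpleGraph W} {t : ℕ} {σ : W → ℕ}
    (h : IsTTreeOrder H t σ) (v : W) : (backNbhd H σ v).ncard ≤ t := by
  obtain ⟨hfin, -, -, h⟩ := h
  rcases Nat.lt_or_ge t {u : W | σ u < σ v}.ncard with hv | hv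
  · exact ((h v).2.1 hv).le
  · exact (Set.ncard_le_ncard fun u hu => hu.2).trans hv

/-- Every finite graph of treewidth at most `t` satisfies `gcol_{k,ℓ}(G) ≤ C(t+k, t)`
for all positive `k ≤ ℓ`. -/
theorem gcol_le_choose_of_treewidth {V : Type} [Fintype V] (G : SimpleGraph V)
    (t k ℓ : ℕ) (ht : 0 < t) (hk : 0 < k) (hkl : k ≤ ℓ)
    (htw : HasTreewidthLE G t) :
    gcol G k ℓ ≤ (t + k).choose t := by
  obtain ⟨W, H, σ, f, hH, hf⟩ := htw
  have hfin : Finite W := hH.1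
  have hσ : Function.Injective σ := hH.2.1
  have hclique : ∀ v, H.IsClique (backNbhd H σ v) := fun v => (hH.2.2.2 v).2.2
  have hle : gcol G k ℓ ≤ gcolOrd G (σ ∘ f) k ℓ :=
    Nat.sInf_le ⟨σ ∘ f, hσ.comp f.injective, rfl⟩
  refine hle.trans (Finset.sup_le fun v _ => ?_)
  rw [Nat.choose_symm_add]
  refine (Set.ncard_le_ncard_of_injOn f ?_ f.injective.injOn).trans
    (BackReach.ncard_le_choose hσ hH.ncard_backNbhd_le hclique k (f v))
  rintro u ⟨p, hp, -, hend, hcount⟩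
  have := backReach_of_prefix_minima (s := p.length) (x := fun i => f (p.getVert i)) hclique
    (fun i hi => hf _ _ (p.adj_getVert_succ hi))
    (fun i hi j hj hij => hp.getVert_injOn hi hj (f.injective (hσ hij)))
    (by simpa using hend) k 0 (Nat.zero_le _) (by simp) (by simpa using hcount)
  simpa using this
end

section
/- Let k ≤ ℓ be positive integers. For every path graph P (a graph whose vertices can be enumerated v_1,…,v_n with edges exactly between consecutive vertices), gcol_{k,ℓ}(P) ≤ ⌈log₂ k⌉ + 2⌈ℓ/k⌉. -/
namespace PathGColoring

/-- The level of `x` in the ruler ordering with blocks of length `2 ^ c`: multiples of `2 ^ c`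
have level `0`, and otherwise `x` has level `c` minus its `2`-adic valuation. -/
def level (c x : ℕ) : ℕ :=
  Nat.find (p := fun j => 2 ^ (c - j) ∣ x) ⟨c, by simp⟩

lemma pow_sub_level_dvd (c x : ℕ) : 2 ^ (c - level c x) ∣ x :=
  Nat.find_spec (p := fun j => 2 ^ (c - j) ∣ x) ⟨c, by simp⟩

lemma level_le_of_dvd {c x j : ℕ} (h : 2 ^ (c - j) ∣ x) : level c x ≤ j :=
  Nat.find_min' _ h

lemma level_le (c x : ℕ) : level c x ≤ c :=
  level_le_of_dvd (by simp)

/-- Between two numbers of the same positive level there is one of smaller level. -/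
lemma exists_level_lt_between {c a b : ℕ} (hab : a < b) (hl : level c a = level c b)
    (hpos : 0 < level c a) : ∃ x, a < x ∧ x < b ∧ level c x < level c a := by
  obtain ⟨j, hj⟩ : ∃ j, level c a = j + 1 := ⟨level c a - 1, by omega⟩
  have hjc : j + 1 ≤ c := hj ▸ level_le c a
  have hpow : 2 ^ (c - j) = 2 ^ (c - (j + 1)) * 2 := by
    rw [← pow_succ]; congr 1; omega
  have hda := pow_sub_level_dvd c a
  have hdb := pow_sub_level_dvd c b
  rw [← hl] at hdb
  rw [hj] at hda hdb
  have hK : 0 < 2 ^ (c - (j + 1)) := by positivity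
  have odd_of (y : ℕ) (hy : level c y = j + 1) : ¬ 2 ^ (c - (j + 1)) * 2 ∣ y := fun h => by
    have := level_le_of_dvd (hpow ▸ h)
    omega
  have hna := odd_of a hj
  have hnb := odd_of b (hl ▸ hj)
  generalize 2 ^ (c - (j + 1)) = K at *
  obtain ⟨m, rfl⟩ := hda
  obtain ⟨m', rfl⟩ := hdb
  rw [Nat.mul_dvd_mul_iff_left hK] at hna hnb
  have hmm : m < m' := lt_of_mul_lt_mul_left' hab
  refine ⟨K * (m + 1), by gcongr; omega, by gcongr; omega, ?_⟩
  have : level c (K * (m + 1)) ≤ j := level_le_of_dvd <| by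
    rw [hpow]; exact mul_dvd_mul_left K (by omega)
  omega

/-- The ruler ordering on `{0, …, n - 1}`: by level, then from left to right. -/
def rulerKey (c n x : ℕ) : ℕ := level c x * n + x

lemma rulerKey_lt_of_level_lt {c n x y : ℕ} (hx : x < n) (h : level c x < level c y) :
    rulerKey c n x < rulerKey c n y := by
  unfold rulerKey
  nlinarith

lemma rulerKey_lt_of_lt {c n x y : ℕ} (hl : level c x = level c y) (h : x < y) :
    rulerKey c n x < rulerKey c n y := by
  unfold rulerKey
  rw [hl]
  omega

lemma rulerKey_inj {c n x y : ℕ} (hx : x < n) (hy : y < n)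
    (h : rulerKey c n x = rulerKey c n y) : x = y := by
  rcases lt_trichotomy (level c x) (level c y) with hl | hl | hl
  · exact absurd h (rulerKey_lt_of_level_lt hx hl).ne
  · unfold rulerKey at h
    rw [hl] at h
    omega
  · exact absurd h (rulerKey_lt_of_level_lt hy hl).ne'

/-- `a` is weakly `ℓ`-reachable from `b` on the path `{0, …, n - 1}` in the ruler ordering. -/
structure Reaches (c n ℓ b a : ℕ) : Prop where
  lt : a < n
  le_add : a ≤ b + ℓ ∧ b ≤ a + ℓ
  left : ∀ x, a < x → x ≤ b → rulerKey c n a < rulerKey c n x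
  right : ∀ x, b ≤ x → x < a → rulerKey c n a < rulerKey c n x

/-- An index that determines a vertex among those reachable from `b`. -/
def reachIndex (c b a : ℕ) : ℕ :=
  if level c a = 0 then if b ≤ a then c else c + 1 + (b - 1 - a) / 2 ^ c else level c a - 1

lemma Reaches.not_lt_of_level_pos {c n ℓ b a a' : ℕ} (h : Reaches c n ℓ b a)
    (h' : Reaches c n ℓ b a') (hl : level c a = level c a') (hpos : 0 < level c a) :
    ¬ a < a' := fun hlt => by
  obtain ⟨x, hax, hxa, hx⟩ := exists_level_lt_between hlt hl hpos
  have hxn : x < n := hxa.trans h'.lt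
  rcases le_total x b with hxb | hxb
  · exact absurd (h.left x hax hxb) (rulerKey_lt_of_level_lt hxn hx).asymm
  · exact absurd (h'.right x hxb hxa) (rulerKey_lt_of_level_lt hxn (hl ▸ hx)).asymm

lemma reachIndex_ne_of_lt {c n ℓ b a a' : ℕ} (h : Reaches c n ℓ b a)
    (h' : Reaches c n ℓ b a') (hlt : a < a') : reachIndex c b a ≠ reachIndex c b a' := by
  intro heq
  have hc := level_le c a
  have hc' := level_le c a'
  have hsame := h.not_lt_of_level_pos h'
  unfold reachIndex at heq
  by_cases h0 : level c a = 0
  · by_cases h0' : level c a' = 0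
    · simp only [h0, h0', if_true] at heq
      split_ifs at heq with hb hb' hb'
      · exact (h'.right a hb hlt).asymm (rulerKey_lt_of_lt (h0.trans h0'.symm) hlt)
      · omega
      · generalize (b - 1 - a) / 2 ^ c = q at heq
        omega
      · have hK : 0 < 2 ^ c := by positivity
        have hd := pow_sub_level_dvd c a
        have hd' := pow_sub_level_dvd c a'
        rw [h0, Nat.sub_zero] at hd
        rw [h0', Nat.sub_zero] at hd'
        have hstep : a + 2 ^ c ≤ a' := by
          have := Nat.le_of_dvd (by omega) (Nat.dvd_sub hd' hd)
          omega
        have hdiv : (b - 1 - a') / 2 ^ c + 1 ≤ (b - 1 - a) / 2 ^ c := by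
          rw [← Nat.add_div_right _ hK]
          exact Nat.div_le_div_right (by omega)
        omega
    · simp only [h0, h0', if_true, if_false] at heq
      generalize (b - 1 - a) / 2 ^ c = q at heq
      split_ifs at heq <;> omega
  · by_cases h0' : level c a' = 0
    · simp only [h0, h0', if_true, if_false] at heq
      generalize (b - 1 - a') / 2 ^ c = q at heq
      split_ifs at heq <;> omega
    · simp only [h0, h0', if_false] at heq
      exact hsame (by omega) (by omega) hlt

lemma reachIndex_injOn (c n ℓ b : ℕ) :
    Set.InjOn (reachIndex c b) {a | Reaches c n ℓ b a} := fun a h a' h' heq => by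
  rcases lt_trichotomy a a' with hlt | rfl | hlt
  · exact absurd heq (reachIndex_ne_of_lt h h' hlt)
  · rfl
  · exact absurd heq.symm (reachIndex_ne_of_lt h' h hlt)

lemma reachIndex_lt {c n ℓ b a : ℕ} (h : Reaches c n ℓ b a) :
    reachIndex c b a < c + 2 + (ℓ - 1) / 2 ^ c := by
  have hc := level_le c a
  have hdiv : (b - 1 - a) / 2 ^ c ≤ (ℓ - 1) / 2 ^ c :=
    Nat.div_le_div_right (by have := h.le_add; omega)
  unfold reachIndex
  generalize (b - 1 - a) / 2 ^ c = q, (ℓ - 1) / 2 ^ c = r at *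
  split_ifs <;> omega

section Walk

variable {V : Type} {G : SimpleGraph V} {f : V → ℕ}

lemma walk_dist_le (hf : ∀ x y, G.Adj x y → f x + 1 = f y ∨ f y + 1 = f x) {v u : V}
    (p : G.Walk v u) : f u ≤ f v + p.length ∧ f v ≤ f u + p.length := by
  induction p with
  | nil => simp
  | cons h p ih =>
    have := hf _ _ h
    rw [SimpleGraph.Walk.length_cons]
    omega

/-- A walk along which an integer function changes in unit steps attains all values between
the values at its ends. -/
lemma exists_mem_support_eq (hf : ∀ x y, G.Adj x y → f x + 1 = f y ∨ f y + 1 = f x) {v u : V}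
    (p : G.Walk v u) {x : ℕ} (hx : f v ≤ x ∧ x ≤ f u ∨ f u ≤ x ∧ x ≤ f v) :
    ∃ w ∈ p.support, f w = x := by
  induction p with
  | @nil a => exact ⟨a, by simp, by omega⟩
  | @cons a b _ h p ih =>
    by_cases hax : f a = x
    · exact ⟨a, by simp, hax⟩
    · have := hf _ _ h
      obtain ⟨w, hw, hwx⟩ := ih (by omega)
      exact ⟨w, by simp [hw], hwx⟩

end Walk

lemma reaches_of_mem_GReach {V : Type} {G : SimpleGraph V} {f : V → ℕ} {c n k ℓ : ℕ}
    (hf : ∀ x y, G.Adj x y → f x + 1 = f y ∨ f y + 1 = f x) (hn : ∀ x, f x < n) {u v : V}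
    (h : u ∈ GReach G (fun x => rulerKey c n (f x)) k ℓ v) : Reaches c n ℓ (f v) (f u) := by
  obtain ⟨p, -, hlen, hmin, -⟩ := h
  have hdist := walk_dist_le hf p
  have key (x : ℕ) (hx : f v ≤ x ∧ x ≤ f u ∨ f u ≤ x ∧ x ≤ f v) (hne : f u ≠ x) :
      rulerKey c n (f u) < rulerKey c n x := by
    obtain ⟨w, hw, rfl⟩ := exists_mem_support_eq hf p hx
    obtain ⟨i, rfl, hi⟩ := SimpleGraph.Walk.mem_support_iff_exists_getVert.1 hw
    refine hmin i (lt_of_le_of_ne hi ?_)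
    rintro rfl
    simp at hne
  exact ⟨hn u, by omega, fun x h₁ h₂ => key x (by omega) (by omega),
    fun x h₁ h₂ => key x (by omega) (by omega)⟩

lemma ncard_GReach_le {V : Type} {G : SimpleGraph V} {f : V → ℕ} {c n k ℓ : ℕ}
    (hf : ∀ x y, G.Adj x y → f x + 1 = f y ∨ f y + 1 = f x) (hn : ∀ x, f x < n)
    (hinj : Function.Injective f) (v : V) :
    (GReach G (fun x => rulerKey c n (f x)) k ℓ v).ncard ≤ c + 2 + (ℓ - 1) / 2 ^ c := by
  have := Set.ncard_le_ncard_of_injOn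
    (s := GReach G (fun x => rulerKey c n (f x)) k ℓ v) (t := Set.Iio (c + 2 + (ℓ - 1) / 2 ^ c))
    (fun u => reachIndex c (f v) (f u))
    (fun u hu => reachIndex_lt (reaches_of_mem_GReach hf hn hu))
    (fun u hu u' hu' heq => hinj <| reachIndex_injOn c n ℓ (f v)
      (reaches_of_mem_GReach hf hn hu) (reaches_of_mem_GReach hf hn hu') heq)
    (Set.finite_Iio _)
  simpa [Set.ncard_eq_toFinset_card'] using this

end PathGColoring

open PathGColoring in
/-- For positive `k ≤ ℓ`, every path graph `P` (a graph isomorphic to the canonical path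
graph on `n` vertices, whose vertices can be enumerated with edges exactly between
consecutive vertices) satisfies `gcol_{k,ℓ}(P) ≤ ⌈log₂ k⌉ + 2⌈ℓ/k⌉`. -/
theorem gcol_pathGraph_le {V : Type} [Fintype V] (P : SimpleGraph V) (n k ℓ : ℕ)
    (hk : 0 < k) (hkl : k ≤ ℓ) (hiso : Nonempty (P ≃g SimpleGraph.pathGraph n)) :
    gcol P k ℓ ≤ Nat.clog 2 k + 2 * ((ℓ + k - 1) / k) := by
  obtain ⟨e⟩ := hiso
  set c := Nat.clog 2 k
  let f : V → ℕ := fun v => (e v).val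
  have hn (v : V) : f v < n := (e v).isLt
  have hinj : Function.Injective f := fun v w h => e.injective (Fin.ext h)
  have hf (x y : V) (h : P.Adj x y) : f x + 1 = f y ∨ f y + 1 = f x :=
    SimpleGraph.pathGraph_adj.1 (e.map_adj_iff.2 h)
  have hle : gcol P k ℓ ≤ gcolOrd P (fun x => rulerKey c n (f x)) k ℓ :=
    Nat.sInf_le ⟨_, fun x y h => hinj (rulerKey_inj (hn x) (hn y) h), rfl⟩
  have hord : gcolOrd P (fun x => rulerKey c n (f x)) k ℓ ≤ c + 2 + (ℓ - 1) / 2 ^ c :=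
    Finset.sup_le fun v _ => ncard_GReach_le hf hn hinj v
  have hdiv : (ℓ - 1) / 2 ^ c ≤ (ℓ - 1) / k :=
    Nat.div_le_div_left (Nat.le_pow_clog one_lt_two k) hk
  have hceil : (ℓ + k - 1) / k = (ℓ - 1) / k + 1 := by
    rw [← Nat.add_div_right _ hk]
    congr 1
    omega
  rw [hceil]
  linarith [Nat.zero_le ((ℓ - 1) / k)]
end

section
/- Let k ≤ ℓ and t be positive integers. Every finite simple graph G with simple treewidth at most t satisfies gcol_{k,ℓ}(G) ≤ (k+1)^{t−1} · (⌈log₂ k⌉ + 2⌈ℓ/k⌉). -/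
/-- `σ` witnesses that `H` is a simple `t`-tree with simplicial ordering `σ`: a `t`-tree
in which no two added vertices are attached to the same `t`-clique, i.e. distinct vertices
beyond the initial clique have distinct sets of earlier neighbours. -/
def IsSimpleTTreeOrder {W : Type} (H : SimpleGraph W) (t : ℕ) (σ : W → ℕ) : Prop :=
  IsTTreeOrder H t σ ∧
  ∀ v w : W, v ≠ w → t + 1 ≤ {u : W | σ u < σ v}.ncard →
    t + 1 ≤ {u : W | σ u < σ w}.ncard →
    {u : W | H.Adj u v ∧ σ u < σ v} ≠ {u : W | H.Adj u w ∧ σ u < σ w}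

/-- `G` has simple treewidth at most `t`: `G` is a subgraph of some simple `t`-tree. -/
def HasSimpleTreewidthLE {V : Type} (G : SimpleGraph V) (t : ℕ) : Prop :=
  ∃ (W : Type) (H : SimpleGraph W) (σ : W → ℕ) (f : V ↪ W),
    IsSimpleTTreeOrder H t σ ∧ ∀ u v : V, G.Adj u v → H.Adj (f u) (f v)
variable {W : Type}

/-- The neighbours of `v` that precede `v` in the ordering `σ`. -/
def backNbrs (H : SimpleGraph W) (σ : W → ℕ) (v : W) : Set W :=
  {u | H.Adj u v ∧ σ u < σ v}

/-- A hereditary relaxation of simple `t`-trees: `σ` is injective, earlier neighbourhoods are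
cliques with at most `t` vertices, and every `t`-clique has at most two common neighbours. -/
structure IsSimpleElimOrder (H : SimpleGraph W) (t : ℕ) (σ : W → ℕ) : Prop where
  inj : Function.Injective σ
  clique : ∀ v, H.IsClique (backNbrs H σ v)
  ncard_le : ∀ v, (backNbrs H σ v).ncard ≤ t
  common : ∀ Q : Finset W, Q.card = t → H.IsClique (Q : Set W) → ∀ a b c : W,
    (∀ q ∈ Q, H.Adj q a) → (∀ q ∈ Q, H.Adj q b) → (∀ q ∈ Q, H.Adj q c) →
    a = b ∨ a = c ∨ b = c

/-- The vertices that are `k`-hop `ℓ`-reachable from `v` along lazy walks, which may repeat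
vertices and stay in place. -/
def lazyReach (H : SimpleGraph W) (τ : W → ℕ) (k ℓ : ℕ) (v : W) : Set W :=
  {u | ∃ n ≤ ℓ, ∃ p : ℕ → W, p 0 = v ∧ p n = u ∧
    (∀ i < n, p i = p (i + 1) ∨ H.Adj (p i) (p (i + 1))) ∧
    (∀ i < n, τ u < τ (p i)) ∧
    {j : ℕ | 1 ≤ j ∧ j ≤ n ∧ ∀ i < j, τ (p j) < τ (p i)}.ncard ≤ k}

lemma self_mem_lazyReach (H : SimpleGraph W) (τ : W → ℕ) (k ℓ : ℕ) (v : W) :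
    v ∈ lazyReach H τ k ℓ v := by
  refine ⟨0, Nat.zero_le _, fun _ => v, rfl, rfl, by simp, by simp, ?_⟩
  have : {j : ℕ | 1 ≤ j ∧ j ≤ 0 ∧ ∀ i < j, τ v < τ v} = ∅ := by
    ext j; simp; omega
  simp only [this]
  simp

/-- Two functions to `ℕ`, the second one injective, can be combined lexicographically into one
injective function to `ℕ`. -/
lemma exists_lex_order [Finite W] (lam τ : W → ℕ) (hτ : Function.Injective τ) :
    ∃ ρ : W → ℕ, Function.Injective ρ ∧
      ∀ a b, ρ a < ρ b ↔ lam a < lam b ∨ (lam a = lam b ∧ τ a < τ b) := by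
  obtain ⟨M, hM⟩ := (Set.finite_range τ).bddAbove
  have hM' : ∀ a, τ a ≤ M := fun a => hM ⟨a, rfl⟩
  have key : ∀ a b, lam a * (M + 1) + τ a < lam b * (M + 1) + τ b ↔
      lam a < lam b ∨ (lam a = lam b ∧ τ a < τ b) := by
    intro a b
    have ha := hM' a
    have hb := hM' b
    rcases lt_trichotomy (lam a) (lam b) with h | h | h
    · have := Nat.mul_le_mul_right (M + 1) (Nat.succ_le_of_lt h)
      rw [Nat.succ_mul] at this
      exact ⟨fun _ => Or.inl h, fun _ => by omega⟩
    · rw [h]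
      simp
    · have := Nat.mul_le_mul_right (M + 1) (Nat.succ_le_of_lt h)
      rw [Nat.succ_mul] at this
      exact ⟨fun _ => by omega, fun _ => by omega⟩
  refine ⟨fun a => lam a * (M + 1) + τ a, fun a b hab => hτ ?_, key⟩
  have h1 := (key a b).not.1 (not_lt.2 (le_of_eq hab.symm))
  have h2 := (key b a).not.1 (not_lt.2 (le_of_eq hab))
  omega

section Layers

/-- The distance of `v` from the first vertex of its component, computed along a
perfect elimination ordering. -/
noncomputable def elimLayer (H : SimpleGraph W) (σ : W → ℕ) (v : W) : ℕ :=
  sInf (Set.range fun u : {u // H.Adj u v ∧ σ u < σ v} => elimLayer H σ u.1 + 1)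
termination_by σ v
decreasing_by exact u.2.2

variable {H : SimpleGraph W} {σ : W → ℕ}

lemma elimLayer_le_succ {u v : W} (h : H.Adj u v) (hl : σ u < σ v) :
    elimLayer H σ v ≤ elimLayer H σ u + 1 := by
  rw [elimLayer]
  exact Nat.sInf_le ⟨⟨u, h, hl⟩, rfl⟩

lemma exists_elimLayer_eq_succ {u v : W} (h : H.Adj u v) (hl : σ u < σ v) :
    ∃ w, H.Adj w v ∧ σ w < σ v ∧ elimLayer H σ v = elimLayer H σ w + 1 := by
  have hne : (Set.range fun u : {u // H.Adj u v ∧ σ u < σ v} =>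
      elimLayer H σ u.1 + 1).Nonempty := ⟨_, ⟨⟨u, h, hl⟩, rfl⟩⟩
  obtain ⟨⟨w, hw, hwl⟩, hw'⟩ := Nat.sInf_mem hne
  refine ⟨w, hw, hwl, ?_⟩
  rw [elimLayer]
  exact hw'.symm

lemma elimLayer_le {σ : W → ℕ} (hinj : Function.Injective σ)
    (hcl : ∀ v, H.IsClique (backNbrs H σ v)) {u v : W} (h : H.Adj u v) (hl : σ u < σ v) :
    elimLayer H σ u ≤ elimLayer H σ v := by
  induction hn : σ v using Nat.strong_induction_on generalizing u v with
  | _ n ih =>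
    obtain ⟨w, hw, hwl, hw'⟩ := exists_elimLayer_eq_succ h hl
    rcases eq_or_ne u w with rfl | huw
    · omega
    have hadj : H.Adj u w := hcl v ⟨h, hl⟩ ⟨hw, hwl⟩ huw
    rcases lt_trichotomy (σ u) (σ w) with h1 | h1 | h1
    · have := ih (σ w) (by omega) hadj h1 rfl
      omega
    · exact absurd (hinj h1) huw
    · have := elimLayer_le_succ hadj.symm h1
      omega

lemma lt_of_elimLayer_lt (hinj : Function.Injective σ)
    (hcl : ∀ v, H.IsClique (backNbrs H σ v)) {u v : W} (h : H.Adj u v)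
    (hl : elimLayer H σ u < elimLayer H σ v) : σ u < σ v := by
  rcases lt_trichotomy (σ u) (σ v) with h1 | h1 | h1
  · exact h1
  · exact absurd (hinj h1) h.ne
  · have := elimLayer_le hinj hcl h.symm h1
    omega

lemma elimLayer_le_succ_of_adj (hinj : Function.Injective σ)
    (hcl : ∀ v, H.IsClique (backNbrs H σ v)) {u v : W} (h : H.Adj u v) :
    elimLayer H σ v ≤ elimLayer H σ u + 1 := by
  by_contra hc
  have := elimLayer_le_succ h (lt_of_elimLayer_lt hinj hcl h (by omega))
  omega

/-- The vertices of layer `j` attached to a component of the graph above layer `j` form a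
clique. -/
lemma exists_attachment (hinj : Function.Injective σ)
    (hcl : ∀ v, H.IsClique (backNbrs H σ v)) (j : ℕ) :
    ∃ A : W → Set W,
      (∀ c d, j < elimLayer H σ c → j < elimLayer H σ d → H.Adj c d → A c = A d) ∧
      (∀ c x, j < elimLayer H σ c → elimLayer H σ x = j → H.Adj x c → x ∈ A c) ∧
      ∀ c, H.IsClique (A c) ∧ ∀ x ∈ A c, elimLayer H σ x = j := by
  classical
  have hroot : ∃ root : W → W, ∀ v,
      (j < elimLayer H σ v → j < elimLayer H σ (root v)) ∧
      ((∃ u, H.Adj u v ∧ σ u < σ v ∧ j < elimLayer H σ u) →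
        ∃ u, (H.Adj u v ∧ σ u < σ v ∧ j < elimLayer H σ u) ∧ root v = root u) ∧
      ((¬ ∃ u, H.Adj u v ∧ σ u < σ v ∧ j < elimLayer H σ u) → root v = v) := by
    let F : (v : W) → ((u : W) → σ u < σ v → W) → W := fun v f =>
      if h : ∃ u, H.Adj u v ∧ σ u < σ v ∧ j < elimLayer H σ u then
        f h.choose h.choose_spec.2.1 else v
    let root : W → W := (measure σ).wf.fix F
    have heq : ∀ v, root v = F v (fun u _ => root u) := fun v => WellFounded.fix_eq _ F v
    have h2 : ∀ v, (∃ u, H.Adj u v ∧ σ u < σ v ∧ j < elimLayer H σ u) →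
        ∃ u, (H.Adj u v ∧ σ u < σ v ∧ j < elimLayer H σ u) ∧ root v = root u := by
      intro v h
      refine ⟨h.choose, h.choose_spec, ?_⟩
      rw [heq v]
      exact dif_pos h
    have h3 : ∀ v, (¬ ∃ u, H.Adj u v ∧ σ u < σ v ∧ j < elimLayer H σ u) → root v = v := by
      intro v h
      rw [heq v]
      exact dif_neg h
    refine ⟨root, fun v => ⟨?_, h2 v, h3 v⟩⟩
    induction hn : σ v using Nat.strong_induction_on generalizing v with
    | _ n ih =>
      intro hv
      by_cases h : ∃ u, H.Adj u v ∧ σ u < σ v ∧ j < elimLayer H σ u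
      · obtain ⟨u, ⟨_, hu2, hu3⟩, hu4⟩ := h2 v h
        rw [hu4]
        exact ih (σ u) (by omega) u rfl hu3
      · rw [h3 v h]
        exact hv
  obtain ⟨root, hroot⟩ := hroot
  have hback : ∀ v u, H.Adj u v → σ u < σ v → j < elimLayer H σ u → root u = root v := by
    intro v
    induction hn : σ v using Nat.strong_induction_on generalizing v with
    | _ n ih =>
      intro u hu hul hju
      obtain ⟨w, ⟨hw, hwl, hjw⟩, hw'⟩ := (hroot v).2.1 ⟨u, hu, by omega, hju⟩
      rw [hw']
      rcases eq_or_ne u w with rfl | huw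
      · rfl
      have hadj : H.Adj u w := hcl v ⟨hu, by omega⟩ ⟨hw, hwl⟩ huw
      rcases lt_trichotomy (σ u) (σ w) with h1 | h1 | h1
      · exact ih (σ w) (by omega) w rfl u hadj h1 hju
      · exact absurd (hinj h1) huw
      · exact (ih (σ u) (by omega) u rfl w hadj.symm h1 hjw).symm
  have hsub : ∀ c x, j < elimLayer H σ c → elimLayer H σ x = j → H.Adj x c →
      H.Adj x (root c) := by
    intro c
    induction hn : σ c using Nat.strong_induction_on generalizing c with
    | _ n ih =>
      intro x hc hx hxc
      by_cases h : ∃ u, H.Adj u c ∧ σ u < σ c ∧ j < elimLayer H σ u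
      · obtain ⟨u, ⟨hu1, hu2, hu3⟩, hu4⟩ := (hroot c).2.1 h
        rw [hu4]
        refine ih (σ u) (by omega) u rfl x hu3 hx ?_
        refine hcl c ⟨hxc, lt_of_elimLayer_lt hinj hcl hxc (by omega)⟩ ⟨hu1, hu2⟩ ?_
        rintro rfl
        omega
      · rw [(hroot c).2.2 h]
        exact hxc
  refine ⟨fun c => {x | H.Adj x (root c) ∧ elimLayer H σ x = j ∧ j < elimLayer H σ (root c)},
    ?_, ?_, ?_⟩
  · intro c d hc hd hcd
    have : root c = root d := by
      rcases lt_trichotomy (σ c) (σ d) with h1 | h1 | h1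
      · exact hback d c hcd h1 hc
      · exact absurd (hinj h1) hcd.ne
      · exact (hback c d hcd.symm h1 hd).symm
    simp only [this]
  · exact fun c x hc hx hxc => ⟨hsub c x hc hx hxc, hx, (hroot c).1 hc⟩
  · refine fun c => ⟨?_, fun x hx => hx.2.1⟩
    refine (hcl (root c)).subset ?_
    rintro x ⟨h1, h2, h3⟩
    exact ⟨h1, lt_of_elimLayer_lt hinj hcl h1 (by omega)⟩

/-- The subgraph keeping the edges whose ends are in the same layer. -/
def layerGraph (H : SimpleGraph W) (lam : W → ℕ) : SimpleGraph W where
  Adj u v := H.Adj u v ∧ lam u = lam v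
  symm := ⟨fun _ _ h => ⟨h.1.symm, h.2.symm⟩⟩
  loopless := ⟨fun _ h => H.loopless.irrefl _ h.1⟩

/-- A clique within layer `a + 1` has a common neighbour in layer `a`. -/
lemma exists_common_nbr_below (hinj : Function.Injective σ)
    (hcl : ∀ v, H.IsClique (backNbrs H σ v)) {Q : Finset W} (hQ : Q.Nonempty)
    (hQc : H.IsClique (Q : Set W)) {a : ℕ} (ha : ∀ q ∈ Q, elimLayer H σ q = a + 1) :
    ∃ z, elimLayer H σ z = a ∧ ∀ q ∈ Q, H.Adj q z := by
  obtain ⟨m, hm, hmax⟩ := Q.exists_max_image σ hQ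
  have hex : ∃ u, H.Adj u m ∧ σ u < σ m := by
    by_contra h
    have h0 : elimLayer H σ m = 0 := by
      rw [elimLayer, Nat.sInf_eq_zero]
      right
      rw [Set.range_eq_empty_iff]
      exact ⟨fun u => h ⟨u.1, u.2⟩⟩
    have := ha m hm
    omega
  obtain ⟨u, hu, hul⟩ := hex
  obtain ⟨z, hz, hzl, hz'⟩ := exists_elimLayer_eq_succ hu hul
  have hza : elimLayer H σ z = a := by
    have := ha m hm
    omega
  refine ⟨z, hza, fun q hq => ?_⟩
  rcases eq_or_ne q m with rfl | hqm
  · exact hz.symm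
  have hlt : σ q < σ m := lt_of_le_of_ne (hmax q hq) fun h => hqm (hinj h)
  refine hcl m ⟨hQc hq hm hqm, hlt⟩ ⟨hz, hzl⟩ ?_
  rintro rfl
  have := ha q hq
  omega

/-- Keeping only the edges inside layers lowers the simple treewidth. -/
lemma IsSimpleElimOrder.layerGraph [Finite W] {t : ℕ} (ht : 0 < t)
    (h : IsSimpleElimOrder H (t + 1) σ) :
    IsSimpleElimOrder (layerGraph H (elimLayer H σ)) t σ := by
  classical
  refine ⟨h.inj, ?_, ?_, ?_⟩
  · rintro v a ⟨ha, hal⟩ b ⟨hb, hbl⟩ hab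
    exact ⟨h.clique v ⟨ha.1, hal⟩ ⟨hb.1, hbl⟩ hab, ha.2.trans hb.2.symm⟩
  · intro v
    rcases (backNbrs (_root_.layerGraph H (elimLayer H σ)) σ v).eq_empty_or_nonempty
      with he | ⟨u, hu, hul⟩
    · rw [he]
      simp
    · obtain ⟨w, hw, hwl, hw'⟩ := exists_elimLayer_eq_succ hu.1 hul
      have hlt : (backNbrs (_root_.layerGraph H (elimLayer H σ)) σ v).ncard <
          (backNbrs H σ v).ncard := by
        refine Set.ncard_lt_ncard ⟨fun x hx => ⟨hx.1.1, hx.2⟩, fun hs => ?_⟩ (Set.toFinite _)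
        have := (hs ⟨hw, hwl⟩ : w ∈ backNbrs (_root_.layerGraph H (elimLayer H σ)) σ v).1.2
        omega
      have := h.ncard_le v
      omega
  · intro Q hQ hQc v₁ v₂ v₃ h₁ h₂ h₃
    by_contra hne
    push Not at hne
    obtain ⟨h12, h13, h23⟩ := hne
    have hQn : Q.Nonempty := Finset.card_pos.1 (by omega)
    obtain ⟨y, hy, hmax⟩ := Q.exists_max_image σ hQn
    have hQc' : H.IsClique (Q : Set W) := fun a ha b hb hab => (hQc ha hb hab).1
    have hQl : ∀ q ∈ Q, elimLayer H σ q = elimLayer H σ y := by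
      intro q hq
      rcases eq_or_ne q y with rfl | hqy
      · rfl
      · exact (hQc hq hy hqy).2
    obtain ⟨a, ha⟩ : ∃ a, elimLayer H σ y = a + 1 := by
      have h1 := h₁ y hy
      rcases lt_trichotomy (σ y) (σ v₁) with hl | hl | hl
      · obtain ⟨w, _, _, hw⟩ := exists_elimLayer_eq_succ h1.1 hl
        exact ⟨_, h1.2.trans hw⟩
      · exact absurd (h.inj hl) h1.1.ne
      · obtain ⟨w, _, _, hw⟩ := exists_elimLayer_eq_succ h1.1.symm hl
        exact ⟨_, hw⟩
    have hz : ∀ v, (∀ q ∈ Q, (_root_.layerGraph H (elimLayer H σ)).Adj q v) →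
        ∃ z, elimLayer H σ z = a ∧ (∀ q ∈ Q, H.Adj q z) ∧ H.Adj v z := by
      intro v hv
      have := exists_common_nbr_below h.inj h.clique (Q := insert v Q) ⟨v, by simp⟩ (a := a) ?_ ?_
      · obtain ⟨z, hz1, hz2⟩ := this
        exact ⟨z, hz1, fun q hq => hz2 q (Finset.mem_insert_of_mem hq),
          hz2 v (Finset.mem_insert_self _ _)⟩
      · rw [Finset.coe_insert]
        exact hQc'.insert fun b hb _ => (hv b hb).1.symm
      · intro q hq
        rcases Finset.mem_insert.1 hq with rfl | hq
        · exact (hv y hy).2.symm.trans ha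
        · exact (hQl q hq).trans ha
    obtain ⟨z₁, hz₁, hq₁, hv₁⟩ := hz v₁ h₁
    obtain ⟨z₂, hz₂, hq₂, hv₂⟩ := hz v₂ h₂
    obtain ⟨z₃, hz₃, hq₃, hv₃⟩ := hz v₃ h₃
    have hzy : ∀ z, elimLayer H σ z = a → (∀ q ∈ Q, H.Adj q z) → z ∈ backNbrs H σ y :=
      fun z hz hq => ⟨(hq y hy).symm,
        lt_of_elimLayer_lt h.inj h.clique (hq y hy).symm (by omega)⟩
    have hva : ∀ v, (∀ q ∈ Q, (_root_.layerGraph H (elimLayer H σ)).Adj q v) →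
        elimLayer H σ v = a + 1 := fun v hv => (hv y hy).2.symm.trans ha
    have hzQ : ∀ z, elimLayer H σ z = a → z ∉ Q := by
      intro z hz hzQ
      have := hQl z hzQ
      omega
    have hcomm : ∀ z b c d, elimLayer H σ z = a → (∀ q ∈ Q, H.Adj q z) →
        ((∀ q ∈ Q, H.Adj q b) ∧ H.Adj b z) → ((∀ q ∈ Q, H.Adj q c) ∧ H.Adj c z) →
        ((∀ q ∈ Q, H.Adj q d) ∧ H.Adj d z) → b = c ∨ b = d ∨ c = d := by
      intro z b c d hz hq hb hc hd
      have hins : ∀ e, ((∀ q ∈ Q, H.Adj q e) ∧ H.Adj e z) → ∀ q ∈ insert z Q, H.Adj q e := by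
        intro e he q hq
        rcases Finset.mem_insert.1 hq with rfl | hq
        · exact he.2.symm
        · exact he.1 q hq
      refine h.common (insert z Q) ?_ ?_ b c d (hins b hb) (hins c hc) (hins d hd)
      · rw [Finset.card_insert_of_notMem (hzQ z hz), hQ]
      · rw [Finset.coe_insert]
        exact hQc'.insert fun b hb _ => (hq b hb).symm
    have w₁ : ∀ q ∈ Q, H.Adj q v₁ := fun q hq => (h₁ q hq).1
    have w₂ : ∀ q ∈ Q, H.Adj q v₂ := fun q hq => (h₂ q hq).1
    have w₃ : ∀ q ∈ Q, H.Adj q v₃ := fun q hq => (h₃ q hq).1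
    have hvz : ∀ v z, (∀ q ∈ Q, (_root_.layerGraph H (elimLayer H σ)).Adj q v) →
        elimLayer H σ z = a → v ≠ z := by
      rintro v z hv hz rfl
      have := hva v hv
      omega
    -- two vertices attached to the same vertex of layer `a`, the third one to a different vertex
    have htwo : ∀ u v z z', u ≠ v →
        (∀ q ∈ Q, (_root_.layerGraph H (elimLayer H σ)).Adj q u) →
        (∀ q ∈ Q, (_root_.layerGraph H (elimLayer H σ)).Adj q v) →
        elimLayer H σ z = a → elimLayer H σ z' = a → (∀ q ∈ Q, H.Adj q z) →
        (∀ q ∈ Q, H.Adj q z') → H.Adj u z → H.Adj v z → z ≠ z' → False := by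
      intro u v z z' huv hu hv hz hz' hq hq' huz hvz' hzz
      have hadj : H.Adj z' z := h.clique y (hzy z' hz' hq') (hzy z hz hq) hzz.symm
      rcases hcomm z u v z' hz hq ⟨fun q hq => (hu q hq).1, huz⟩
        ⟨fun q hq => (hv q hq).1, hvz'⟩ ⟨hq', hadj⟩ with e | e | e
      · exact huv e
      · exact hvz u z' hu hz' e
      · exact hvz v z' hv hz' e
    rcases eq_or_ne z₁ z₂ with e12 | n12
    · subst e12
      rcases eq_or_ne z₁ z₃ with e13 | n13
      · subst e13
        rcases hcomm z₁ v₁ v₂ v₃ hz₁ hq₁ ⟨w₁, hv₁⟩ ⟨w₂, hv₂⟩ ⟨w₃, hv₃⟩ with e | e | e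
        · exact h12 e
        · exact h13 e
        · exact h23 e
      · exact htwo v₁ v₂ z₁ z₃ h12 h₁ h₂ hz₁ hz₃ hq₁ hq₃ hv₁ hv₂ n13
    rcases eq_or_ne z₁ z₃ with e13 | n13
    · subst e13
      exact htwo v₁ v₃ z₁ z₂ h13 h₁ h₃ hz₁ hz₂ hq₁ hq₂ hv₁ hv₃ n12
    rcases eq_or_ne z₂ z₃ with e23 | n23
    · subst e23
      exact htwo v₂ v₃ z₂ z₁ h23 h₂ h₃ hz₂ hz₁ hq₂ hq₁ hv₂ hv₃ n12.symm
    have hsub : ((insert z₁ (insert z₂ (insert z₃ (Q.erase y))) : Finset W) : Set W) ⊆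
        backNbrs H σ y := by
      intro x hx
      simp only [Finset.coe_insert, Set.mem_insert_iff, Finset.mem_coe, Finset.mem_erase] at hx
      rcases hx with rfl | rfl | rfl | ⟨hxy, hx⟩
      · exact hzy _ hz₁ hq₁
      · exact hzy _ hz₂ hq₂
      · exact hzy _ hz₃ hq₃
      · exact ⟨hQc' hx hy hxy, lt_of_le_of_ne (hmax x hx) fun e => hxy (h.inj e)⟩
    have hcard := Set.ncard_le_ncard hsub (Set.toFinite _)
    rw [Set.ncard_coe_finset, Finset.card_insert_of_notMem, Finset.card_insert_of_notMem,
      Finset.card_insert_of_notMem, Finset.card_erase_of_mem hy, hQ] at hcard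
    · have := h.ncard_le y
      omega
    · simp [hzQ z₃ hz₃]
    · simp [hzQ z₂ hz₂, n23]
    · simp [hzQ z₁ hz₁, n12, n13]

end Layers

section Step

variable {H : SimpleGraph W} {σ τ ρ : W → ℕ}

/-- A lazy walk visits every layer it descends through, each time with a new hop. -/
lemma elimLayer_le_add_of_mem_lazyReach (hinj : Function.Injective σ)
    (hcl : ∀ v, H.IsClique (backNbrs H σ v))
    (hρ : ∀ a b, elimLayer H σ a < elimLayer H σ b → ρ a < ρ b) {k ℓ : ℕ} {u v : W}
    (hu : u ∈ lazyReach H ρ k ℓ v) :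
    elimLayer H σ v ≤ elimLayer H σ u + k := by
  classical
  obtain ⟨n, -, p, rfl, rfl, hstep, -, hk⟩ := hu
  have hsub : Set.Ico (elimLayer H σ (p n)) (elimLayer H σ (p 0)) ⊆
      (fun i => elimLayer H σ (p i)) ''
        {j : ℕ | 1 ≤ j ∧ j ≤ n ∧ ∀ i < j, ρ (p j) < ρ (p i)} := by
    rintro m ⟨hm1, hm2⟩
    have hex : ∃ s, elimLayer H σ (p s) ≤ m := ⟨n, hm1⟩
    obtain ⟨s, hs, hmin⟩ : ∃ s, elimLayer H σ (p s) ≤ m ∧ ∀ i < s, m < elimLayer H σ (p i) :=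
      ⟨Nat.find hex, Nat.find_spec hex, fun i hi => not_le.1 (Nat.find_min hex hi)⟩
    have hs0 : s ≠ 0 := by
      rintro rfl
      omega
    have hsn : s ≤ n := by
      by_contra hc
      have := hmin n (by omega)
      omega
    refine ⟨s, ⟨by omega, hsn, fun i hi => hρ _ _ (lt_of_le_of_lt hs (hmin i hi))⟩, ?_⟩
    obtain ⟨r, rfl⟩ := Nat.exists_eq_succ_of_ne_zero hs0
    have hr := hmin r (by omega)
    rcases hstep r (by omega) with e | e
    · simp only [Nat.succ_eq_add_one] at hs
      rw [← e] at hs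
      omega
    · have := elimLayer_le_succ_of_adj hinj hcl e.symm
      simp only [Nat.succ_eq_add_one] at hs ⊢
      omega
  have hfin : {j : ℕ | 1 ≤ j ∧ j ≤ n ∧ ∀ i < j, ρ (p j) < ρ (p i)}.Finite :=
    (Set.finite_Iic n).subset fun j hj => hj.2.1
  have h1 := Set.ncard_le_ncard hsub (hfin.image _)
  have h2 := Set.ncard_image_le (f := fun i => elimLayer H σ (p i)) hfin
  rw [← Finset.coe_Ico, Set.ncard_coe_finset, Nat.card_Ico] at h1
  omega

/-- Within layer `j`, everything reachable from `v` is reachable from a single vertex. -/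
lemma exists_lazyReach_layer [Finite W] (hinj : Function.Injective σ)
    (hcl : ∀ v, H.IsClique (backNbrs H σ v)) (hτ : Function.Injective τ)
    (hρ : ∀ a b, ρ a < ρ b ↔ elimLayer H σ a < elimLayer H σ b ∨
      (elimLayer H σ a = elimLayer H σ b ∧ τ a < τ b))
    (k ℓ j : ℕ) (v : W) (hj : j ≤ elimLayer H σ v) :
    ∃ x, ∀ u ∈ lazyReach H ρ k ℓ v, elimLayer H σ u = j →
      u ∈ lazyReach (layerGraph H (elimLayer H σ)) τ k ℓ x := by
  classical
  obtain ⟨A, hA1, hA2, hA3⟩ := exists_attachment hinj hcl j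
  -- the set in which the first vertex of layer `j` on the walk lies
  obtain ⟨B, hB⟩ : ∃ B : Set W, B = if elimLayer H σ v = j then {v} else A v := ⟨_, rfl⟩
  have hentry : ∀ n (p : ℕ → W), p 0 = v →
      (∀ i < n, p i = p (i + 1) ∨ H.Adj (p i) (p (i + 1))) →
      (∀ i ≤ n, j ≤ elimLayer H σ (p i)) →
      (∃ y ∈ B, ∃ i ≤ n, p i = y) ∨ (j < elimLayer H σ (p n) ∧ A (p n) = B) := by
    intro n p h0 hstep hlow
    induction n with
    | zero =>
      by_cases hv : elimLayer H σ v = j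
      · rw [if_pos hv] at hB
        exact Or.inl ⟨v, by simp [hB], 0, le_rfl, h0⟩
      · rw [if_neg hv] at hB
        exact Or.inr ⟨by rw [h0]; omega, by rw [h0, hB]⟩
    | succ n ih =>
      rcases ih (fun i hi => hstep i (by omega)) (fun i hi => hlow i (by omega)) with
        ⟨y, hy, i, hi, e⟩ | ⟨hn, hAn⟩
      · exact Or.inl ⟨y, hy, i, by omega, e⟩
      · rcases hstep n (by omega) with e | e
        · rw [← e]
          exact Or.inr ⟨hn, hAn⟩
        · rcases (hlow (n + 1) le_rfl).eq_or_lt with h1 | h1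
          · refine Or.inl ⟨p (n + 1), ?_, n + 1, le_rfl, rfl⟩
            rw [← hAn]
            exact hA2 _ _ hn h1.symm e.symm
          · exact Or.inr ⟨h1, by rw [← hA1 _ _ hn h1 e, hAn]⟩
  rcases B.eq_empty_or_nonempty with hBe | hBn
  · refine ⟨v, fun u hu huj => ?_⟩
    obtain ⟨n, hn, p, h0, rfl, hstep, hmin, -⟩ := hu
    have hlow : ∀ i ≤ n, j ≤ elimLayer H σ (p i) := by
      intro i hi
      rcases hi.eq_or_lt with rfl | hi
      · exact huj.ge
      · have := (hρ _ _).1 (hmin i hi)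
        omega
    rcases hentry n p h0 hstep hlow with ⟨y, hy, -⟩ | ⟨h, -⟩
    · simp [hBe] at hy
    · omega
  obtain ⟨x, hxB, hxmax⟩ := Set.exists_max_image B τ (Set.toFinite _) hBn
  refine ⟨x, fun u hu huj => ?_⟩
  obtain ⟨n, hn, p, h0, rfl, hstep, hmin, hk⟩ := hu
  rcases eq_or_ne (p n) x with e | hne
  · rw [e]
    exact self_mem_lazyReach _ _ _ _ _
  have hlow : ∀ i ≤ n, j ≤ elimLayer H σ (p i) := by
    intro i hi
    rcases hi.eq_or_lt with rfl | hi
    · exact huj.ge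
    · have := (hρ _ _).1 (hmin i hi)
      omega
  have hmin' : ∀ i < n, elimLayer H σ (p i) = j → τ (p n) < τ (p i) := by
    intro i hi hij
    have := (hρ _ _).1 (hmin i hi)
    omega
  have hux : τ (p n) < τ x := by
    rcases hentry n p h0 hstep hlow with ⟨y, hy, i, hi, e⟩ | ⟨h, -⟩
    · have hle : τ y ≤ τ x := hxmax y hy
      have hyj : elimLayer H σ y = j := by
        rw [hB] at hy
        split_ifs at hy with hv
        · rw [Set.mem_singleton_iff.1 hy, hv]
        · exact (hA3 v).2 y hy
      have hny : τ (p n) ≤ τ y := by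
        rcases hi.eq_or_lt with h1 | h1
        · rw [← e, h1]
        · rw [← e]
          exact (hmin' i h1 (by rw [e, hyj])).le
      exact lt_of_le_of_ne (hny.trans hle) fun e => hne (hτ e)
    · omega
  let q : ℕ → W := fun i =>
    Nat.rec x (fun i w => if elimLayer H σ (p (i + 1)) = j then p (i + 1) else w) i
  have hq0 : q 0 = x := rfl
  have hqs : ∀ i, q (i + 1) = if elimLayer H σ (p (i + 1)) = j then p (i + 1) else q i :=
    fun i => rfl
  have hq : ∀ i ≤ n, (elimLayer H σ (p i) = j → q i = p i) ∧
      (j < elimLayer H σ (p i) → q i ∈ A (p i)) ∧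
      (q i = x ∨ ∃ i' ≤ i, elimLayer H σ (p i') = j ∧ q i = p i') := by
    intro i
    induction i with
    | zero =>
      intro _
      refine ⟨fun h => ?_, fun h => ?_, Or.inl hq0⟩
      · rw [h0] at h ⊢
        rw [if_pos h] at hB
        rw [hB] at hxB
        exact hxB
      · rw [h0] at h ⊢
        rw [if_neg h.ne'] at hB
        rw [← hB]
        exact hxB
    | succ i ih =>
      intro hi
      obtain ⟨ih1, ih2, ih3⟩ := ih (by omega)
      rcases (hlow (i + 1) hi).eq_or_lt with h | h
      · have e : q (i + 1) = p (i + 1) := by rw [hqs, if_pos h.symm]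
        exact ⟨fun _ => e, fun h' => by omega, Or.inr ⟨i + 1, le_rfl, h.symm, e⟩⟩
      · have e : q (i + 1) = q i := by rw [hqs, if_neg h.ne']
        refine ⟨fun h' => by omega, fun _ => ?_, ?_⟩
        · rw [e]
          rcases hstep i (by omega) with e' | e'
          · rw [← e']
            exact ih2 (by rw [e']; exact h)
          · rcases (hlow i (by omega)).eq_or_lt with h1 | h1
            · rw [ih1 h1.symm]
              exact hA2 _ _ h h1.symm e'
            · rw [← hA1 _ _ h1 h e']
              exact ih2 h1
        · rw [e]
          rcases ih3 with e' | ⟨i', hi', h1, h2⟩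
          · exact Or.inl e'
          · exact Or.inr ⟨i', by omega, h1, h2⟩
  refine ⟨n, hn, q, hq0, (hq n le_rfl).1 huj, ?_, ?_, ?_⟩
  · intro i hi
    rcases (hlow (i + 1) hi).eq_or_lt with h | h
    · rw [hqs, if_pos h.symm]
      rcases (hlow i hi.le).eq_or_lt with h1 | h1
      · rw [(hq i hi.le).1 h1.symm]
        rcases hstep i hi with e | e
        · exact Or.inl e
        · exact Or.inr ⟨e, by omega⟩
      · have hqi := (hq i hi.le).2.1 h1
        have hpi : p (i + 1) ∈ A (p i) := by
          rcases hstep i hi with e | e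
          · rw [← e] at h
            omega
          · exact hA2 _ _ h1 h.symm e.symm
        rcases eq_or_ne (q i) (p (i + 1)) with e | e
        · exact Or.inl e
        · exact Or.inr ⟨(hA3 _).1 hqi hpi e, by rw [(hA3 _).2 _ hqi, h]⟩
    · rw [hqs, if_neg h.ne']
      exact Or.inl rfl
  · intro i hi
    rcases (hq i hi.le).2.2 with e | ⟨i', hi', h1, e⟩
    · rw [e]
      exact hux
    · rw [e]
      exact hmin' i' (by omega) h1
  · refine le_trans (Set.ncard_le_ncard ?_ ((Set.finite_Iic n).subset fun j hj => hj.2.1)) hk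
    rintro s ⟨hs1, hs2, hs3⟩
    refine ⟨hs1, hs2, fun i hi => ?_⟩
    obtain ⟨r, rfl⟩ : ∃ r, s = r + 1 := ⟨s - 1, by omega⟩
    have hsj : elimLayer H σ (p (r + 1)) = j := by
      by_contra hc
      have := hs3 r (by omega)
      rw [hqs, if_neg hc] at this
      exact lt_irrefl _ this
    rw [hρ]
    rcases (hlow i (by omega)).eq_or_lt with h1 | h1
    · right
      refine ⟨by omega, ?_⟩
      have := hs3 i hi
      rwa [(hq i (by omega)).1 h1.symm, (hq (r + 1) hs2).1 hsj] at this
    · left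
      omega

lemma ncard_lazyReach_le_succ_mul [Finite W] (hinj : Function.Injective σ)
    (hcl : ∀ v, H.IsClique (backNbrs H σ v)) (hτ : Function.Injective τ)
    (hρ : ∀ a b, ρ a < ρ b ↔ elimLayer H σ a < elimLayer H σ b ∨
      (elimLayer H σ a = elimLayer H σ b ∧ τ a < τ b))
    {k ℓ C : ℕ}
    (hC : ∀ v, (lazyReach (layerGraph H (elimLayer H σ)) τ k ℓ v).ncard ≤ C) (v : W) :
    (lazyReach H ρ k ℓ v).ncard ≤ (k + 1) * C := by
  classical
  have hx : ∀ j, ∃ x, j ≤ elimLayer H σ v → ∀ u ∈ lazyReach H ρ k ℓ v, elimLayer H σ u = j →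
      u ∈ lazyReach (layerGraph H (elimLayer H σ)) τ k ℓ x := by
    intro j
    by_cases hj : j ≤ elimLayer H σ v
    · obtain ⟨x, hx⟩ := exists_lazyReach_layer hinj hcl hτ hρ k ℓ j v hj
      exact ⟨x, fun _ => hx⟩
    · exact ⟨v, fun h => absurd h hj⟩
  choose x hx using hx
  have hsub : lazyReach H ρ k ℓ v ⊆
      ⋃ j ∈ Finset.Icc (elimLayer H σ v - k) (elimLayer H σ v),
        lazyReach (layerGraph H (elimLayer H σ)) τ k ℓ (x j) := by
    intro u hu
    have h1 := elimLayer_le_add_of_mem_lazyReach hinj hcl (fun a b h => (hρ a b).2 (Or.inl h)) hu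
    have h2 : elimLayer H σ u ≤ elimLayer H σ v := by
      obtain ⟨n, -, p, h0, hn, -, hmin, -⟩ := hu
      rcases Nat.eq_zero_or_pos n with rfl | hpos
      · rw [← hn, h0]
      · have := (hρ _ _).1 (hmin 0 hpos)
        rw [h0] at this
        omega
    simp only [Set.mem_iUnion]
    exact ⟨elimLayer H σ u, Finset.mem_Icc.2 ⟨by omega, h2⟩, hx _ h2 u hu rfl⟩
  calc (lazyReach H ρ k ℓ v).ncard
      ≤ (⋃ j ∈ Finset.Icc (elimLayer H σ v - k) (elimLayer H σ v),
        lazyReach (layerGraph H (elimLayer H σ)) τ k ℓ (x j)).ncard :=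
        Set.ncard_le_ncard hsub (Set.toFinite _)
    _ ≤ ∑ j ∈ Finset.Icc (elimLayer H σ v - k) (elimLayer H σ v),
        (lazyReach (layerGraph H (elimLayer H σ)) τ k ℓ (x j)).ncard :=
        Finset.set_ncard_biUnion_le _ _
    _ ≤ (Finset.Icc (elimLayer H σ v - k) (elimLayer H σ v)).card * C := by
        rw [← smul_eq_mul]
        exact Finset.sum_le_card_nsmul _ _ _ fun j _ => hC _
    _ ≤ (k + 1) * C := by
        gcongr
        rw [Nat.card_Icc]
        omega

end Step

section Path

/-- The rank of `x` in the ruler ordering of depth `q`: multiples of `2 ^ q` have rank `0`, the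
remaining multiples of `2 ^ (q - 1)` have rank `1`, and so on. -/
noncomputable def rulerRank (q x : ℕ) : ℕ := sInf {i | 2 ^ (q - i) ∣ x}

lemma pow_dvd_of_rulerRank (q x : ℕ) : 2 ^ (q - rulerRank q x) ∣ x :=
  Nat.sInf_mem (s := {i | 2 ^ (q - i) ∣ x}) ⟨q, by simp⟩

lemma rulerRank_le_of_dvd {q x i : ℕ} (h : 2 ^ (q - i) ∣ x) : rulerRank q x ≤ i :=
  Nat.sInf_le h

lemma rulerRank_le (q x : ℕ) : rulerRank q x ≤ q :=
  rulerRank_le_of_dvd (by simp)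

/-- Between two numbers of the same positive rank there is one of smaller rank. -/
lemma exists_rulerRank_lt_between {q x y : ℕ} (hxy : x < y)
    (he : rulerRank q x = rulerRank q y) (hpos : rulerRank q x ≠ 0) :
    ∃ m, x < m ∧ m < y ∧ rulerRank q m < rulerRank q x := by
  obtain ⟨i, hi⟩ := Nat.exists_eq_succ_of_ne_zero hpos
  rw [Nat.succ_eq_add_one] at hi
  have hiq : i + 1 ≤ q := hi ▸ rulerRank_le q x
  have hpow : 2 ^ (q - i) = 2 ^ (q - (i + 1)) * 2 := by
    rw [← pow_succ]
    congr 1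
    omega
  have hD : 0 < 2 ^ (q - (i + 1)) := by positivity
  obtain ⟨a, ha⟩ := pow_dvd_of_rulerRank q x
  obtain ⟨b, hb⟩ := pow_dvd_of_rulerRank q y
  rw [hi] at ha
  rw [← he, hi] at hb
  have hodd : ∀ c z, z = 2 ^ (q - (i + 1)) * c → rulerRank q z = i + 1 → ¬ 2 ∣ c := by
    rintro c z hz hr ⟨d, rfl⟩
    have : rulerRank q z ≤ i := rulerRank_le_of_dvd ⟨d, by rw [hz, hpow]; ring⟩
    omega
  have hao := hodd a x ha hi
  have hbo := hodd b y hb (he ▸ hi)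
  have hab : a < b := by
    by_contra hc
    have := Nat.mul_le_mul_left (2 ^ (q - (i + 1))) (not_lt.1 hc)
    omega
  refine ⟨2 ^ (q - (i + 1)) * (a + 1), ?_, ?_, ?_⟩
  · rw [ha]
    exact Nat.mul_lt_mul_of_pos_left (by omega) hD
  · rw [hb]
    exact Nat.mul_lt_mul_of_pos_left (by omega) hD
  · have : rulerRank q (2 ^ (q - (i + 1)) * (a + 1)) ≤ i := by
      obtain ⟨d, hd⟩ : 2 ∣ a + 1 := by omega
      exact rulerRank_le_of_dvd ⟨d, by rw [hpow, hd]; ring⟩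
    omega

/-- The number of integers at distance at most `ℓ` from `v` that precede everything between
them and `v` in the ruler ordering. -/
lemma ncard_ruler_le {k ℓ q : ℕ} (hk : 0 < k) (hkl : k ≤ ℓ) (hq : k ≤ 2 ^ q) (v : ℕ) (R : Set ℕ)
    (hlow : ∀ x ∈ R, v ≤ x + ℓ)
    (hR : ∀ x ∈ R, ∀ y, (v ≤ y ∧ y < x ∨ x < y ∧ y ≤ v) →
      rulerRank q x < rulerRank q y ∨ (rulerRank q x = rulerRank q y ∧ x < y)) :
    R.ncard ≤ q + 2 * ((ℓ + k - 1) / k) := by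
  have hceil : (ℓ + k - 1) / k = (ℓ - 1) / k + 1 := by
    rw [← Nat.add_div_right _ hk]
    congr 1
    omega
  have hdvd : ∀ x, rulerRank q x = 0 → 2 ^ q ∣ x := by
    intro x hx
    have := pow_dvd_of_rulerRank q x
    rwa [hx, Nat.sub_zero] at this
  have hsplit : R ⊆ ({x ∈ R | rulerRank q x ≠ 0} ∪ {x ∈ R | rulerRank q x = 0 ∧ x < v}) ∪
      {x ∈ R | rulerRank q x = 0 ∧ v ≤ x} := by
    intro x hx
    rcases eq_or_ne (rulerRank q x) 0 with h | h
    · rcases lt_or_ge x v with h' | h'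
      · exact Or.inl (Or.inr ⟨hx, h, h'⟩)
      · exact Or.inr ⟨hx, h, h'⟩
    · exact Or.inl (Or.inl ⟨hx, h⟩)
  have hinj1 : Set.InjOn (rulerRank q) {x ∈ R | rulerRank q x ≠ 0} := by
    have key : ∀ x ∈ R, ∀ y ∈ R, rulerRank q x ≠ 0 → rulerRank q x = rulerRank q y →
        ¬ x < y := by
      intro x hx y hy h0 he hxy
      obtain ⟨m, hm1, hm2, hm3⟩ := exists_rulerRank_lt_between hxy he h0
      rcases le_total v m with h | h
      · have := hR y hy m (Or.inl ⟨h, hm2⟩)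
        omega
      · have := hR x hx m (Or.inr ⟨hm1, h⟩)
        omega
    rintro x ⟨hx, hx0⟩ y ⟨hy, hy0⟩ he
    have h1 := key x hx y hy hx0 he
    have h2 := key y hy x hx hy0 he.symm
    omega
  have hm1 : Set.MapsTo (rulerRank q) {x ∈ R | rulerRank q x ≠ 0}
      (Finset.Icc 1 q : Finset ℕ) := by
    rintro x ⟨hx, hx0⟩
    rw [Finset.mem_coe, Finset.mem_Icc]
    exact ⟨Nat.one_le_iff_ne_zero.2 hx0, rulerRank_le q x⟩
  have hinj2 : Set.InjOn (fun x => (v - x - 1) / 2 ^ q)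
      {x ∈ R | rulerRank q x = 0 ∧ x < v} := by
    have hp : 0 < 2 ^ q := by positivity
    have key : ∀ x y, 2 ^ q ∣ x → 2 ^ q ∣ y → x < y → y < v →
        (v - y - 1) / 2 ^ q < (v - x - 1) / 2 ^ q := by
      intro x y hx hy hxy hyv
      have h1 : 2 ^ q ≤ y - x := Nat.le_of_dvd (by omega) (Nat.dvd_sub hy hx)
      have h2 : (v - y - 1) + 2 ^ q ≤ v - x - 1 := by omega
      have h3 := Nat.div_le_div_right (c := 2 ^ q) h2
      rw [Nat.add_div_right _ hp] at h3
      omega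
    rintro x ⟨hx, hx0, hxv⟩ y ⟨hy, hy0, hyv⟩ he
    simp only at he
    rcases lt_trichotomy x y with h | h | h
    · have := key x y (hdvd x hx0) (hdvd y hy0) h hyv
      omega
    · exact h
    · have := key y x (hdvd y hy0) (hdvd x hx0) h hxv
      omega
  have hm2 : Set.MapsTo (fun x => (v - x - 1) / 2 ^ q) {x ∈ R | rulerRank q x = 0 ∧ x < v}
      (Finset.range ((ℓ + k - 1) / k) : Finset ℕ) := by
    rintro x ⟨hx, -, hxv⟩
    rw [Finset.mem_coe, Finset.mem_range, hceil]
    have h1 : v - x - 1 ≤ ℓ - 1 := by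
      have := hlow x hx
      omega
    exact Nat.lt_succ_of_le ((Nat.div_le_div_right h1).trans (Nat.div_le_div_left hq hk))
  have hsub3 : ({x ∈ R | rulerRank q x = 0 ∧ v ≤ x}).Subsingleton := by
    have key : ∀ x ∈ R, ∀ y ∈ R, rulerRank q x = 0 → rulerRank q y = 0 → v ≤ x → ¬ x < y := by
      intro x hx y hy hx0 hy0 hv hxy
      have := hR y hy x (Or.inl ⟨hv, hxy⟩)
      omega
    rintro x ⟨hx, hx0, hxv⟩ y ⟨hy, hy0, hyv⟩
    have h1 := key x hx y hy hx0 hy0 hxv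
    have h2 := key y hy x hx hy0 hx0 hyv
    omega
  have hf1 := Set.Finite.of_injOn hm1 hinj1 (Finset.finite_toSet _)
  have hf2 := Set.Finite.of_injOn hm2 hinj2 (Finset.finite_toSet _)
  have hc1 := Set.ncard_le_ncard_of_injOn _ hm1 hinj1 (Finset.finite_toSet _)
  have hc2 := Set.ncard_le_ncard_of_injOn _ hm2 hinj2 (Finset.finite_toSet _)
  rw [Set.ncard_coe_finset, Nat.card_Icc] at hc1
  rw [Set.ncard_coe_finset, Finset.card_range] at hc2
  have hc3 : ({x ∈ R | rulerRank q x = 0 ∧ v ≤ x}).ncard ≤ 1 :=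
    (Set.ncard_le_one hsub3.finite).2 fun a ha b hb => hsub3 ha hb
  have h := Set.ncard_le_ncard hsplit ((hf1.union hf2).union hsub3.finite)
  have h' := Set.ncard_union_le ({x ∈ R | rulerRank q x ≠ 0} ∪
    {x ∈ R | rulerRank q x = 0 ∧ x < v}) {x ∈ R | rulerRank q x = 0 ∧ v ≤ x}
  have h'' := Set.ncard_union_le {x ∈ R | rulerRank q x ≠ 0}
    {x ∈ R | rulerRank q x = 0 ∧ x < v}
  have hpos : 1 ≤ (ℓ + k - 1) / k := by
    rw [hceil]
    exact Nat.le_add_left _ _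
  omega

variable {H : SimpleGraph W} {σ : W → ℕ}

/-- A graph of simple treewidth one is a subgraph of a path. -/
lemma IsSimpleElimOrder.exists_path_position [Finite W] (h : IsSimpleElimOrder H 1 σ) :
    ∃ pos : W → ℕ, Function.Injective pos ∧
      ∀ a b, H.Adj a b → pos b = pos a + 1 ∨ pos a = pos b + 1 := by
  classical
  have hdeg : ∀ u a b c, H.Adj u a → H.Adj u b → H.Adj u c → a = b ∨ a = c ∨ b = c := by
    intro u a b c ha hb hc
    exact h.common {u} (by simp) (by simp) a b c (by simpa) (by simpa) (by simpa)
  have hback : ∀ v a b, H.Adj a v → σ a < σ v → H.Adj b v → σ b < σ v → a = b := by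
    intro v a b ha hal hb hbl
    have := (Set.ncard_le_one (Set.toFinite _)).1 (h.ncard_le v)
    exact this a ⟨ha, hal⟩ b ⟨hb, hbl⟩
  have hind : ∀ n, ∃ pos : W → ℤ, Set.InjOn pos {w | σ w < n} ∧
      ∀ a b, σ a < n → σ b < n → H.Adj a b → pos b = pos a + 1 ∨ pos a = pos b + 1 := by
    intro n
    induction n with
    | zero => exact ⟨fun _ => 0, by simp [Set.InjOn], by simp⟩
    | succ n ih =>
      obtain ⟨pos, hpos, hadj⟩ := ih
      by_cases hv : ∃ v, σ v = n
      swap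
      · have : ∀ w, σ w < n + 1 → σ w < n := by
          intro w hw
          have : σ w ≠ n := fun e => hv ⟨w, e⟩
          omega
        exact ⟨pos, fun a ha b hb => hpos (this a ha) (this b hb),
          fun a b ha hb => hadj a b (this a ha) (this b hb)⟩
      obtain ⟨v, rfl⟩ := hv
      have hlt : ∀ w, σ w < σ v + 1 → w ≠ v → σ w < σ v := by
        intro w hw hwv
        have : σ w ≠ σ v := fun e => hwv (h.inj e)
        omega
      by_cases hu : ∃ u, H.Adj u v ∧ σ u < σ v
      swap
      · obtain ⟨M, hM⟩ := (Set.finite_range pos).bddAbove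
        have hM' : ∀ a, pos a ≤ M := fun a => hM ⟨a, rfl⟩
        refine ⟨fun w => if w = v then M + 1 else pos w, ?_, ?_⟩
        · intro a ha b hb hab
          have h1 := hM' a
          have h2 := hM' b
          by_cases hav : a = v <;> by_cases hbv : b = v <;>
            simp only [hav, hbv, if_true, if_false] at hab ⊢
          · omega
          · omega
          · exact hpos (hlt a ha hav) (hlt b hb hbv) hab
        · intro a b ha hb hab
          by_cases hav : a = v
          · subst hav
            exact absurd ⟨b, hab.symm, hlt b hb hab.ne'⟩ hu
          by_cases hbv : b = v
          · subst hbv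
            exact absurd ⟨a, hab, hlt a ha hab.ne⟩ hu
          simp only [hav, hbv, if_false]
          exact hadj a b (hlt a ha hav) (hlt b hb hbv) hab
      obtain ⟨u, hu, hul⟩ := hu
      have hfree : ∃ pos : W → ℤ, Set.InjOn pos {w | σ w < σ v} ∧
          (∀ a b, σ a < σ v → σ b < σ v → H.Adj a b → pos b = pos a + 1 ∨ pos a = pos b + 1) ∧
          ∀ w, σ w < σ v → H.Adj u w → pos w ≠ pos u + 1 := by
        by_cases hw : ∃ w, σ w < σ v ∧ H.Adj u w ∧ pos w = pos u + 1
        · obtain ⟨w, hw1, hw2, hw3⟩ := hw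
          refine ⟨fun a => - pos a, fun a ha b hb hab => hpos ha hb (neg_injective hab),
            fun a b ha hb hab => ?_, fun x hx1 hx2 hx3 => ?_⟩
          · have := hadj a b ha hb hab
            simp only
            omega
          · simp only at hx3
            rcases hdeg u v w x hu hw2 hx2 with e | e | e
            all_goals
              subst e
              omega
        · refine ⟨pos, hpos, hadj, fun w h1 h2 h3 => hw ⟨w, h1, h2, h3⟩⟩
      obtain ⟨pos, hpos, hadj, hfree⟩ := hfree
      refine ⟨fun w => if w = v then pos u + 1 else if pos w ≤ pos u then pos w else pos w + 1,
        ?_, ?_⟩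
      · intro a ha b hb hab
        by_cases hav : a = v <;> by_cases hbv : b = v <;>
          simp only [hav, hbv, if_true, if_false] at hab ⊢
        · split_ifs at hab <;> omega
        · split_ifs at hab <;> omega
        · refine hpos (hlt a ha hav) (hlt b hb hbv) ?_
          split_ifs at hab <;> omega
      · intro a b ha hb hab
        by_cases hav : a = v
        · subst hav
          have e := hback a b u hab.symm (hlt b hb hab.ne') hu hul
          subst e
          simp [hab.ne']
        by_cases hbv : b = v
        · subst hbv
          have e := hback b a u hab (hlt a ha hab.ne) hu hul
          subst e
          simp [hab.ne]
        simp only [hav, hbv, if_false]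
        have h1 := hadj a b (hlt a ha hav) (hlt b hb hbv) hab
        have h2 : pos a = pos u → pos b ≠ pos u + 1 := by
          intro e
          have e' := hpos (hlt a ha hav) hul e
          subst e'
          exact hfree b (hlt b hb hbv) hab
        have h3 : pos b = pos u → pos a ≠ pos u + 1 := by
          intro e
          have e' := hpos (hlt b hb hbv) hul e
          subst e'
          exact hfree a (hlt a ha hav) hab.symm
        split_ifs <;> omega
  obtain ⟨N, hN⟩ := (Set.finite_range σ).bddAbove
  have hN' : ∀ a, σ a < N + 1 := fun a => Nat.lt_succ_of_le (hN ⟨a, rfl⟩)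
  obtain ⟨pos, hpos, hadj⟩ := hind (N + 1)
  obtain ⟨m, hm⟩ := (Set.finite_range pos).bddBelow
  have hm' : ∀ a, m ≤ pos a := fun a => hm ⟨a, rfl⟩
  refine ⟨fun a => (pos a - m).toNat, fun a b hab => hpos (hN' a) (hN' b) ?_, fun a b hab => ?_⟩
  · have h1 := hm' a
    have h2 := hm' b
    simp only at hab
    omega
  · have h1 := hm' a
    have h2 := hm' b
    have h3 := hadj a b (hN' a) (hN' b) hab
    simp only
    omega

/-- A discrete intermediate value theorem. -/
lemma exists_eq_of_between (f : ℕ → ℕ) (n : ℕ)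
    (hf : ∀ i < n, f i = f (i + 1) ∨ f (i + 1) = f i + 1 ∨ f i = f (i + 1) + 1) (y : ℕ)
    (hy : f 0 ≤ y ∧ y ≤ f n ∨ f n ≤ y ∧ y ≤ f 0) : ∃ i ≤ n, f i = y := by
  induction n with
  | zero => exact ⟨0, le_rfl, by omega⟩
  | succ n ih =>
    by_cases hc : f (n + 1) = y
    · exact ⟨n + 1, le_rfl, hc⟩
    · have := hf n (by omega)
      obtain ⟨i, hi, e⟩ := ih (fun i hi => hf i (by omega)) (by omega)
      exact ⟨i, by omega, e⟩

lemma le_add_of_steps (f : ℕ → ℕ) (n : ℕ)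
    (hf : ∀ i < n, f i = f (i + 1) ∨ f (i + 1) = f i + 1 ∨ f i = f (i + 1) + 1) :
    f 0 ≤ f n + n := by
  induction n with
  | zero => simp
  | succ n ih =>
    have := ih fun i hi => hf i (by omega)
    have := hf n (by omega)
    omega

lemma IsSimpleElimOrder.exists_order_one [Finite W] (h : IsSimpleElimOrder H 1 σ) {k ℓ : ℕ}
    (hk : 0 < k) (hkl : k ≤ ℓ) :
    ∃ τ : W → ℕ, Function.Injective τ ∧
      ∀ v, (lazyReach H τ k ℓ v).ncard ≤ Nat.clog 2 k + 2 * ((ℓ + k - 1) / k) := by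
  obtain ⟨pos, hpos, hadj⟩ := h.exists_path_position
  obtain ⟨τ, hτ, hlex⟩ := exists_lex_order (fun w => rulerRank (Nat.clog 2 k) (pos w)) pos hpos
  refine ⟨τ, hτ, fun v => ?_⟩
  rw [← Set.ncard_image_of_injective _ hpos]
  refine ncard_ruler_le hk hkl (Nat.le_pow_clog (by norm_num) k) (pos v) _ ?_ ?_
  all_goals
    rintro _ ⟨_, ⟨n, hn, p, rfl, rfl, hstep, hmin, -⟩, rfl⟩
    have hf : ∀ i < n, pos (p i) = pos (p (i + 1)) ∨ pos (p (i + 1)) = pos (p i) + 1 ∨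
        pos (p i) = pos (p (i + 1)) + 1 := by
      intro i hi
      rcases hstep i hi with e | e
      · exact Or.inl (by rw [← e])
      · exact Or.inr (hadj _ _ e)
  · have := le_add_of_steps (fun i => pos (p i)) n hf
    omega
  · intro y hy
    obtain ⟨i, hi, rfl⟩ := exists_eq_of_between (fun i => pos (p i)) n hf y (by omega)
    have hin : i < n := by
      refine lt_of_le_of_ne hi ?_
      rintro rfl
      omega
    exact (hlex _ _).1 (hmin i hin)

end Path

lemma IsSimpleElimOrder.exists_order [Finite W] {H : SimpleGraph W} {σ : W → ℕ} {t k ℓ : ℕ}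
    (h : IsSimpleElimOrder H (t + 1) σ) (hk : 0 < k) (hkl : k ≤ ℓ) :
    ∃ τ : W → ℕ, Function.Injective τ ∧ ∀ v, (lazyReach H τ k ℓ v).ncard ≤
      (k + 1) ^ t * (Nat.clog 2 k + 2 * ((ℓ + k - 1) / k)) := by
  induction t generalizing H with
  | zero =>
    simpa using h.exists_order_one hk hkl
  | succ t ih =>
    obtain ⟨τ, hτ, hC⟩ := ih (h.layerGraph (Nat.succ_pos t))
    obtain ⟨ρ, hρ, hlex⟩ := exists_lex_order (elimLayer H σ) τ hτ
    refine ⟨ρ, hρ, fun v => ?_⟩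
    rw [pow_succ', mul_assoc]
    exact ncard_lazyReach_le_succ_mul h.inj h.clique hτ hlex hC v

lemma IsSimpleTTreeOrder.isSimpleElimOrder {H : SimpleGraph W} {t : ℕ} {σ : W → ℕ}
    (ht : 0 < t) (h : IsSimpleTTreeOrder H t σ) : IsSimpleElimOrder H t σ := by
  classical
  obtain ⟨⟨hfin, hinj, -, hv⟩, hsimple⟩ := h
  have hle : ∀ v, (backNbrs H σ v).ncard ≤ t := by
    intro v
    rcases Nat.lt_or_ge t {u : W | σ u < σ v}.ncard with h1 | h1
    · exact ((hv v).2.1 h1).le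
    · exact (Set.ncard_le_ncard (fun u hu => hu.2) (Set.toFinite _)).trans h1
  refine ⟨hinj, fun v => (hv v).2.2, hle, ?_⟩
  intro Q hQ hQc a b c ha hb hc
  by_contra hne
  push Not at hne
  obtain ⟨hab, hac, hbc⟩ := hne
  obtain ⟨y, hy, hmax⟩ := Q.exists_max_image σ (Finset.card_pos.1 (by omega))
  have hnotQ : ∀ x, (∀ q ∈ Q, H.Adj q x) → x ∉ Q := fun x hx hxQ => (hx x hxQ).ne rfl
  have hcmp : ∀ x, (∀ q ∈ Q, H.Adj q x) → σ x < σ y ∨ σ y < σ x := by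
    intro x hx
    exact lt_or_gt_of_ne fun e => (hx y hy).ne (hinj e.symm)
  have hearly : ∀ x z, x ≠ z → (∀ q ∈ Q, H.Adj q x) → (∀ q ∈ Q, H.Adj q z) →
      σ x < σ y → ¬ σ z < σ y := by
    intro x z hxz hx hz hxy hzy
    have hsub : ((insert x (insert z (Q.erase y)) : Finset W) : Set W) ⊆ backNbrs H σ y := by
      intro w hw
      simp only [Finset.coe_insert, Set.mem_insert_iff, Finset.mem_coe, Finset.mem_erase] at hw
      rcases hw with rfl | rfl | ⟨hwy, hw⟩
      · exact ⟨(hx y hy).symm, hxy⟩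
      · exact ⟨(hz y hy).symm, hzy⟩
      · exact ⟨hQc hw hy hwy, lt_of_le_of_ne (hmax w hw) fun e => hwy (hinj e)⟩
    have hcard := Set.ncard_le_ncard hsub (Set.toFinite _)
    rw [Set.ncard_coe_finset, Finset.card_insert_of_notMem, Finset.card_insert_of_notMem,
      Finset.card_erase_of_mem hy, hQ] at hcard
    · have := hle y
      omega
    · simp [hnotQ z hz]
    · simp [hnotQ x hx, hxz]
  have hlate : ∀ x, (∀ q ∈ Q, H.Adj q x) → σ y < σ x → backNbrs H σ x = Q := by
    intro x hx hyx
    have hsub : (Q : Set W) ⊆ backNbrs H σ x :=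
      fun q hq => ⟨hx q hq, lt_of_le_of_lt (hmax q hq) hyx⟩
    refine (Set.eq_of_subset_of_ncard_le hsub ?_ (Set.toFinite _)).symm
    rw [Set.ncard_coe_finset, hQ]
    exact hle x
  have hinit : ∀ x, (∀ q ∈ Q, H.Adj q x) → σ y < σ x → {u : W | σ u < σ x}.ncard ≤ t →
      ∀ z, (∀ q ∈ Q, H.Adj q z) → ¬ σ z < σ x := by
    intro x hx hyx hn z hz hzx
    have : z ∈ backNbrs H σ x := ⟨(hv x).1 hn z hzx, hzx⟩
    rw [hlate x hx hyx] at this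
    exact hnotQ z hz this
  have hboth : ∀ x z, x ≠ z → (∀ q ∈ Q, H.Adj q x) → (∀ q ∈ Q, H.Adj q z) →
      σ y < σ x → σ y < σ z →
      {u : W | σ u < σ x}.ncard ≤ t ∨ {u : W | σ u < σ z}.ncard ≤ t := by
    intro x z hxz hx hz hyx hyz
    by_contra hcon
    push Not at hcon
    exact hsimple x z hxz hcon.1 hcon.2 ((hlate x hx hyx).trans (hlate z hz hyz).symm)
  have hia := hinit a ha
  have hib := hinit b hb
  have hic := hinit c hc
  have nab : σ a ≠ σ b := fun e => hab (hinj e)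
  have nac : σ a ≠ σ c := fun e => hac (hinj e)
  have nbc : σ b ≠ σ c := fun e => hbc (hinj e)
  have eab := hearly a b hab ha hb
  have eac := hearly a c hac ha hc
  have ebc := hearly b c hbc hb hc
  have ia := fun h1 h2 => And.intro (hia h1 h2 b hb) (hia h1 h2 c hc)
  have ib := fun h1 h2 => And.intro (hib h1 h2 a ha) (hib h1 h2 c hc)
  have ic := fun h1 h2 => And.intro (hic h1 h2 a ha) (hic h1 h2 b hb)
  have ca := hcmp a ha
  have cb := hcmp b hb
  have cc := hcmp c hc
  have jab := hboth a b hab ha hb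
  have jac := hboth a c hac ha hc
  have jbc := hboth b c hbc hb hc
  clear hia hib hic hboth hinit hlate hearly hcmp hsimple hv hle
  omega

lemma GReach_image_subset {V : Type} {G : SimpleGraph V} {H : SimpleGraph W} (f : V ↪ W)
    (hf : ∀ u v : V, G.Adj u v → H.Adj (f u) (f v)) (τ : W → ℕ) (k ℓ : ℕ) (v : V) :
    f '' GReach G (τ ∘ f) k ℓ v ⊆ lazyReach H τ k ℓ (f v) := by
  rintro _ ⟨u, ⟨p, -, hlen, hmin, hk⟩, rfl⟩
  refine ⟨p.length, hlen, fun i => f (p.getVert i), by simp, by simp, fun i hi => ?_, hmin, hk⟩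
  exact Or.inr (hf _ _ (p.adj_getVert_succ hi))

/-- Every finite graph of simple treewidth at most `t` satisfies
`gcol_{k,ℓ}(G) ≤ (k+1)^{t-1} · (⌈log₂ k⌉ + 2⌈ℓ/k⌉)` for all positive `k ≤ ℓ`. -/
theorem gcol_le_of_simpleTreewidth {V : Type} [Fintype V] (G : SimpleGraph V)
    (t k ℓ : ℕ) (ht : 0 < t) (hk : 0 < k) (hkl : k ≤ ℓ)
    (hstw : HasSimpleTreewidthLE G t) :
    gcol G k ℓ ≤ (k + 1) ^ (t - 1) * (Nat.clog 2 k + 2 * ((ℓ + k - 1) / k)) := by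
  obtain ⟨W, H, σ, f, hH, hf⟩ := hstw
  have hfin : Finite W := hH.1.1
  obtain ⟨s, rfl⟩ : ∃ s, t = s + 1 := ⟨t - 1, by omega⟩
  obtain ⟨τ, hτ, hC⟩ := (hH.isSimpleElimOrder ht).exists_order hk hkl
  have hle : gcol G k ℓ ≤ gcolOrd G (τ ∘ f) k ℓ :=
    Nat.sInf_le ⟨τ ∘ f, hτ.comp f.injective, rfl⟩
  refine hle.trans ?_
  refine Finset.sup_le fun v _ => ?_
  rw [← Set.ncard_image_of_injective _ f.injective]
  exact (Set.ncard_le_ncard (GReach_image_subset f hf τ k ℓ v) (Set.toFinite _)).trans (hC (f v))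
end

section
/- Every connected finite planar graph contains a neat reduction, i.e. an isometric-path decomposition P_0, P_1, …, P_t such that for every i ≥ 1 the path P_i is adjacent to at least one and at most two of the paths P_j with j < i. -/
/-- A plane embedding of a graph `G`: an injective placement `f` of the vertices in the
plane together with, for each edge, a continuous injective arc joining the images of its
endpoints, such that arcs meet vertex points only at their own endpoints and two distinct
arcs meet only at images of common endpoints. -/
def IsPlaneEmbedding {V : Type} (G : SimpleGraph V) (f : V → ℝ × ℝ)
    (γ : G.edgeSet → Set.Icc (0:ℝ) 1 → ℝ × ℝ) : Prop :=
  Function.Injective f ∧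
  (∀ e : G.edgeSet, Continuous (γ e) ∧ Function.Injective (γ e)) ∧
  (∀ e : G.edgeSet, ∃ u v : V, (e : Sym2 V) = s(u, v) ∧
    γ e ⟨0, by norm_num⟩ = f u ∧ γ e ⟨1, by norm_num⟩ = f v) ∧
  (∀ e : G.edgeSet, ∀ x : V, ∀ t, γ e t = f x → x ∈ (e : Sym2 V)) ∧
  (∀ e e' : G.edgeSet, e ≠ e' → ∀ t t', γ e t = γ e' t' →
    ∃ x : V, x ∈ (e : Sym2 V) ∧ x ∈ (e' : Sym2 V) ∧ γ e t = f x)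

/-- A graph is planar if it admits a plane embedding. -/
def IsPlanar {V : Type} (G : SimpleGraph V) : Prop :=
  ∃ f γ, IsPlaneEmbedding G f γ

section Topology

open unitInterval

/-- The total change along the interval of a continuous logarithm of `f`
(`0` if there is no such logarithm). -/
noncomputable def logVariation (f : I → ℂ) : ℂ :=
  open Classical in
  if h : ∃ g : I → ℂ, Continuous g ∧ ∀ t, Complex.exp (g t) = f t then
    h.choose 1 - h.choose 0 else 0

theorem sub_eq_sub_of_exp_eq {g h : I → ℂ} (hg : Continuous g) (hh : Continuous h)
    (e : ∀ t, Complex.exp (g t) = Complex.exp (h t)) : g 1 - g 0 = h 1 - h 0 := by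
  let h' : I → ℂ := fun t => h t + (g 0 - h 0)
  have e0 : Complex.exp (g 0 - h 0) = 1 := by
    rw [Complex.exp_sub, e 0, div_self (Complex.exp_ne_zero _)]
  have key : g = h' := by
    refine Complex.isCoveringMap_exp.eq_of_comp_eq hg (by fun_prop) ?_ 0 (by simp [h'])
    funext t
    simp [h', Complex.exp_add, e0, e t]
  have := congrFun key 1
  simp only [h'] at this
  rw [this]
  ring

theorem logVariation_eq {f g : I → ℂ} (hg : Continuous g)
    (e : ∀ t, Complex.exp (g t) = f t) : logVariation f = g 1 - g 0 := by
  have h : ∃ g : I → ℂ, Continuous g ∧ ∀ t, Complex.exp (g t) = f t := ⟨g, hg, e⟩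
  rw [logVariation, dif_pos h]
  exact sub_eq_sub_of_exp_eq h.choose_spec.1 hg fun t => by rw [h.choose_spec.2, e]

theorem exists_continuous_log {f : I × I → ℂ} (hf : Continuous f) (h0 : ∀ a, f a ≠ 0) :
    ∃ g : I × I → ℂ, Continuous g ∧ ∀ a, Complex.exp (g a) = f a := by
  let r : ℝ → I := Set.projIcc 0 1 zero_le_one
  have hr : Continuous r := continuous_projIcc
  let F : C(ℝ × ℝ, ℂ) := ⟨fun x => f (r x.1, r x.2), by fun_prop⟩
  obtain ⟨g, ⟨-, hg⟩, -⟩ := Complex.isCoveringMapOn_exp.existsUnique_continuousMap_lifts F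
    (a₀ := 0) (e₀ := Complex.log (F 0)) (Complex.exp_log (h0 _)) (fun a => h0 _)
  refine ⟨fun a => g (a.1, a.2), by fun_prop, fun a => ?_⟩
  have : F (a.1, a.2) = f a := by simp [F, r, Set.projIcc_val]
  rw [← this]
  exact congrFun hg (a.1, a.2)

theorem logVariation_mod {β : I → ℂ} (hβ : Continuous β) {p x y : ℂ} (hp : ∀ t, β t ≠ p)
    (hx : Complex.exp x = β 0 - p) (hy : Complex.exp y = β 1 - p) :
    ∃ n : ℤ, logVariation (fun t => β t - p) = y - x + n * (2 * Real.pi * Complex.I) := by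
  obtain ⟨g, hg, e⟩ := exists_continuous_log (f := fun a => β a.2 - p) (by fun_prop)
    fun a => sub_ne_zero.2 (hp _)
  rw [logVariation_eq (g := fun t => g (0, t)) (by fun_prop) fun t => e (0, t)]
  obtain ⟨m, hm⟩ := Complex.exp_eq_exp_iff_exists_int.1 ((e (0, 0)).trans hx.symm)
  obtain ⟨n, hn⟩ := Complex.exp_eq_exp_iff_exists_int.1 ((e (0, 1)).trans hy.symm)
  refine ⟨n - m, ?_⟩
  rw [hm, hn]
  push_cast
  ring

theorem logVariation_square {α β : I → ℂ} (hα : Continuous α) (hβ : Continuous β)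
    (h : ∀ s t, α s ≠ β t) :
    logVariation (fun t => β t - α 0) + logVariation (fun s => α s - β 1) =
      logVariation (fun t => β t - α 1) + logVariation (fun s => α s - β 0) := by
  obtain ⟨g, hg, e⟩ := exists_continuous_log (f := fun a => β a.2 - α a.1) (by fun_prop)
    fun a => sub_ne_zero.2 (h _ _).symm
  have e' : ∀ s t, Complex.exp (g (s, t) + Real.pi * Complex.I) = α s - β t := fun s t => by
    rw [Complex.exp_add, e, Complex.exp_pi_mul_I]
    ring
  rw [logVariation_eq (g := fun t => g (0, t)) (by fun_prop) fun t => e (0, t),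
    logVariation_eq (g := fun t => g (1, t)) (by fun_prop) fun t => e (1, t),
    logVariation_eq (g := fun s => g (s, 1) + Real.pi * Complex.I) (by fun_prop) fun s => e' s 1,
    logVariation_eq (g := fun s => g (s, 0) + Real.pi * Complex.I) (by fun_prop) fun s => e' s 0]
  ring

/-- Two disjoint curves joining points `p a, p b` and `p c, p d` of a plane point set indexed by a
linear order: whether the pairs `a, b` and `c, d` interleave is determined modulo `2` by integers
attached to pairs consisting of a point and a curve avoiding it. -/
theorem exists_crossing_numbers {ι : Type*} [LinearOrder ι] (p : ι → ℂ) :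
    ∃ n : ι → ∀ c d, Path (p c) (p d) → ℤ, ∀ a b c d (γ : Path (p a) (p b)) (δ : Path (p c) (p d)),
      (∀ s t, γ s ≠ δ t) →
      (if a < d then 1 else -1) - (if a < c then 1 else -1) - (if b < d then 1 else -1) +
        (if b < c then 1 else -1) = 2 * (n a c d δ + n d a b γ - n b c d δ - n c a b γ) := by
  let ℓ : ι → ι → ℂ := fun i j =>
    if i < j then Complex.log (p j - p i) else Complex.log (p i - p j) + Real.pi * Complex.I
  have hℓ : ∀ i j, p i ≠ p j → Complex.exp (ℓ i j) = p j - p i := fun i j hij => by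
    by_cases h : i < j
    · simp [ℓ, h, Complex.exp_log (sub_ne_zero.2 hij.symm)]
    · simp [ℓ, h, Complex.exp_add, Complex.exp_log (sub_ne_zero.2 hij)]
  have hsymm : ∀ i j, p i ≠ p j →
      ℓ j i - ℓ i j = ((if i < j then 1 else -1 : ℤ) : ℂ) * (Real.pi * Complex.I) := by
    intro i j hij
    rcases lt_trichotomy i j with h | rfl | h
    · simp [ℓ, h, h.not_gt]
    · exact absurd rfl hij
    · simp [ℓ, h, h.not_gt]
  have hn : ∀ v c d (γ : Path (p c) (p d)), ∃ n : ℤ, (∀ t, γ t ≠ p v) →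
      logVariation (fun t => γ t - p v) = ℓ v d - ℓ v c + n * (2 * Real.pi * Complex.I) := by
    intro v c d γ
    by_cases h : ∀ t, γ t ≠ p v
    · obtain ⟨n, hn⟩ := logVariation_mod γ.continuous h
        (x := ℓ v c) (y := ℓ v d) (by simpa using hℓ v c (by simpa using (h 0).symm))
        (by simpa using hℓ v d (by simpa using (h 1).symm))
      exact ⟨n, fun _ => hn⟩
    · exact ⟨0, fun h' => absurd h' h⟩
  choose n hn using hn
  refine ⟨n, fun a b c d γ δ h => ?_⟩
  have sq := logVariation_square γ.continuous δ.continuous h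
  have hac : p a ≠ p c := by simpa using h 0 0
  have had : p a ≠ p d := by simpa using h 0 1
  have hbc : p b ≠ p c := by simpa using h 1 0
  have hbd : p b ≠ p d := by simpa using h 1 1
  simp only [Path.source, Path.target] at sq
  rw [hn a c d δ fun t => by simpa using (h 0 t).symm,
    hn b c d δ fun t => by simpa using (h 1 t).symm,
    hn c a b γ fun s => by simpa using h s 0, hn d a b γ fun s => by simpa using h s 1] at sq
  have h1 := hsymm a c hac
  have h2 := hsymm a d had
  have h3 := hsymm b c hbc
  have h4 := hsymm b d hbd
  have hpi : (Real.pi * Complex.I : ℂ) ≠ 0 := by simp [Real.pi_ne_zero]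
  rw [← Int.cast_inj (α := ℂ)]
  refine mul_right_cancel₀ hpi ?_
  push_cast at h1 h2 h3 h4 ⊢
  linear_combination -sq + h1 - h2 - h3 + h4

/-- `K₅` cannot be drawn in the plane so that curves of non-adjacent edges are disjoint. The
vertices are `x`, `y` and the three points `t i`; the edge opposite to `t i` in the triangle of the
`t i` is drawn in `D i`. -/
theorem not_joinedIn_K5 {x y : ℂ} {t : Fin 3 → ℂ} {E : Set ℂ} {A B D : Fin 3 → Set ℂ}
    (hE : JoinedIn E x y) (hA : ∀ i, JoinedIn (A i) x (t i)) (hB : ∀ i, JoinedIn (B i) y (t i))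
    (hD : ∀ i j k, i ≠ j → i ≠ k → j ≠ k → JoinedIn (D i) (t j) (t k))
    (hED : ∀ i, Disjoint E (D i)) (hAB : ∀ i j, i ≠ j → Disjoint (A i) (B j))
    (hAD : ∀ i, Disjoint (A i) (D i)) (hBD : ∀ i, Disjoint (B i) (D i)) : False := by
  obtain ⟨e, he⟩ := hE
  choose a ha using hA
  choose b hb using hB
  obtain ⟨d₀, hd₀⟩ := hD 0 1 2 (by decide) (by decide) (by decide)
  obtain ⟨d₁, hd₁⟩ := hD 1 0 2 (by decide) (by decide) (by decide)
  obtain ⟨d₂, hd₂⟩ := hD 2 0 1 (by decide) (by decide) (by decide)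
  obtain ⟨n, hn⟩ := exists_crossing_numbers ![x, y, t 0, t 1, t 2]
  have e₀ := hn 0 1 3 4 e d₀ fun u v => (hED 0).ne_of_mem (he u) (hd₀ v)
  have e₁ := hn 0 1 2 4 e d₁ fun u v => (hED 1).ne_of_mem (he u) (hd₁ v)
  have e₂ := hn 0 1 2 3 e d₂ fun u v => (hED 2).ne_of_mem (he u) (hd₂ v)
  have a₀ := hn 0 2 3 4 (a 0) d₀ fun u v => (hAD 0).ne_of_mem (ha 0 u) (hd₀ v)
  have a₁ := hn 0 3 2 4 (a 1) d₁ fun u v => (hAD 1).ne_of_mem (ha 1 u) (hd₁ v)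
  have a₂ := hn 0 4 2 3 (a 2) d₂ fun u v => (hAD 2).ne_of_mem (ha 2 u) (hd₂ v)
  have b₀ := hn 1 2 3 4 (b 0) d₀ fun u v => (hBD 0).ne_of_mem (hb 0 u) (hd₀ v)
  have b₁ := hn 1 3 2 4 (b 1) d₁ fun u v => (hBD 1).ne_of_mem (hb 1 u) (hd₁ v)
  have b₂ := hn 1 4 2 3 (b 2) d₂ fun u v => (hBD 2).ne_of_mem (hb 2 u) (hd₂ v)
  have hab : ∀ i j, i ≠ j → ∀ u v, a i u ≠ b j v := fun i j hij u v =>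
    (hAB i j hij).ne_of_mem (ha i u) (hb j v)
  have c₀₁ := hn 0 2 1 3 (a 0) (b 1) (hab 0 1 (by decide))
  have c₀₂ := hn 0 2 1 4 (a 0) (b 2) (hab 0 2 (by decide))
  have c₁₀ := hn 0 3 1 2 (a 1) (b 0) (hab 1 0 (by decide))
  have c₁₂ := hn 0 3 1 4 (a 1) (b 2) (hab 1 2 (by decide))
  have c₂₀ := hn 0 4 1 2 (a 2) (b 0) (hab 2 0 (by decide))
  have c₂₁ := hn 0 4 1 3 (a 2) (b 1) (hab 2 1 (by decide))
  simp only [Fin.reduceLT, if_true, if_false]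
    at e₀ e₁ e₂ a₀ a₁ a₂ b₀ b₁ b₂ c₀₁ c₀₂ c₁₀ c₁₂ c₂₀ c₂₁
  omega

/-- `K₃,₃` cannot be drawn in the plane so that curves of non-adjacent edges are disjoint. -/
theorem not_joinedIn_K33 {x y : Fin 3 → ℂ} {S : Fin 3 → Fin 3 → Set ℂ}
    (hS : ∀ i j, JoinedIn (S i j) (x i) (y j))
    (hd : ∀ i i' j j', i < i' → j ≠ j' → Disjoint (S i j) (S i' j')) : False := by
  choose γ hγ using hS
  obtain ⟨n, hn⟩ := exists_crossing_numbers ![x 0, x 1, x 2, y 0, y 1, y 2]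
  have hne : ∀ i i' j j', i < i' → j ≠ j' → ∀ u v, γ i j u ≠ γ i' j' v :=
    fun i i' j j' hi hj u v => (hd i i' j j' hi hj).ne_of_mem (hγ i j u) (hγ i' j' v)
  have h₁ := hn 0 3 1 4 (γ 0 0) (γ 1 1) (hne 0 1 0 1 (by decide) (by decide))
  have h₂ := hn 0 3 1 5 (γ 0 0) (γ 1 2) (hne 0 1 0 2 (by decide) (by decide))
  have h₃ := hn 0 4 1 3 (γ 0 1) (γ 1 0) (hne 0 1 1 0 (by decide) (by decide))
  have h₄ := hn 0 4 1 5 (γ 0 1) (γ 1 2) (hne 0 1 1 2 (by decide) (by decide))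
  have h₅ := hn 0 5 1 3 (γ 0 2) (γ 1 0) (hne 0 1 2 0 (by decide) (by decide))
  have h₆ := hn 0 5 1 4 (γ 0 2) (γ 1 1) (hne 0 1 2 1 (by decide) (by decide))
  have k₁ := hn 0 3 2 4 (γ 0 0) (γ 2 1) (hne 0 2 0 1 (by decide) (by decide))
  have k₂ := hn 0 3 2 5 (γ 0 0) (γ 2 2) (hne 0 2 0 2 (by decide) (by decide))
  have k₃ := hn 0 4 2 3 (γ 0 1) (γ 2 0) (hne 0 2 1 0 (by decide) (by decide))
  have k₄ := hn 0 4 2 5 (γ 0 1) (γ 2 2) (hne 0 2 1 2 (by decide) (by decide))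
  have k₅ := hn 0 5 2 3 (γ 0 2) (γ 2 0) (hne 0 2 2 0 (by decide) (by decide))
  have k₆ := hn 0 5 2 4 (γ 0 2) (γ 2 1) (hne 0 2 2 1 (by decide) (by decide))
  have l₁ := hn 1 3 2 4 (γ 1 0) (γ 2 1) (hne 1 2 0 1 (by decide) (by decide))
  have l₂ := hn 1 3 2 5 (γ 1 0) (γ 2 2) (hne 1 2 0 2 (by decide) (by decide))
  have l₃ := hn 1 4 2 3 (γ 1 1) (γ 2 0) (hne 1 2 1 0 (by decide) (by decide))
  have l₄ := hn 1 4 2 5 (γ 1 1) (γ 2 2) (hne 1 2 1 2 (by decide) (by decide))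
  have l₅ := hn 1 5 2 3 (γ 1 2) (γ 2 0) (hne 1 2 2 0 (by decide) (by decide))
  have l₆ := hn 1 5 2 4 (γ 1 2) (γ 2 1) (hne 1 2 2 1 (by decide) (by decide))
  simp only [Fin.reduceLT, if_true, if_false]
    at h₁ h₂ h₃ h₄ h₅ h₆ k₁ k₂ k₃ k₄ k₅ k₆ l₁ l₂ l₃ l₄ l₅ l₆
  omega

end Topology

namespace SimpleGraph

variable {V : Type} {G : SimpleGraph V}

/-- `u` and `v` are joined by a walk of `G` with all vertices in `S`. -/
def ConnIn (G : SimpleGraph V) (S : Set V) (u v : V) : Prop :=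
  ∃ w : G.Walk u v, ∀ x ∈ w.support, x ∈ S

/-- Any two vertices of `S` are joined by a walk inside `S`. -/
def ConnSet (G : SimpleGraph V) (S : Set V) : Prop :=
  ∀ u ∈ S, ∀ v ∈ S, G.ConnIn S u v

namespace ConnIn

variable {S S' : Set V} {u v w : V}

theorem refl (hu : u ∈ S) : G.ConnIn S u u := ⟨.nil, by simpa using hu⟩

theorem symm (h : G.ConnIn S u v) : G.ConnIn S v u := by
  obtain ⟨w, hw⟩ := h
  exact ⟨w.reverse, by simpa using hw⟩

theorem trans (h : G.ConnIn S u v) (h' : G.ConnIn S v w) : G.ConnIn S u w := by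
  obtain ⟨p, hp⟩ := h
  obtain ⟨q, hq⟩ := h'
  exact ⟨p.append q, fun x hx => ((Walk.mem_support_append_iff p q).1 hx).elim (hp x) (hq x)⟩

theorem mono (h : G.ConnIn S u v) (hS : S ⊆ S') : G.ConnIn S' u v :=
  h.imp fun _ hw x hx => hS (hw x hx)

theorem left_mem (h : G.ConnIn S u v) : u ∈ S := by
  obtain ⟨w, hw⟩ := h
  exact hw _ w.start_mem_support

theorem right_mem (h : G.ConnIn S u v) : v ∈ S := h.symm.left_mem

theorem of_adj (h : G.Adj u v) (hu : u ∈ S) (hv : v ∈ S) : G.ConnIn S u v :=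
  ⟨h.toWalk, by simp [hu, hv]⟩

theorem of_mem_support {p : G.Walk u v} (hp : ∀ x ∈ p.support, x ∈ S) {x : V}
    (hx : x ∈ p.support) : G.ConnIn S u x := by
  classical
  exact ⟨p.takeUntil x hx, fun y hy => hp y (p.support_takeUntil_subset_support hx hy)⟩

end ConnIn

theorem ConnSet.of_center {S : Set V} {c : V} (h : ∀ u ∈ S, G.ConnIn S u c) : G.ConnSet S :=
  fun u hu v hv => (h u hu).trans (h v hv).symm

theorem connSet_support {u v : V} (p : G.Walk u v) : G.ConnSet {x | x ∈ p.support} :=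
  .of_center (c := u) fun _ hx => (ConnIn.of_mem_support (fun _ h => h) hx).symm

theorem ConnSet.union {S S' : Set V} (h : G.ConnSet S) (h' : G.ConnSet S') {u v : V} (hu : u ∈ S)
    (hv : v ∈ S') (huv : G.Adj u v) : G.ConnSet (S ∪ S') := by
  refine .of_center (c := u) fun x hx => ?_
  rcases hx with hx | hx
  · exact (h x hx u hu).mono Set.subset_union_left
  · exact ((h' x hx v hv).mono Set.subset_union_right).trans (.of_adj huv.symm (.inr hv) (.inl hu))

theorem ConnSet.insert {S : Set V} (h : G.ConnSet S) {u v : V} (hu : u ∈ S)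
    (huv : G.Adj u v) : G.ConnSet (S ∪ {v}) :=
  h.union (fun x hx y hy => by rw [hx, hy]; exact .refl rfl) hu rfl huv

/-- A plane graph assigns to each vertex set a plane set, disjoint sets to disjoint sets, such that
connections inside the vertex set yield curves inside the plane set. -/
theorem _root_.IsPlanar.exists_drawing (h : IsPlanar G) : ∃ (p : V → ℂ) (D : Set V → Set ℂ),
    (∀ S u v, G.ConnIn S u v → JoinedIn (D S) (p u) (p v)) ∧
    ∀ S S', Disjoint S S' → Disjoint (D S) (D S') := by
  obtain ⟨f, γ, hf, hγ, hend, hvert, hcross⟩ := h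
  let φ := Complex.equivRealProdCLM.symm
  let D : Set V → Set (ℝ × ℝ) := fun S =>
    f '' S ∪ {z | ∃ e : G.edgeSet, (∀ v ∈ (e : Sym2 V), v ∈ S) ∧ z ∈ Set.range (γ e)}
  refine ⟨fun v => φ (f v), fun S => φ '' D S, ?_, ?_⟩
  · rintro S u v ⟨w, hw⟩
    refine JoinedIn.map ?_ φ.continuous
    induction w with
    | nil => exact .refl (.inl ⟨_, hw _ (by simp), rfl⟩)
    | @cons a b c hab w ih =>
      refine JoinedIn.trans ?_ (ih fun x hx => hw x (by simp [hx]))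
      have ha : a ∈ S := hw a (by simp)
      have hb : b ∈ S := hw b (by simp)
      let e : G.edgeSet := ⟨s(a, b), hab⟩
      have he : ∀ t, γ e t ∈ D S := fun t => .inr ⟨e, by simp [e, ha, hb], t, rfl⟩
      obtain ⟨x, y, hxy, h0, h1⟩ := hend e
      have hj : JoinedIn (D S) (f x) (f y) := ⟨⟨⟨γ e, (hγ e).1⟩, h0, h1⟩, he⟩
      rcases Sym2.eq_iff.1 hxy with ⟨rfl, rfl⟩ | ⟨rfl, rfl⟩
      · exact hj
      · exact hj.symm
  · intro S S' hS
    refine (Set.disjoint_image_iff φ.injective).2 (Set.disjoint_left.2 ?_)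
    have hS' := Set.disjoint_left.1 hS
    rintro z (⟨x, hx, rfl⟩ | ⟨e, he, t, rfl⟩) (⟨y, hy, hxy⟩ | ⟨e', he', t', ht'⟩)
    · exact hS' hx (hf hxy ▸ hy)
    · exact hS' hx (he' _ (hvert _ _ _ ht'))
    · exact hS' (he _ (hvert _ _ _ hxy.symm)) hy
    · by_cases hee : e = e'
      · subst hee
        obtain ⟨x, y, hxy, -⟩ := hend e
        have hx : x ∈ (e : Sym2 V) := by simp [hxy]
        exact hS' (he x hx) (he' x hx)
      · obtain ⟨x, hx, hx', -⟩ := hcross e e' hee t t' ht'.symm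
        exact hS' (he x hx) (he' x hx')

/-- The vertices of `C` with a neighbour in `Q`. -/
def contacts (G : SimpleGraph V) (C Q : Set V) : Set V := {t ∈ C | ∃ q ∈ Q, G.Adj q t}

/-- A connected vertex set `C` of a planar graph, a connected set `U` disjoint from it, and two
disjoint connected subsets `Q₁`, `Q₂` of `U`. -/
structure Frame (G : SimpleGraph V) (U C Q₁ Q₂ : Set V) : Prop where
  planar : IsPlanar G
  connU : G.ConnSet U
  connC : G.ConnSet C
  connQ₁ : G.ConnSet Q₁
  connQ₂ : G.ConnSet Q₂
  subset₁ : Q₁ ⊆ U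
  subset₂ : Q₂ ⊆ U
  disjQ : Disjoint Q₁ Q₂
  disjU : Disjoint U C

/-- `A` is one part of a partition of `C` into two connected sets both of which contain vertices of
`T` and of `B`. -/
structure IsSplit (G : SimpleGraph V) (C T B A : Set V) : Prop where
  subset : A ⊆ C
  conn : G.ConnSet A
  conn_diff : G.ConnSet (C \ A)
  top : ∃ t ∈ T, t ∈ A
  top_diff : ∃ t ∈ T, t ∉ A
  bot : ∃ b ∈ B, b ∈ A
  bot_diff : ∃ b ∈ B, b ∉ A

/-- Some vertex of `T` lies in both `M` and `N` and some in neither. -/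
def Parallel (T M N : Set V) : Prop := (∃ t ∈ T, t ∈ M ∧ t ∈ N) ∧ ∃ t ∈ T, t ∉ M ∧ t ∉ N

/-- Some vertex of `T` lies in `M` only and some in `N` only. -/
def Opposed (T M N : Set V) : Prop := (∃ t ∈ T, t ∈ M ∧ t ∉ N) ∧ ∃ t ∈ T, t ∉ M ∧ t ∈ N

theorem Opposed.symm {T M N : Set V} (h : Opposed T M N) : Opposed T N M := by
  obtain ⟨⟨a, ha, ha', ha''⟩, b, hb, hb', hb''⟩ := h
  exact ⟨⟨b, hb, hb'', hb'⟩, a, ha, ha'', ha'⟩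

theorem parallel_diff {C T M N : Set V} (hT : T ⊆ C) :
    Parallel T M (C \ N) ↔ Opposed T M N := by
  have := fun t (ht : t ∈ T) => hT ht
  simp only [Parallel, Opposed, Set.mem_sdiff]
  grind

theorem opposed_diff {C T M N : Set V} (hT : T ⊆ C) :
    Opposed T M (C \ N) ↔ Parallel T M N := by
  have := fun t (ht : t ∈ T) => hT ht
  simp only [Parallel, Opposed, Set.mem_sdiff]
  grind

theorem contacts_subset (C Q : Set V) : G.contacts C Q ⊆ C := fun _ h => h.1

namespace IsSplit

variable {C T B A M N : Set V}

theorem compl (h : G.IsSplit C T B A) (hT : T ⊆ C) (hB : B ⊆ C) : G.IsSplit C T B (C \ A) where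
  subset := Set.sdiff_subset
  conn := h.conn_diff
  conn_diff := by simpa [Set.inter_eq_right.2 h.subset] using h.conn
  top := h.top_diff.imp fun _ ht => ⟨ht.1, hT ht.1, ht.2⟩
  top_diff := h.top.imp fun _ ht => ⟨ht.1, fun h' => h'.2 ht.2⟩
  bot := h.bot_diff.imp fun _ ht => ⟨ht.1, hB ht.1, ht.2⟩
  bot_diff := h.bot.imp fun _ ht => ⟨ht.1, fun h' => h'.2 ht.2⟩

theorem parallel_or_opposed_top (hM : G.IsSplit C T B M) (hN : G.IsSplit C T B N) :
    Parallel T M N ∨ Opposed T M N := by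
  have h1 := hM.top; have h2 := hM.top_diff; have h3 := hN.top; have h4 := hN.top_diff
  unfold Parallel Opposed
  grind

theorem parallel_or_opposed_bot (hM : G.IsSplit C T B M) (hN : G.IsSplit C T B N) :
    Parallel B M N ∨ Opposed B M N := by
  have h1 := hM.bot; have h2 := hM.bot_diff; have h3 := hN.bot; have h4 := hN.bot_diff
  unfold Parallel Opposed
  grind

end IsSplit

namespace Frame

variable {U C Q₁ Q₂ M N : Set V}

local notation "Tops" => contacts G C Q₁
local notation "Bots" => contacts G C Q₂
local notation "Split" => IsSplit G C Tops Bots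

theorem not_parallel_opposed (F : G.Frame U C Q₁ Q₂) (hM : Split M) (hN : Split N)
    (hT : Parallel Tops M N) (hB : Opposed Bots M N) : False := by
  obtain ⟨⟨t₀, ht₀, t₀M, t₀N⟩, t₁, ht₁, t₁M, t₁N⟩ := hT
  obtain ⟨⟨b₀, hb₀, b₀M, b₀N⟩, b₁, hb₁, b₁M, b₁N⟩ := hB
  obtain ⟨p, D, hD, hdisj⟩ := F.planar.exists_drawing
  obtain ⟨q₁, hq₁, hqt₀⟩ := ht₀.2
  obtain ⟨q₁', hq₁', hqt₁⟩ := ht₁.2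
  obtain ⟨q₂, hq₂, hqb₀⟩ := hb₀.2
  obtain ⟨q₂', hq₂', hqb₁⟩ := hb₁.2
  have hU := Set.disjoint_left.1 F.disjU
  have hQ := Set.disjoint_left.1 F.disjQ
  have s₁ := fun {x} => @F.subset₁ x
  have s₂ := fun {x} => @F.subset₂ x
  have sM := fun {x} => @hM.subset x
  have sN := fun {x} => @hN.subset x
  let S : Fin 3 → Fin 3 → Set V :=
    ![![M, N, Q₁ ∪ {t₀}], ![C \ N, C \ M, Q₁ ∪ {t₁}], ![Q₂ ∪ {b₀}, Q₂ ∪ {b₁}, U]]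
  refine not_joinedIn_K33 (x := ![p t₀, p t₁, p q₂]) (y := ![p b₀, p b₁, p q₁])
    (S := fun i j => D (S i j)) ?_ ?_
  · have e₀ : G.ConnIn (Q₁ ∪ {t₀}) t₀ q₁ :=
      F.connQ₁.insert hq₁ hqt₀ _ (by simp) _ (by simp [hq₁])
    have e₁ : G.ConnIn (Q₁ ∪ {t₁}) t₁ q₁ :=
      F.connQ₁.insert hq₁' hqt₁ _ (by simp) _ (by simp [hq₁])
    have e₂ : G.ConnIn (Q₂ ∪ {b₀}) q₂ b₀ :=
      F.connQ₂.insert hq₂ hqb₀ _ (by simp [hq₂]) _ (by simp)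
    have e₃ : G.ConnIn (Q₂ ∪ {b₁}) q₂ b₁ :=
      F.connQ₂.insert hq₂' hqb₁ _ (by simp [hq₂]) _ (by simp)
    intro i j
    fin_cases i <;> fin_cases j
    · exact hD _ _ _ (hM.conn _ t₀M _ b₀M)
    · exact hD _ _ _ (hN.conn _ t₀N _ b₁N)
    · exact hD _ _ _ e₀
    · exact hD _ _ _ (hN.conn_diff _ ⟨ht₁.1, t₁N⟩ _ ⟨hb₀.1, b₀N⟩)
    · exact hD _ _ _ (hM.conn_diff _ ⟨ht₁.1, t₁M⟩ _ ⟨hb₁.1, b₁M⟩)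
    · exact hD _ _ _ e₁
    · exact hD _ _ _ e₂
    · exact hD _ _ _ e₃
    · exact hD _ _ _ (F.connU _ (s₂ hq₂) _ (s₁ hq₁))
  · have := ht₀.1; have := ht₁.1; have := hb₀.1; have := hb₁.1
    intro i i' j j' hi hj
    refine hdisj _ _ (Set.disjoint_left.2 fun x hx hx' => ?_)
    fin_cases i <;> fin_cases i' <;> first | exact absurd hi (by decide) | skip
    all_goals
      fin_cases j <;> fin_cases j' <;> first | exact absurd rfl hj | skip
    all_goals
      simp [S] at hx hx'
      grind

theorem opposed_bot (F : G.Frame U C Q₁ Q₂) (hM : Split M) (hN : Split N)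
    (hT : Opposed Tops M N) : Opposed Bots M N := by
  refine (hM.parallel_or_opposed_bot hN).resolve_left fun hB => ?_
  exact F.not_parallel_opposed hM (hN.compl (contacts_subset _ _) (contacts_subset _ _))
    ((parallel_diff (contacts_subset _ _)).2 hT) ((opposed_diff (contacts_subset _ _)).2 hB)

theorem opposed_top (F : G.Frame U C Q₁ Q₂) (hM : Split M) (hN : Split N)
    (hB : Opposed Bots M N) : Opposed Tops M N :=
  (hM.parallel_or_opposed_top hN).resolve_left fun hT => F.not_parallel_opposed hM hN hT hB

theorem not_parallel (F : G.Frame U C Q₁ Q₂) (hM : Split M) (hN : Split N)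
    (hT : Opposed Tops M N) : ¬ Parallel Tops M N := fun h =>
  F.not_parallel_opposed hM hN h (F.opposed_bot hM hN hT)

theorem not_private_tops (F : G.Frame U C Q₁ Q₂) {a : Fin 3 → Set V} (ha : ∀ i, Split (a i))
    {t : Fin 3 → V} (ht : ∀ i, t i ∈ Tops) (hta : ∀ i, t i ∈ a i)
    (hta' : ∀ i j, i ≠ j → t i ∉ a j) : False := by
  obtain ⟨p, D, hD, hdisj⟩ := F.planar.exists_drawing
  choose htC q hq hqt using ht
  choose b hb hba using fun i => (ha i).bot
  choose hbC r hr hrb using hb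
  have hU := Set.disjoint_left.1 F.disjU
  have hQ := Set.disjoint_left.1 F.disjQ
  refine not_joinedIn_K5 (x := p (q 0)) (y := p (r 0)) (t := fun i => p (t i)) (E := D U)
    (A := fun i => D (Q₁ ∪ {t i})) (B := fun i => D (Q₂ ∪ a i)) (D := fun i => D (C \ a i))
    ?_ ?_ ?_ ?_ ?_ ?_ ?_ ?_
  · exact hD _ _ _ (F.connU _ (F.subset₁ (hq 0)) _ (F.subset₂ (hr 0)))
  · exact fun i => hD _ _ _ (F.connQ₁.insert (hq i) (hqt i) _ (.inl (hq 0)) _ (.inr rfl))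
  · exact fun i => hD _ _ _
      (F.connQ₂.union (ha i).conn (hr i) (hba i) (hrb i) _ (.inl (hr 0)) _ (.inr (hta i)))
  · exact fun i j k hij hik _ => hD _ _ _
      ((ha i).conn_diff _ ⟨htC j, hta' j i hij.symm⟩ _ ⟨htC k, hta' k i hik.symm⟩)
  · exact fun i => hdisj _ _ (F.disjU.mono_right Set.sdiff_subset)
  · refine fun i j hij => hdisj _ _ (Set.disjoint_left.2 ?_)
    rintro x (hx | rfl) (hx' | hx')
    · exact hQ hx hx'
    · exact hU (F.subset₁ hx) ((ha j).subset hx')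
    · exact hU (F.subset₂ hx') (htC i)
    · exact hta' i j hij hx'
  · refine fun i => hdisj _ _ (Set.disjoint_left.2 ?_)
    rintro x (hx | rfl) hx'
    · exact hU (F.subset₁ hx) hx'.1
    · exact hx'.2 (hta i)
  · refine fun i => hdisj _ _ (Set.disjoint_left.2 ?_)
    rintro x (hx | hx) hx'
    · exact hU (F.subset₂ hx) hx'.1
    · exact hx'.2 hx

theorem not_private_tops' (F : G.Frame U C Q₁ Q₂) {a b c : Set V} (ha : Split a) (hb : Split b)
    (hc : Split c) (hab : ∀ t ∈ Tops, t ∈ a → t ∉ b) (hac : ∀ t ∈ Tops, t ∈ a → t ∉ c)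
    (hbc : ∀ t ∈ Tops, t ∈ b → t ∉ c) : False := by
  obtain ⟨x, hx, hxa⟩ := ha.top
  obtain ⟨y, hy, hyb⟩ := hb.top
  obtain ⟨z, hz, hzc⟩ := hc.top
  have h1 := hab x hx hxa; have h2 := hac x hx hxa; have h3 := hbc y hy hyb
  have h4 : y ∉ a := fun h => hab y hy h hyb
  have h5 : z ∉ a := fun h => hac z hz h hzc
  have h6 : z ∉ b := fun h => hbc z hz h hzc
  refine F.not_private_tops (a := ![a, b, c]) (t := ![x, y, z]) ?_ ?_ ?_ ?_
  · simp [Fin.forall_fin_succ, ha, hb, hc]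
  · simp [Fin.forall_fin_succ, hx, hy, hz]
  · simp [Fin.forall_fin_succ, hxa, hyb, hzc]
  · simp [Fin.forall_fin_succ, *]

theorem not_opposed_triple (F : G.Frame U C Q₁ Q₂) {a b c : Set V} (ha : Split a) (hb : Split b)
    (hc : Split c) (hab : Opposed Tops a b) (hac : Opposed Tops a c)
    (hbc : Opposed Tops b c) : False := by
  have h1 := F.not_parallel ha hb hab
  have h2 := F.not_parallel ha hc hac
  have h3 := F.not_parallel hb hc hbc
  have hT : ∀ t ∈ Tops, t ∈ C := contacts_subset C Q₁
  have d := F.not_private_tops' ha hb hc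
  have d' := F.not_private_tops' (ha.compl (contacts_subset _ _) (contacts_subset _ _))
    (hb.compl (contacts_subset _ _) (contacts_subset _ _))
    (hc.compl (contacts_subset _ _) (contacts_subset _ _))
  have ta := ha.top; have tb := hb.top; have tc := hc.top
  have ta' := ha.top_diff; have tb' := hb.top_diff; have tc' := hc.top_diff
  simp only [Parallel, Set.mem_sdiff] at h1 h2 h3 d'
  clear hab hac hbc F
  by_cases k1 : ∃ t ∈ Tops, t ∈ a ∧ t ∈ b <;> by_cases k2 : ∃ t ∈ Tops, t ∈ a ∧ t ∈ c <;>
    by_cases k3 : ∃ t ∈ Tops, t ∈ b ∧ t ∈ c <;> grind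

/-- Splits that agree in orientation with a common split agree with each other. -/
theorem not_opposed_of_parallel (F : G.Frame U C Q₁ Q₂) {A : Set V} (hA : Split A) (hM : Split M)
    (hN : Split N) (hMA : Parallel Tops M A) (hNA : Parallel Tops N A) : ¬ Opposed Tops M N :=
  fun h => F.not_opposed_triple hM hN (hA.compl (contacts_subset _ _) (contacts_subset _ _)) h
    ((opposed_diff (contacts_subset _ _)).2 hMA) ((opposed_diff (contacts_subset _ _)).2 hNA)

theorem exists_isSplit (F : G.Frame U C Q₁ Q₂) {u w u' w' : V} (hu : u ∈ Tops) (hw : w ∈ Bots)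
    (hu' : u' ∈ Tops) (hw' : w' ∈ Bots) {p : G.Walk u w} {p' : G.Walk u' w'}
    (hp : ∀ x ∈ p.support, x ∈ C) (hp' : ∀ x ∈ p'.support, x ∈ C)
    (hd : ∀ x ∈ p.support, x ∉ p'.support) : ∃ A, Split A ∧ u ∈ A ∧ w ∈ A := by
  let R : Set V := C \ {x | x ∈ p'.support}
  let A : Set V := {x | G.ConnIn R u x}
  have hAR : A ⊆ R := fun x hx => hx.right_mem
  have huA : u ∈ A := .refl ⟨hu.1, hd u p.start_mem_support⟩
  have hwA : w ∈ A := ⟨p, fun x hx => ⟨hp x hx, hd x hx⟩⟩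
  have hp'A : ∀ x ∈ p'.support, x ∉ A := fun x hx hxA => (hAR hxA).2 hx
  have hconn : ∀ {x y : V} (q : G.Walk x y), (∀ z ∈ q.support, z ∈ C) → y = u' → x ∉ A →
      G.ConnIn (C \ A) x u' := by
    intro x y q
    induction q with
    | nil => rintro hq rfl hx; exact .refl ⟨hq _ (by simp), hx⟩
    | @cons x z y hxz q ih =>
      intro hq hy hx
      have hxC : x ∈ C := hq x (by simp)
      by_cases hxp : x ∈ p'.support
      · exact (ConnIn.of_mem_support (S := C \ A) (fun y hy => ⟨hp' y hy, hp'A y hy⟩) hxp).symm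
      · have hzA : z ∉ A := fun hz =>
          hx (hz.trans (.of_adj hxz.symm (hAR hz) ⟨hxC, hxp⟩))
        exact (ConnIn.of_adj (S := C \ A) hxz ⟨hxC, hx⟩ ⟨hq z (by simp), hzA⟩).trans
          (ih (fun y hy => hq y (by simp [hy])) hy hzA)
  refine ⟨A, ⟨fun x hx => (hAR hx).1, .of_center (c := u) fun x hx => ?_,
    .of_center (c := u') fun x hx => ?_, ⟨u, hu, huA⟩, ⟨u', hu', hp'A _ p'.start_mem_support⟩,
    ⟨w, hw, hwA⟩, ⟨w', hw', hp'A _ p'.end_mem_support⟩⟩, huA, hwA⟩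
  · obtain ⟨q, hq⟩ := hx
    exact ConnIn.symm ⟨q, fun y hy => ConnIn.of_mem_support hq hy⟩
  · obtain ⟨q, hq⟩ := F.connC x hx.1 u' hu'.1
    exact hconn q hq rfl hx.2

theorem exists_mem_forall_of_not_opposed [Finite V] {S : Set V} {𝓕 : Set (Set V)}
    (hne : 𝓕.Nonempty) (hS : ∀ A ∈ 𝓕, ∃ t ∈ S, t ∈ A)
    (hop : ∀ A ∈ 𝓕, ∀ A' ∈ 𝓕, ¬ Opposed S A A') : ∃ t ∈ S, ∀ A ∈ 𝓕, t ∈ A := by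
  obtain ⟨A, hA, hmin⟩ := 𝓕.toFinite.exists_minimalFor (fun A => (A ∩ S).ncard) 𝓕 hne
  obtain ⟨t, ht, htA⟩ := hS A hA
  refine ⟨t, ht, fun A' hA' => by_contra fun htA' => ?_⟩
  have hsub : A' ∩ S ⊆ A ∩ S := fun x hx =>
    ⟨by_contra fun hxA => hop A hA A' hA' ⟨⟨t, ht, htA, htA'⟩, x, hx.2, hxA, hx.1⟩, hx.2⟩
  have hlt : (A' ∩ S).ncard < (A ∩ S).ncard :=
    Set.ncard_lt_ncard ⟨hsub, fun h => htA' (h ⟨htA, ht⟩).1⟩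
  exact absurd (hmin hA' hlt.le) (not_le.2 hlt)

/-- There are contacts `u` of `Q₁` and `w` of `Q₂` in `C` such that each walk in `C` from `u` to `w`
meets each walk in `C` from a contact of `Q₁` to a contact of `Q₂`. -/
theorem exists_separating_pair [Finite V] (F : G.Frame U C Q₁ Q₂) (hT : (Tops).Nonempty)
    (hB : (Bots).Nonempty) : ∃ u ∈ Tops, ∃ w ∈ Bots, ∀ u' ∈ Tops, ∀ w' ∈ Bots,
      ∀ (p : G.Walk u w) (p' : G.Walk u' w'), (∀ x ∈ p.support, x ∈ C) →
        (∀ x ∈ p'.support, x ∈ C) → ∃ x ∈ p.support, x ∈ p'.support := by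
  suffices h : ∃ u ∈ Tops, ∃ w ∈ Bots, ∀ A, Split A → u ∈ A → w ∉ A by
    obtain ⟨u, hu, w, hw, h⟩ := h
    refine ⟨u, hu, w, hw, fun u' hu' w' hw' p p' hp hp' => ?_⟩
    by_contra! hd
    obtain ⟨A, hA, huA, hwA⟩ := F.exists_isSplit hu hw hu' hw' hp hp' hd
    exact h A hA huA hwA
  by_cases hex : ∃ A₀, Split A₀
  · obtain ⟨A₀, hA₀⟩ := hex
    let 𝓕 : Set (Set V) := {A | Split A ∧ Parallel Tops A A₀}
    have hne : 𝓕.Nonempty := ⟨A₀, hA₀, hA₀.top.imp fun t ht => ⟨ht.1, ht.2, ht.2⟩,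
      hA₀.top_diff.imp fun t ht => ⟨ht.1, ht.2, ht.2⟩⟩
    have hop : ∀ A ∈ 𝓕, ∀ A' ∈ 𝓕, ¬ Opposed Tops A A' := fun A hA A' hA' =>
      F.not_opposed_of_parallel hA₀ hA.1 hA'.1 hA.2 hA'.2
    obtain ⟨u, hu, huF⟩ := exists_mem_forall_of_not_opposed hne (fun A hA => hA.1.top) hop
    obtain ⟨w, hw, hwF⟩ := exists_mem_forall_of_not_opposed (S := Bots) (𝓕 := compl '' 𝓕)
      (hne.image _) (by rintro _ ⟨A, hA, rfl⟩; exact hA.1.bot_diff) (by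
        rintro _ ⟨A, hA, rfl⟩ _ ⟨A', hA', rfl⟩ h
        refine hop A' hA' A hA (F.opposed_top hA'.1 hA.1 ?_)
        simpa [Opposed, and_comm] using h)
    refine ⟨u, hu, w, hw, fun A hA huA => ?_⟩
    rcases hA.parallel_or_opposed_top hA₀ with h | h
    · exact hwF _ ⟨A, ⟨hA, h⟩, rfl⟩
    · have hA' := hA.compl (contacts_subset _ _) (contacts_subset _ _)
      have h' : Parallel Tops (C \ A) A₀ := by
        have := (parallel_diff (contacts_subset C Q₁)).2 h.symm
        simpa [Parallel, and_comm] using this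
      exact absurd huA (huF _ ⟨hA', h'⟩).2
  · obtain ⟨u, hu⟩ := hT
    obtain ⟨w, hw⟩ := hB
    exact ⟨u, hu, w, hw, fun A hA => absurd ⟨A, hA⟩ hex⟩

end Frame

/-- A walk together with its endpoints. -/
abbrev AnyWalk (G : SimpleGraph V) : Type := Σ u v, G.Walk u v

/-- The vertex set of a walk. -/
def AnyWalk.verts (p : G.AnyWalk) : Set V := {x | x ∈ p.2.2.support}

/-- The vertices on the first `s` walks of `P`. -/
def covered (P : ℕ → G.AnyWalk) (s : ℕ) : Set V := {x | ∃ i < s, x ∈ (P i).verts}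

/-- The indices of those among the first `s` walks of `P` that are adjacent to `S`. -/
def touching (P : ℕ → G.AnyWalk) (s : ℕ) (S : Set V) : Set ℕ :=
  {j | j < s ∧ ∃ u ∈ (P j).verts, ∃ v ∈ S, G.Adj u v}

/-- The first `s` walks of `P` form an initial segment of a neat reduction whose union is connected
and such that each component of the remaining graph is adjacent to at most two of them. -/
structure IsPartialReduction (P : ℕ → G.AnyWalk) (s : ℕ) : Prop where
  isPath : ∀ i < s, (P i).2.2.IsPath
  disj : ∀ i < s, Disjoint (covered P i) (P i).verts
  isometric : ∀ i < s, ∀ q : G.Walk (P i).1 (P i).2.1, (∀ x ∈ q.support, x ∉ covered P i) →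
    (P i).2.2.length ≤ q.length
  touching_nonempty : ∀ i < s, 0 < i → (touching P i (P i).verts).Nonempty
  touching_le : ∀ i < s, (touching P i (P i).verts).ncard ≤ 2
  conn : G.ConnSet (covered P s)
  component_le : ∀ v ∉ covered P s,
    (touching P s {x | G.ConnIn (covered P s)ᶜ v x}).ncard ≤ 2

section Extension

variable {P : ℕ → G.AnyWalk} {s : ℕ} {p : G.AnyWalk}

theorem finite_touching (S : Set V) : (touching P s S).Finite :=
  (Set.finite_Iio s).subset fun _ h => h.1

theorem touching_mono {S S' : Set V} (h : S ⊆ S') : touching P s S ⊆ touching P s S' :=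
  fun _ ⟨hj, u, hu, v, hv, huv⟩ => ⟨hj, u, hu, v, h hv, huv⟩

theorem update_of_lt {i : ℕ} (h : i < s) : Function.update P s p i = P i :=
  Function.update_of_ne h.ne _ _

theorem covered_update {i : ℕ} (h : i ≤ s) : covered (Function.update P s p) i = covered P i := by
  ext x
  refine exists_congr fun j => and_congr_right fun hj => ?_
  rw [update_of_lt (hj.trans_le h)]

theorem touching_update {i : ℕ} (h : i ≤ s) (S : Set V) :
    touching (Function.update P s p) i S = touching P i S := by
  ext j
  refine and_congr_right fun hj => ?_
  rw [update_of_lt (hj.trans_le h)]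

theorem covered_update_succ :
    covered (Function.update P s p) (s + 1) = covered P s ∪ p.verts := by
  ext x
  constructor
  · rintro ⟨i, hi, hx⟩
    rcases Nat.lt_succ_iff_lt_or_eq.1 hi with hi | rfl
    · exact .inl ⟨i, hi, by rwa [update_of_lt hi] at hx⟩
    · exact .inr (by simpa using hx)
  · rintro (⟨i, hi, hx⟩ | hx)
    · exact ⟨i, hi.trans s.lt_succ_self, by rwa [update_of_lt hi]⟩
    · exact ⟨s, s.lt_succ_self, by simpa using hx⟩

theorem touching_update_succ_subset (S : Set V) :
    touching (Function.update P s p) (s + 1) S ⊆ insert s (touching P s S) := by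
  rintro j ⟨hj, h⟩
  rcases Nat.lt_succ_iff_lt_or_eq.1 hj with hj | rfl
  · exact .inr ⟨hj, by rwa [update_of_lt hj] at h⟩
  · exact .inl rfl

theorem IsPartialReduction.update (h : IsPartialReduction P s) {v : V} (hv : v ∉ covered P s)
    (hp : p.2.2.IsPath) (hpC : ∀ x ∈ p.verts, G.ConnIn (covered P s)ᶜ v x)
    (hiso : ∀ q : G.Walk p.1 p.2.1, (∀ x ∈ q.support, x ∉ covered P s) →
      p.2.2.length ≤ q.length)
    (htouch : (touching P s p.verts).Nonempty)
    (hcomp : ∀ x, G.ConnIn (covered P s)ᶜ v x →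
      (touching P s {y | G.ConnIn (covered P s ∪ p.verts)ᶜ x y}).ncard ≤ 1) :
    IsPartialReduction (Function.update P s p) (s + 1) where
  isPath i hi := by
    rcases Nat.lt_succ_iff_lt_or_eq.1 hi with hi | rfl
    · rw [update_of_lt hi]; exact h.isPath i hi
    · rwa [Function.update_self]
  disj i hi := by
    rw [covered_update (Nat.lt_succ_iff.1 hi)]
    rcases Nat.lt_succ_iff_lt_or_eq.1 hi with hi | rfl
    · rw [update_of_lt hi]; exact h.disj i hi
    · rw [Function.update_self]
      exact Set.disjoint_right.2 fun x hx => (hpC x hx).right_mem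
  isometric i hi := by
    rw [covered_update (Nat.lt_succ_iff.1 hi)]
    rcases Nat.lt_succ_iff_lt_or_eq.1 hi with hi | rfl
    · rw [update_of_lt hi]; exact h.isometric i hi
    · rwa [Function.update_self]
  touching_nonempty i hi := by
    rw [touching_update (Nat.lt_succ_iff.1 hi)]
    rcases Nat.lt_succ_iff_lt_or_eq.1 hi with hi | rfl
    · rw [update_of_lt hi]; exact h.touching_nonempty i hi
    · rw [Function.update_self]; exact fun _ => htouch
  touching_le i hi := by
    rw [touching_update (Nat.lt_succ_iff.1 hi)]
    rcases Nat.lt_succ_iff_lt_or_eq.1 hi with hi | rfl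
    · rw [update_of_lt hi]; exact h.touching_le i hi
    · rw [Function.update_self]
      exact (Set.ncard_le_ncard (touching_mono hpC) (finite_touching _)).trans (h.component_le v hv)
  conn := by
    rw [covered_update_succ]
    obtain ⟨j, hj, a, ha, b, hb, hab⟩ := htouch
    exact h.conn.union (connSet_support p.2.2) ⟨j, hj, ha⟩ hb hab
  component_le x hx := by
    rw [covered_update_succ] at hx ⊢
    by_cases hvx : G.ConnIn (covered P s)ᶜ v x
    · refine (Set.ncard_le_ncard (touching_update_succ_subset _)
        ((finite_touching _).insert s)).trans ((Set.ncard_insert_le _ _).trans ?_)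
      exact Nat.succ_le_succ (hcomp x hvx)
    · refine (Set.ncard_le_ncard ?_ (finite_touching _)).trans
        (h.component_le x fun hx' => hx (.inl hx'))
      have hmono : ∀ {y}, G.ConnIn (covered P s ∪ p.verts)ᶜ x y → G.ConnIn (covered P s)ᶜ x y :=
        fun hy => hy.mono (Set.compl_subset_compl.2 Set.subset_union_left)
      rintro j hj
      rcases touching_update_succ_subset _ hj with rfl | hj'
      · obtain ⟨-, a, ha, y, hy, hay⟩ := hj
        rw [Function.update_self] at ha
        have hva := hpC a ha
        exact absurd (hva.trans ((ConnIn.of_adj hay hva.right_mem (hmono hy).right_mem).trans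
          (hmono hy).symm)) hvx
      · exact touching_mono (fun y hy => hmono hy) hj'

theorem IsPartialReduction.exists_extension [Finite V] (hG : G.Connected) (hplanar : IsPlanar G)
    (h : IsPartialReduction P s) (hs : 0 < s) {v : V} (hv : v ∉ covered P s) :
    ∃ p : G.AnyWalk, IsPartialReduction (Function.update P s p) (s + 1) ∧
      Disjoint (covered P s) p.verts := by
  set U := covered P s
  let C : Set V := {x | G.ConnIn Uᶜ v x}
  have hUC : Disjoint U C := Set.disjoint_right.2 fun x hx => hx.right_mem
  have hvC : v ∈ C := .refl hv
  have hC : G.ConnSet C := by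
    refine .of_center (c := v) fun x hx => ?_
    obtain ⟨q, hq⟩ := hx
    exact ConnIn.symm ⟨q, fun y hy => ConnIn.of_mem_support hq hy⟩
  have hcompC : ∀ (p : G.AnyWalk) (x : V), x ∈ C → {y | G.ConnIn (U ∪ p.verts)ᶜ x y} ⊆ C :=
    fun p x hx y hy => hx.trans (hy.mono (Set.compl_subset_compl.2 Set.subset_union_left))
  have hN : (touching P s C).Nonempty := by
    obtain ⟨q⟩ := hG.preconnected v (P 0).1
    obtain ⟨d, -, hd, hd'⟩ := q.exists_boundary_dart C hvC fun hx =>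
      hx.right_mem ⟨0, hs, (P 0).2.2.start_mem_support⟩
    have : d.snd ∈ U := by_contra fun hU' =>
      hd' (hd.trans (.of_adj d.adj hd.right_mem hU'))
    obtain ⟨j, hj, hjd⟩ := this
    exact ⟨j, hj, d.snd, hjd, d.fst, hd, d.adj.symm⟩
  suffices hmain : ∃ p : G.AnyWalk, p.2.2.IsPath ∧ p.verts ⊆ C ∧
      (∀ q : G.Walk p.1 p.2.1, (∀ x ∈ q.support, x ∉ U) → p.2.2.length ≤ q.length) ∧
      (touching P s p.verts).Nonempty ∧
      ∀ x ∈ C, (touching P s {y | G.ConnIn (U ∪ p.verts)ᶜ x y}).ncard ≤ 1 by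
    obtain ⟨p, h1, h2, h3, h4, h5⟩ := hmain
    exact ⟨p, h.update hv h1 h2 h3 h4 h5, hUC.mono_right h2⟩
  obtain ⟨i, hi⟩ := hN
  obtain ⟨his, a, ha, b, hb, hab⟩ := hi
  by_cases hle : (touching P s C).ncard ≤ 1
  · refine ⟨⟨b, b, .nil⟩, .nil, ?_, fun q _ => Nat.zero_le _, ⟨i, his, a, ha, b, ?_, hab⟩,
      fun x hx => ?_⟩
    · intro x hx
      have hx : x = b := by simpa [AnyWalk.verts] using hx
      exact hx ▸ hb
    · simp [AnyWalk.verts]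
    · exact (Set.ncard_le_ncard (touching_mono (hcompC _ x hx)) (finite_touching _)).trans hle
  · have htwo : (touching P s C).ncard = 2 := le_antisymm (h.component_le v hv) (not_le.1 hle)
    obtain ⟨j, k, hjk, hjkC⟩ := Set.ncard_eq_two.1 htwo
    have hj : j ∈ touching P s C := hjkC ▸ Set.mem_insert j {k}
    have hk : k ∈ touching P s C := hjkC ▸ Set.mem_insert_of_mem j rfl
    have hdisj : Disjoint (P j).verts (P k).verts := by
      rcases hjk.lt_or_gt with hlt | hlt
      · exact Set.disjoint_left.2 fun x hx =>
          Set.disjoint_left.1 (h.disj k hk.1) ⟨j, hlt, hx⟩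
      · exact Set.disjoint_right.2 fun x hx =>
          Set.disjoint_left.1 (h.disj j hj.1) ⟨k, hlt, hx⟩
    have F : G.Frame U C (P j).verts (P k).verts := ⟨hplanar, h.conn, hC, connSet_support _,
      connSet_support _, fun x hx => ⟨j, hj.1, hx⟩, fun x hx => ⟨k, hk.1, hx⟩, hdisj, hUC⟩
    obtain ⟨hj', a₁, ha₁, b₁, hb₁, hab₁⟩ := hj
    obtain ⟨-, a₂, ha₂, b₂, hb₂, hab₂⟩ := hk
    obtain ⟨u, hu, w, hw, hsep⟩ :=
      F.exists_separating_pair ⟨b₁, hb₁, a₁, ha₁, hab₁⟩ ⟨b₂, hb₂, a₂, ha₂, hab₂⟩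
    classical
    obtain ⟨q, hq, hqmin⟩ := exists_minimalFor_of_wellFoundedLT
      (fun q : G.Walk u w => ∀ x ∈ q.support, x ∈ Uᶜ) Walk.length (hu.1.symm.trans hw.1)
    have hqC : ∀ x ∈ q.bypass.support, x ∈ C := fun x hx =>
      hu.1.trans (ConnIn.of_mem_support hq (q.support_bypass_subset_support hx))
    refine ⟨⟨u, w, q.bypass⟩, q.bypass_isPath, hqC, fun q' hq' => ?_, ?_, fun x hx => ?_⟩
    · exact q.length_bypass_le_length.trans ((le_total _ _).elim id (hqmin hq'))
    · obtain ⟨-, c, hc, hcu⟩ := hu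
      exact ⟨j, hj', c, hc, u, q.bypass.start_mem_support, hcu⟩
    · have hsub := touching_mono (P := P) (s := s) (hcompC ⟨u, w, q.bypass⟩ x hx)
      refine (Set.ncard_le_one_iff (finite_touching _)).2 fun {m n} hm hn => ?_
      let N := touching P s {y | G.ConnIn (U ∪ AnyWalk.verts ⟨u, w, q.bypass⟩)ᶜ x y}
      have key : ∀ m ∈ N, ∀ n ∈ N, m = j → n ≠ k := by
        rintro _ ⟨-, c, hc, y, hy, hcy⟩ _ ⟨-, d, hd, z, hz, hdz⟩ rfl rfl
        obtain ⟨r, hr⟩ := hy.symm.trans hz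
        obtain ⟨t, ht, htr⟩ := hsep y ⟨hcompC _ x hx hy, c, hc, hcy⟩ z
          ⟨hcompC _ x hx hz, d, hd, hdz⟩ q.bypass r hqC fun t ht =>
            hcompC ⟨u, w, q.bypass⟩ x hx (hy.trans (ConnIn.of_mem_support hr ht))
        exact hr t htr (.inr ht)
      have h1 : m = j ∨ m = k := by simpa [hjkC] using hsub hm
      have h2 : n = j ∨ n = k := by simpa [hjkC] using hsub hn
      have h3 := key m hm n hn
      have h4 := key n hn m hm
      grind

theorem isPartialReduction_one (v : V) :
    IsPartialReduction (fun _ => (⟨v, v, .nil⟩ : G.AnyWalk)) 1 where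
  isPath _ _ := .nil
  disj i hi := by
    obtain rfl := Nat.lt_one_iff.1 hi
    exact Set.disjoint_left.2 fun x ⟨j, hj, _⟩ => absurd hj (Nat.not_lt_zero j)
  isometric _ _ _ _ := Nat.zero_le _
  touching_nonempty i hi hi' := by omega
  touching_le i hi := (Set.ncard_le_ncard (t := {0}) fun j hj => by
    have := hj.1
    rw [Set.mem_singleton_iff]
    omega).trans (by simp)
  conn := by
    have : covered (fun _ => (⟨v, v, .nil⟩ : G.AnyWalk)) 1 = {v} := by
      ext x
      simp [covered, AnyWalk.verts]
    rw [this]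
    rintro x rfl y rfl
    exact .refl rfl
  component_le x hx := (Set.ncard_le_ncard (t := {0}) fun j hj => by
    have := hj.1
    rw [Set.mem_singleton_iff]
    omega).trans (by simp)

theorem IsPartialReduction.exists_covered_eq_univ [Finite V] (hG : G.Connected)
    (hplanar : IsPlanar G) (h : IsPartialReduction P s) (hs : 0 < s) :
    ∃ (P' : ℕ → G.AnyWalk) (s' : ℕ), IsPartialReduction P' s' ∧ covered P' s' = Set.univ := by
  induction hn : (covered P s)ᶜ.ncard using Nat.strong_induction_on generalizing P s with
  | _ n ih =>
    by_cases hU : covered P s = Set.univ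
    · exact ⟨P, s, h, hU⟩
    · obtain ⟨v, hv⟩ := (Set.ne_univ_iff_exists_notMem _).1 hU
      obtain ⟨p, hp, hd⟩ := h.exists_extension hG hplanar hs hv
      refine ih _ ?_ hp s.succ_pos rfl
      rw [← hn, covered_update_succ]
      have hstart : p.1 ∈ p.verts := p.2.2.start_mem_support
      exact Set.ncard_lt_ncard ⟨Set.compl_subset_compl.2 Set.subset_union_left,
        fun hsub => hsub (Set.disjoint_right.1 hd hstart) (.inr hstart)⟩

end Extension

end SimpleGraph

/-- Every connected finite planar graph contains a neat reduction: an isometric-path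
decomposition `P_0, …, P_{s-1}` (here `P_i` is the path `W i` from `A i` to `B i`; the
supports partition `V(G)` and each `W i` is isometric in the graph obtained by deleting
the supports of the earlier paths) such that for every `i ≥ 1` the path `P_i` is adjacent
to at least one and at most two of the paths `P_j` with `j < i`. -/
theorem exists_neat_reduction {V : Type} [Fintype V] (G : SimpleGraph V)
    (hconn : G.Connected) (hplanar : IsPlanar G) :
    ∃ (s : ℕ) (A B : Fin s → V) (W : ∀ i : Fin s, G.Walk (A i) (B i)),
      (∀ i, (W i).IsPath) ∧
      (∀ v : V, ∃! i : Fin s, v ∈ (W i).support) ∧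
      (∀ i : Fin s, ∀ q : G.Walk (A i) (B i),
        (∀ x ∈ q.support, ∀ j : Fin s, j < i → x ∉ (W j).support) →
        (W i).length ≤ q.length) ∧
      (∀ i : Fin s, 0 < (i : ℕ) →
        1 ≤ {j : Fin s | j < i ∧
              ∃ u ∈ (W j).support, ∃ v ∈ (W i).support, G.Adj u v}.ncard ∧
        {j : Fin s | j < i ∧
              ∃ u ∈ (W j).support, ∃ v ∈ (W i).support, G.Adj u v}.ncard ≤ 2) := by
  obtain ⟨v⟩ := hconn.nonempty
  obtain ⟨P, s, h, hU⟩ :=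
    (SimpleGraph.isPartialReduction_one v).exists_covered_eq_univ hconn hplanar one_pos
  refine ⟨s, fun i => (P i).1, fun i => (P i).2.1, fun i => (P i).2.2, fun i => h.isPath i i.2,
    fun v => ?_, fun i q hq => h.isometric i i.2 q fun x hx ⟨j, hj, hxj⟩ =>
      hq x hx ⟨j, hj.trans i.2⟩ hj hxj, fun i hi => ?_⟩
  · obtain ⟨i, hi, hv⟩ : v ∈ SimpleGraph.covered P s := hU ▸ Set.mem_univ v
    refine ⟨⟨i, hi⟩, hv, fun j hj => Fin.ext ?_⟩
    by_contra hne
    rcases Nat.lt_or_gt_of_ne hne with hlt | hlt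
    · exact Set.disjoint_left.1 (h.disj i hi) ⟨j, hlt, hj⟩ hv
    · exact Set.disjoint_left.1 (h.disj j j.2) ⟨i, hlt, hv⟩ hj
  · have himage : (fun j : Fin s => (j : ℕ)) '' {j : Fin s | j < i ∧
        ∃ u ∈ (P j).2.2.support, ∃ v ∈ (P i).2.2.support, G.Adj u v} =
        SimpleGraph.touching P i (P i).verts := by
      ext j
      constructor
      · rintro ⟨j, hj, rfl⟩
        exact hj
      · exact fun hj => ⟨⟨j, hj.1.trans i.2⟩, hj, rfl⟩
    rw [← Set.ncard_image_of_injective _ Fin.val_injective, himage]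
    exact ⟨(Set.ncard_pos (SimpleGraph.finite_touching _)).2 (h.touching_nonempty i i.2 hi),
      h.touching_le i i.2⟩
end
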